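/- Let R be a Cohen-Macaulay commutative noetherian ring with a dualizing module D, let p ∈ Spec(R) with h = ht(p), and let M be an R-module. Then for all k there are isomorphisms Tor_k^R(Hom_R(D, E_R(R/p)), M) ≅ H^{h−k}_p(M_p) ≅ H^{h−k}_{pR_p}(M_p), where H^i denotes local cohomology. -/

import Mathlib

/-!
Common definitions: property t(p), injective hulls, (C-)Gorenstein injective modules,
(C-)Gorenstein injective / injective / flat dimensions, small support, torsion functor,
Tor and Ext modules, semidualizing and dualizing modules, depth, Cohen-Macaulay rings,
Serre's condition (S₁), Gorenstein local rings, minimal injective resolutions.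
-/

universe u

open CategoryTheory Limits DirectSum

noncomputable section

/-- An `R`-module `S` has property `t(p)`: multiplication by every `r ∉ p` is bijective on `S`,
and every element of `S` is annihilated by a power of `p`. -/
def PropT (R : Type u) [CommRing R] (p : Ideal R) (S : Type u) [AddCommGroup S]
    [Module R S] : Prop :=
  (∀ r : R, r ∉ p → Function.Bijective (fun s : S => r • s)) ∧
  (∀ x : S, ∃ m : ℕ, 0 < m ∧ ∀ a ∈ p ^ m, a • x = 0)

/-- `E` is an injective hull of `N` over `R`: `E` is injective and `N` embeds in `E` as an
essential submodule. -/
def IsInjectiveHull (R : Type u) [CommRing R] (N : Type u) [AddCommGroup N] [Module R N]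
    (E : Type u) [AddCommGroup E] [Module R E] : Prop :=
  Module.Injective R E ∧ ∃ ι : N →ₗ[R] E, Function.Injective ι ∧
    ∀ K : Submodule R E, K ≠ ⊥ → K ⊓ LinearMap.range ι ≠ ⊥

/-- A complete injective resolution: a doubly infinite exact sequence of injective modules
which stays exact after applying `Hom_R(-, I)` for every injective module `I`. -/
structure CompleteInjRes (R : Type u) [CommRing R] where
  E : ℤ → Type u
  [acg : ∀ i, AddCommGroup (E i)]
  [mod : ∀ i, Module R (E i)]
  d : ∀ i, E i →ₗ[R] E (i + 1)
  inj : ∀ i, Module.Injective R (E i)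
  exct : ∀ i, LinearMap.range (d i) = LinearMap.ker (d (i + 1))
  homExact : ∀ (I : Type u) [AddCommGroup I] [Module R I], Module.Injective R I →
    ∀ (i : ℤ) (g : E (i + 1) →ₗ[R] I), g ∘ₗ d i = 0 →
      ∃ h : E (i + 1 + 1) →ₗ[R] I, h ∘ₗ d (i + 1) = g

attribute [instance] CompleteInjRes.acg CompleteInjRes.mod

/-- `G` is a Gorenstein injective `R`-module: it is the image of some map in a complete
injective resolution. -/
def GorensteinInjective (R : Type u) [CommRing R] (G : Type u) [AddCommGroup G]
    [Module R G] : Prop :=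
  ∃ X : CompleteInjRes R, Nonempty (G ≃ₗ[R] LinearMap.range (X.d 0))

/-- A complete `I_C I`-resolution: an exact sequence
`⋯ → Hom(C,I₁) → Hom(C,I₀) → I⁰ → I¹ → ⋯` (terms in nonnegative degrees are injective,
terms in negative degrees are of the form `Hom_R(C, I)` with `I` injective) such that
`Hom_R(Hom_R(C,J), -)` leaves it exact for every injective `R`-module `J`. -/
structure CompleteICIRes (R : Type u) [CommRing R] (C : Type u) [AddCommGroup C]
    [Module R C] where
  X : ℤ → Type u
  [acg : ∀ i, AddCommGroup (X i)]
  [mod : ∀ i, Module R (X i)]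
  d : ∀ i, X i →ₗ[R] X (i + 1)
  exct : ∀ i, LinearMap.range (d i) = LinearMap.ker (d (i + 1))
  injPos : ∀ i : ℤ, 0 ≤ i → Module.Injective R (X i)
  homCInjNeg : ∀ i : ℤ, i < 0 → ∃ (I : Type u) (_ : AddCommGroup I) (_ : Module R I),
    Module.Injective R I ∧ Nonempty (X i ≃ₗ[R] (C →ₗ[R] I))
  homExact : ∀ (J : Type u) [AddCommGroup J] [Module R J], Module.Injective R J →
    ∀ (i : ℤ) (g : (C →ₗ[R] J) →ₗ[R] X (i + 1)), d (i + 1) ∘ₗ g = 0 →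
      ∃ h : (C →ₗ[R] J) →ₗ[R] X i, d i ∘ₗ h = g

attribute [instance] CompleteICIRes.acg CompleteICIRes.mod

/-- `G` is a `C`-Gorenstein injective `R`-module: it is the image of the map
`Hom_R(C, I₀) → I⁰` in some complete `I_C I`-resolution. -/
def CGorensteinInjective (R : Type u) [CommRing R] (C : Type u) [AddCommGroup C] [Module R C]
    (G : Type u) [AddCommGroup G] [Module R G] : Prop :=
  ∃ X : CompleteICIRes R C, Nonempty (G ≃ₗ[R] LinearMap.range (X.d (-1)))

/-- `M` has a `C`-Gorenstein injective coresolution `0 → M → G⁰ → ⋯ → Gⁿ → 0`,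
i.e. `C`-Gorenstein injective dimension at most `n`. -/
def CGidLE (R : Type u) [CommRing R] (C : Type u) [AddCommGroup C] [Module R C] :
    ℕ → ModuleCat.{u} R → Prop
  | 0, M => CGorensteinInjective R C M
  | n + 1, M => ∃ (G : ModuleCat.{u} R), CGorensteinInjective R C G ∧
      ∃ ι : M →ₗ[R] G, Function.Injective ι ∧
        CGidLE R C n (ModuleCat.of R (G ⧸ LinearMap.range ι))

/-- The `C`-Gorenstein injective dimension of `M` (equal to `⊤` if `M` admits no bounded
coresolution by `C`-Gorenstein injective modules). -/
def CGid (R : Type u) [CommRing R] (C : Type u) [AddCommGroup C] [Module R C]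
    (M : Type u) [AddCommGroup M] [Module R M] : ℕ∞ :=
  sInf {n : ℕ∞ | ∃ m : ℕ, (m : ℕ∞) = n ∧ CGidLE R C m (ModuleCat.of R M)}

/-- There exists an exact sequence `0 → N → Gₙ → ⋯ → G₁ → M → 0` in which each `Gᵢ` is
`C`-Gorenstein injective (and `N` is arbitrary). -/
def CGICoresApprox (R : Type u) [CommRing R] (C : Type u) [AddCommGroup C] [Module R C] :
    ℕ → ModuleCat.{u} R → Prop
  | 0, _ => True
  | n + 1, M => ∃ (G : ModuleCat.{u} R), CGorensteinInjective R C G ∧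
      ∃ π : G →ₗ[R] M, Function.Surjective π ∧
        CGICoresApprox R C n (ModuleCat.of R (LinearMap.ker π))

/-- The `a`-torsion submodule `Γ_a(N)` of `N`. -/
def torsionSubmodule (R : Type u) [CommRing R] (a : Ideal R) (N : Type u) [AddCommGroup N]
    [Module R N] : Submodule R N :=
  ⨆ m : ℕ, Submodule.torsionBySet R N ((a ^ m : Ideal R) : Set R)

/-- `Tor_i^R(M, N)`, as an object of `ModuleCat R`. -/
abbrev TorM (R : Type u) [CommRing R] (i : ℕ) (M N : Type u) [AddCommGroup M] [Module R M]
    [AddCommGroup N] [Module R N] : ModuleCat.{u} R :=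
  ((Tor (ModuleCat.{u} R) i).obj (ModuleCat.of R M)).obj (ModuleCat.of R N)

/-- `Ext_R^i(M, N)`, as an object of `ModuleCat R`. -/
abbrev ExtM (R : Type u) [CommRing R] (i : ℕ) (M N : Type u) [AddCommGroup M] [Module R M]
    [AddCommGroup N] [Module R N] : ModuleCat.{u} R :=
  ((Ext R (ModuleCat.{u} R) i).obj (Opposite.op (ModuleCat.of R M))).obj (ModuleCat.of R N)

/-- The small support of `M`: primes `p` such that `Tor_i^R(κ(p), M) ≠ 0` for some `i`,
where `κ(p)` is the residue field of `R_p`. -/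
def smallSupport (R : Type u) [CommRing R] (M : Type u) [AddCommGroup M] [Module R M] :
    Set (PrimeSpectrum R) :=
  {p | ∃ i : ℕ,
    Nontrivial (TorM R i (IsLocalRing.ResidueField (Localization.AtPrime p.asIdeal)) M)}

/-- `C` is a semidualizing `R`-module: finitely generated, the homothety map
`R → Hom_R(C,C)` is bijective, and `Ext_R^i(C,C) = 0` for `i ≥ 1`. -/
def IsSemidualizing (R : Type u) [CommRing R] (C : Type u) [AddCommGroup C] [Module R C] : Prop :=
  Module.Finite R C ∧
  Function.Bijective (fun r : R => (r • LinearMap.id : C →ₗ[R] C)) ∧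
  ∀ i : ℕ, 1 ≤ i → Subsingleton (ExtM R i C C)

/-- `M` has injective dimension at most `n`. -/
def InjDimLE (R : Type u) [CommRing R] : ℕ → ModuleCat.{u} R → Prop
  | 0, M => Module.Injective R M
  | n + 1, M => ∃ (I : ModuleCat.{u} R), Module.Injective R I ∧
      ∃ ι : M →ₗ[R] I, Function.Injective ι ∧
        InjDimLE R n (ModuleCat.of R (I ⧸ LinearMap.range ι))

/-- `M` has flat dimension at most `n`. -/
def FlatDimLE (R : Type u) [CommRing R] : ℕ → ModuleCat.{u} R → Prop
  | 0, M => Module.Flat R M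
  | n + 1, M => ∃ (F : ModuleCat.{u} R), Module.Flat R F ∧
      ∃ π : F →ₗ[R] M, Function.Surjective π ∧
        FlatDimLE R n (ModuleCat.of R (LinearMap.ker π))

/-- `D` is a dualizing `R`-module: semidualizing of finite injective dimension. -/
def IsDualizing (R : Type u) [CommRing R] (D : Type u) [AddCommGroup D] [Module R D] : Prop :=
  IsSemidualizing R D ∧ ∃ n : ℕ, InjDimLE R n (ModuleCat.of R D)

/-- The depth of a local ring: the supremum of lengths of regular sequences contained in
the maximal ideal. -/
def localRingDepth (A : Type u) [CommRing A] [IsLocalRing A] : ℕ∞ :=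
  sSup {n : ℕ∞ | ∃ rs : List A, (∀ r ∈ rs, r ∈ IsLocalRing.maximalIdeal A) ∧
    RingTheory.Sequence.IsRegular A rs ∧ (rs.length : ℕ∞) = n}

/-- `R` is a Cohen-Macaulay ring: for each prime `p`, `depth (R_p) = dim (R_p)`. -/
def IsCohenMacaulayRing (R : Type u) [CommRing R] : Prop :=
  ∀ (p : Ideal R) (_ : p.IsPrime),
    (localRingDepth (Localization.AtPrime p) : WithBot ℕ∞) =
      ringKrullDim (Localization.AtPrime p)

/-- Serre's condition `(S₁)`: `depth (R_p) ≥ min (ht p, 1)` for every prime `p`. -/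
def SerreS1 (R : Type u) [CommRing R] : Prop :=
  ∀ (p : Ideal R) (hp : p.IsPrime),
    min (Order.height (⟨p, hp⟩ : PrimeSpectrum R)) 1 ≤ localRingDepth (Localization.AtPrime p)

/-- A Gorenstein local ring: a noetherian local ring of finite self-injective dimension. -/
def IsGorensteinLocalRing (A : Type u) [CommRing A] : Prop :=
  IsLocalRing A ∧ IsNoetherianRing A ∧ ∃ n : ℕ, InjDimLE A n (ModuleCat.of A A)

/-- A minimal injective resolution `0 → D → J⁰ → J¹ → ⋯` of `D`: an exact sequence with all
`Jⁱ` injective, in which the kernel of each differential is an essential submodule. -/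
structure MinimalInjRes (R : Type u) [CommRing R] (D : Type u) [AddCommGroup D]
    [Module R D] where
  J : ℕ → Type u
  [acg : ∀ i, AddCommGroup (J i)]
  [mod : ∀ i, Module R (J i)]
  ε : D →ₗ[R] J 0
  d : ∀ i, J i →ₗ[R] J (i + 1)
  inj : ∀ i, Module.Injective R (J i)
  ε_inj : Function.Injective ε
  exct0 : LinearMap.range ε = LinearMap.ker (d 0)
  exct : ∀ i, LinearMap.range (d i) = LinearMap.ker (d (i + 1))
  minimal : ∀ i, ∀ K : Submodule R (J i), K ≠ ⊥ → K ⊓ LinearMap.ker (d i) ≠ ⊥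

attribute [instance] MinimalInjRes.acg MinimalInjRes.mod

end

section HomologyClasses

variable {R : Type u} [CommRing R] {ι : Type*} {c : ComplexShape ι}

/-- The inclusion of cocycles, seen as elements, into the categorical cycles. -/
noncomputable def toHomologicalCycles (K : HomologicalComplex (ModuleCat.{u} R) c) (i j : ι)
    (hj : c.next i = j) : LinearMap.ker (K.d i j).hom →ₗ[R] K.cycles i :=
  (K.liftCycles (ModuleCat.ofHom (LinearMap.ker (K.d i j).hom).subtype) j hj
    (by ext x; exact x.2)).hom

theorem iCycles_toHomologicalCycles (K : HomologicalComplex (ModuleCat.{u} R) c) (i j : ι)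
    (hj : c.next i = j) (x : LinearMap.ker (K.d i j).hom) :
    (K.iCycles i).hom (toHomologicalCycles K i j hj x) = x.1 := by
  have h := K.liftCycles_i (ModuleCat.ofHom (LinearMap.ker (K.d i j).hom).subtype) j hj
    (by ext x; exact x.2)
  have h2 := LinearMap.congr_fun (congrArg ModuleCat.Hom.hom h) x
  exact h2

theorem iCycles_injective (K : HomologicalComplex (ModuleCat.{u} R) c) (i : ι) :
    Function.Injective (K.iCycles i).hom :=
  (ModuleCat.mono_iff_injective (K.iCycles i)).1 inferInstance

/-- The class map from cocycles of a complex of modules to its homology. -/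
noncomputable def homologyClass (K : HomologicalComplex (ModuleCat.{u} R) c) (i j : ι)
    (hj : c.next i = j) : LinearMap.ker (K.d i j).hom →ₗ[R] K.homology i :=
  (K.homologyπ i).hom ∘ₗ toHomologicalCycles K i j hj

theorem homologyClass_surjective (K : HomologicalComplex (ModuleCat.{u} R) c) (i j : ι)
    (hj : c.next i = j) : Function.Surjective (homologyClass K i j hj) := by
  intro x
  obtain ⟨z, rfl⟩ := (ModuleCat.epi_iff_surjective (K.homologyπ i)).1 inferInstance x
  have hz : (K.iCycles i).hom z ∈ LinearMap.ker (K.d i j).hom :=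
    LinearMap.congr_fun (congrArg ModuleCat.Hom.hom (K.iCycles_d i j)) z
  refine ⟨⟨_, hz⟩, congrArg (K.homologyπ i).hom (iCycles_injective K i ?_)⟩
  exact iCycles_toHomologicalCycles K i j hj ⟨_, hz⟩

theorem homologyClass_eq_zero_iff (K : HomologicalComplex (ModuleCat.{u} R) c) (k i j : ι)
    (hk : c.prev i = k) (hj : c.next i = j) (x : LinearMap.ker (K.d i j).hom) :
    homologyClass K i j hj x = 0 ↔ ∃ y, (K.d k i).hom y = x.1 := by
  have hex := (ShortComplex.ShortExact.moduleCat_exact_iff_function_exact _).1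
    (ShortComplex.exact_of_g_is_cokernel
    (ShortComplex.mk _ _ (K.toCycles_comp_homologyπ k i)) (K.homologyIsCokernel k i hk))
  refine (hex (toHomologicalCycles K i j hj x)).trans (exists_congr fun y => ?_)
  rw [← iCycles_toHomologicalCycles K i j hj x, ← K.toCycles_i k i]
  exact (iCycles_injective K i).eq_iff.symm

theorem homologyMap_homologyClass {K L : HomologicalComplex (ModuleCat.{u} R) c} (φ : K ⟶ L)
    (i j : ι) (hj : c.next i = j) (x : LinearMap.ker (K.d i j).hom)
    (hx : (φ.f i).hom x.1 ∈ LinearMap.ker (L.d i j).hom) :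
    (HomologicalComplex.homologyMap φ i).hom (homologyClass K i j hj x) =
      homologyClass L i j hj ⟨(φ.f i).hom x.1, hx⟩ := by
  refine (LinearMap.congr_fun (congrArg ModuleCat.Hom.hom
    (HomologicalComplex.homologyπ_naturality φ i)) (toHomologicalCycles K i j hj x)).trans ?_
  refine congrArg (L.homologyπ i).hom (iCycles_injective L i ?_)
  rw [iCycles_toHomologicalCycles]
  refine (LinearMap.congr_fun (congrArg ModuleCat.Hom.hom
    (HomologicalComplex.cyclesMap_i φ i)) (toHomologicalCycles K i j hj x)).trans ?_
  exact congrArg (φ.f i).hom (iCycles_toHomologicalCycles K i j hj x)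

end HomologyClasses

section ClassicalExt

variable {R : Type u} [CommRing R]

/-- The class in `Ext` of a cocycle on a projective resolution. -/
noncomputable def extClassOf {X : ModuleCat.{u} R} (P : ProjectiveResolution X)
    (Y : ModuleCat.{u} R) (n : ℕ) :
    LinearMap.ker ((P.complex.linearYonedaObj R Y).d n (n + 1)).hom →ₗ[R]
      ((Ext R (ModuleCat.{u} R) n).obj (Opposite.op X)).obj Y :=
  (P.isoExt n Y).inv.hom ∘ₗ homologyClass (P.complex.linearYonedaObj R Y) n (n+1) (by simp)

theorem extClassOf_naturality {X X' : ModuleCat.{u} R} (P : ProjectiveResolution X)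
    (P' : ProjectiveResolution X') (g : X' ⟶ X) (φ : ProjectiveResolution.Hom P' P g)
    (Y : ModuleCat.{u} R) (n : ℕ)
    (f : LinearMap.ker ((P.complex.linearYonedaObj R Y).d n (n + 1)).hom)
    (hf : (φ.hom.f n ≫ (f.1 : P.complex.X n ⟶ Y) : P'.complex.X n ⟶ Y) ∈
      LinearMap.ker ((P'.complex.linearYonedaObj R Y).d n (n + 1)).hom) :
    (((Ext R (ModuleCat.{u} R) n).map g.op).app Y).hom (extClassOf P Y n f) =
      extClassOf P' Y n ⟨_, hf⟩ := by
  let F := ((linearYoneda R (ModuleCat.{u} R)).obj Y).rightOp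
  have h1 := P'.isoLeftDerivedObj_hom_naturality g P φ.hom φ.hom_f_zero_comp_π_f_zero F n
  let ψ : P.complex.linearYonedaObj R Y ⟶ P'.complex.linearYonedaObj R Y :=
    (HomologicalComplex.unopFunctor _ _).map ((F.mapHomologicalComplex _).map φ.hom).op
  have h2 := HomologicalComplex.homologyOp_hom_naturality ψ n
  have h3 : ((Ext R (ModuleCat.{u} R) n).map g.op).app Y = ((F.leftDerived n).map g).unop := rfl
  have key : (P.isoExt n Y).inv ≫ ((Ext R (ModuleCat.{u} R) n).map g.op).app Y =
      HomologicalComplex.homologyMap ψ n ≫ (P'.isoExt n Y).inv := by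
    rw [h3]
    have h4 := congrArg Quiver.Hom.unop h1
    have h5 : HomologicalComplex.homologyMap ((F.mapHomologicalComplex _).map φ.hom) n ≫
        (HomologicalComplex.homologyOp (P.complex.linearYonedaObj R Y) n).hom =
        (HomologicalComplex.homologyOp (P'.complex.linearYonedaObj R Y) n).hom ≫
          (HomologicalComplex.homologyMap ψ n).op := h2
    have h6 := congrArg Quiver.Hom.unop h5
    change ((HomologicalComplex.homologyOp (P.complex.linearYonedaObj R Y) n).hom.unop ≫
      (P.isoLeftDerivedObj F n).hom.unop) ≫ ((F.leftDerived n).map g).unop =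
      HomologicalComplex.homologyMap ψ n ≫
        (HomologicalComplex.homologyOp (P'.complex.linearYonedaObj R Y) n).hom.unop ≫
        (P'.isoLeftDerivedObj F n).hom.unop
    refine (Category.assoc _ _ _).trans ?_
    refine (congrArg (_ ≫ ·) h4).trans ?_
    refine (Category.assoc _ _ _).symm.trans ?_
    refine (congrArg (· ≫ _) h6).trans ?_
    exact Category.assoc _ _ _
  refine (LinearMap.congr_fun (congrArg ModuleCat.Hom.hom key) _).trans ?_
  refine congrArg (P'.isoExt n Y).inv.hom ?_
  exact homologyMap_homologyClass ψ n (n+1) (by simp) f hf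

end ClassicalExt

theorem extMk_zero_eq_zero_iff {R : Type u} [CommRing R] {X Y : ModuleCat.{u} R}
    (P : ProjectiveResolution X) (f : P.complex.X 0 ⟶ Y)
    (hf : P.complex.d 1 0 ≫ f = 0) : P.extMk f 1 rfl hf = 0 ↔ f = 0 := by
  refine ⟨fun h => ?_, fun h => by subst h; simp⟩
  rw [← P.extEquivCohomologyClass.apply_eq_iff_eq,
    ProjectiveResolution.extEquivCohomologyClass_extMk,
    ProjectiveResolution.extEquivCohomologyClass_zero,
    CochainComplex.HomComplex.CohomologyClass.mk_eq_zero_iff,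
    CochainComplex.HomComplex.Cocycle.toSingleMk_mem_coboundaries_iff _ _ _ _ _ 1 (by simp)] at h
  obtain ⟨g, hg⟩ := h
  have hz : IsZero (P.cochainComplex.X 1) :=
    CochainComplex.isZero_of_isStrictlyLE _ 0 1 (by simp)
  rw [hz.eq_of_src g 0, comp_zero] at hg
  rw [← cancel_epi (P.cochainComplexXIso (-((0 : ℕ) : ℤ)) 0 rfl).hom, comp_zero]
  exact hg.symm

section

variable {R : Type u} [CommRing R] {X : ModuleCat.{u} R} (P : ProjectiveResolution X)
    (Y : ModuleCat.{u} R) (n : ℕ)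

theorem smul_extMk {Y : ModuleCat.{u} R} {n : ℕ} (r : R) (f : P.complex.X n ⟶ Y)
    (hf : P.complex.d (n + 1) n ≫ f = 0) :
    P.extMk (r • f) (n + 1) rfl (by rw [Linear.comp_smul, hf, smul_zero]) =
      r • P.extMk f (n + 1) rfl hf := by
  rw [Abelian.Ext.smul_eq_comp_mk₀, ProjectiveResolution.extMk_comp_mk₀]
  congr 1

/-- `ProjectiveResolution.extMk` as a linear map on cocycles. -/
noncomputable def extMkLinear :
    LinearMap.ker ((P.complex.linearYonedaObj R Y).d n (n + 1)).hom →ₗ[R]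
      Abelian.Ext X Y n where
  toFun f := P.extMk f.1 (n + 1) rfl f.2
  map_add' f g := (P.add_extMk f.1 g.1 (n + 1) rfl f.2 g.2).symm
  map_smul' r f := smul_extMk P r f.1 f.2

theorem extMkLinear_surjective : Function.Surjective (extMkLinear P Y n) := by
  intro a
  obtain ⟨f, hf, h⟩ := P.extMk_surjective a (n + 1) rfl
  exact ⟨⟨f, hf⟩, h⟩

theorem extClassOf_surjective : Function.Surjective (extClassOf P Y n) := by
  intro x
  obtain ⟨z, hz⟩ := homologyClass_surjective (P.complex.linearYonedaObj R Y) n (n + 1) (by simp)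
    ((P.isoExt n Y).hom.hom x)
  refine ⟨z, ?_⟩
  unfold extClassOf
  rw [LinearMap.comp_apply, hz]
  exact (P.isoExt n Y).toLinearEquiv.symm_apply_apply x

theorem ker_extMkLinear : LinearMap.ker (extMkLinear P Y n) = LinearMap.ker (extClassOf P Y n) := by
  ext f
  have h1 : extClassOf P Y n f = 0 ↔
      homologyClass (P.complex.linearYonedaObj R Y) n (n + 1) (by simp) f = 0 :=
    (P.isoExt n Y).toLinearEquiv.symm.map_eq_zero_iff
  rw [LinearMap.mem_ker, LinearMap.mem_ker, h1]
  cases n with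
  | zero =>
    rw [homologyClass_eq_zero_iff _ 0 0 1 (by simp) (by simp)]
    refine (extMk_zero_eq_zero_iff P f.1 f.2).trans ?_
    have : (P.complex.linearYonedaObj R Y).d 0 0 = 0 :=
      (P.complex.linearYonedaObj R Y).shape _ _ (by simp)
    rw [this]
    exact ⟨fun h => ⟨0, h.symm⟩, fun ⟨_, h⟩ => h.symm⟩
  | succ n =>
    rw [homologyClass_eq_zero_iff _ n (n + 1) (n + 1 + 1) (by simp) (by simp)]
    exact P.extMk_eq_zero_iff f.1 (n + 1 + 1) rfl f.2 n rfl

/-- The comparison between the two definitions of `Ext` for modules. -/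
noncomputable def extComparison :
    ((Ext R (ModuleCat.{u} R) n).obj (Opposite.op X)).obj Y ≃ₗ[R] Abelian.Ext X Y n :=
  ((extClassOf P Y n).quotKerEquivOfSurjective (extClassOf_surjective P Y n)).symm ≪≫ₗ
    Submodule.quotEquivOfEq _ _ (ker_extMkLinear P Y n).symm ≪≫ₗ
    (extMkLinear P Y n).quotKerEquivOfSurjective (extMkLinear_surjective P Y n)

theorem extComparison_extClassOf
    (f : LinearMap.ker ((P.complex.linearYonedaObj R Y).d n (n + 1)).hom) :
    extComparison P Y n (extClassOf P Y n f) = extMkLinear P Y n f := by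
  have : ((extClassOf P Y n).quotKerEquivOfSurjective (extClassOf_surjective P Y n)).symm
      (extClassOf P Y n f) = Submodule.Quotient.mk f := by
    rw [LinearEquiv.symm_apply_eq]; rfl
  unfold extComparison
  rw [LinearEquiv.trans_apply, LinearEquiv.trans_apply, this]
  rfl

theorem extComparison_naturality {X X' : ModuleCat.{u} R} (P : ProjectiveResolution X)
    (P' : ProjectiveResolution X') (g : X' ⟶ X) (Y : ModuleCat.{u} R) (n : ℕ)
    (e : ((Ext R (ModuleCat.{u} R) n).obj (Opposite.op X)).obj Y) :
    extComparison P' Y n ((((Ext R (ModuleCat.{u} R) n).map g.op).app Y).hom e) =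
      (Abelian.Ext.mk₀ g).comp (extComparison P Y n e) (zero_add n) := by
  obtain ⟨f, rfl⟩ := extClassOf_surjective P Y n e
  let φ : ProjectiveResolution.Hom P' P g := ⟨ProjectiveResolution.lift g P' P, by
    have := ProjectiveResolution.lift_commutes g P' P
    exact congrArg (fun k => k.f 0) this⟩
  have hf : P'.complex.d (n + 1) n ≫ φ.hom.f n ≫ (f.1 : P.complex.X n ⟶ Y) = 0 := by
    have hf : P.complex.d (n + 1) n ≫ (f.1 : P.complex.X n ⟶ Y) = 0 := f.2
    refine (φ.hom.comm_assoc _ _ _).symm.trans ?_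
    exact (congrArg (_ ≫ ·) hf).trans comp_zero
  rw [extClassOf_naturality P P' g φ Y n f hf, extComparison_extClassOf,
    extComparison_extClassOf]
  exact (ProjectiveResolution.mk₀_comp_extMk f.1 (n + 1) rfl f.2 φ).symm

end

section LocCoh

variable {A : Type u} [CommRing A] (J : Ideal A)

/-- The quotient of `A` by a power of `J`, as an object of the category of modules. -/
abbrev powQuot (n : ℕ) : ModuleCat.{u} A := ModuleCat.of A (A ⧸ J ^ n)

/-- The projection between quotients by powers of `J`. -/
noncomputable def powQuotMap {m n : ℕ} (h : m ≤ n) : powQuot J n ⟶ powQuot J m :=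
  ModuleCat.ofHom (Submodule.mapQ _ _ LinearMap.id (Ideal.pow_le_pow_right h))

theorem powQuotMap_refl (n : ℕ) : powQuotMap J (le_refl n) = 𝟙 _ := by
  ext; rfl

theorem powQuotMap_comp {l m n : ℕ} (h : l ≤ m) (h' : m ≤ n) :
    powQuotMap J h' ≫ powQuotMap J h = powQuotMap J (h.trans h') := by
  ext; rfl

/-- The transition maps between the modules `Ext^i(A/J^n, N)`. -/
noncomputable def locCohTrans (N : ModuleCat.{u} A) (i : ℕ) (m n : ℕ) (h : m ≤ n) :
    Abelian.Ext (powQuot J m) N i →ₗ[A] Abelian.Ext (powQuot J n) N i :=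
  (Abelian.Ext.mk₀ (powQuotMap J h)).precompOfLinear A N (zero_add i)

theorem locCohTrans_apply (N : ModuleCat.{u} A) (i : ℕ) (m n : ℕ) (h : m ≤ n)
    (e : Abelian.Ext (powQuot J m) N i) :
    locCohTrans J N i m n h e = (Abelian.Ext.mk₀ (powQuotMap J h)).comp e (zero_add i) := rfl

instance (N : ModuleCat.{u} A) (i : ℕ) : DirectedSystem
    (fun n => Abelian.Ext (powQuot J n) N i) (fun m n h => locCohTrans J N i m n h) where
  map_self n x := by
    rw [locCohTrans_apply, powQuotMap_refl, Abelian.Ext.mk₀_id_comp]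
  map_map k j i' h h' x := by
    rw [locCohTrans_apply, locCohTrans_apply, locCohTrans_apply,
      Abelian.Ext.mk₀_comp_mk₀_assoc, powQuotMap_comp]

/-- Local cohomology, as the direct limit of the derived-category `Ext^i(A/J^n, N)`. -/
abbrev LocCoh (N : ModuleCat.{u} A) (i : ℕ) : Type u :=
  Module.DirectLimit (fun n => Abelian.Ext (powQuot J n) N i) (locCohTrans J N i)

/-- The canonical map from `Ext^i(A/J^n, N)` to local cohomology. -/
noncomputable abbrev locCohOf (N : ModuleCat.{u} A) (i n : ℕ) :
    Abelian.Ext (powQuot J n) N i →ₗ[A] LocCoh J N i :=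
  Module.DirectLimit.of A ℕ (fun n => Abelian.Ext (powQuot J n) N i) (locCohTrans J N i) n

variable {J}

theorem LocCoh.exists_of {N : ModuleCat.{u} A} {i : ℕ} (z : LocCoh J N i) :
    ∃ n e, locCohOf J N i n e = z := Module.DirectLimit.exists_of z

theorem LocCoh.of_eq_zero {N : ModuleCat.{u} A} {i n : ℕ} {e : Abelian.Ext (powQuot J n) N i}
    (h : locCohOf J N i n e = 0) :
    ∃ m, ∃ h : n ≤ m, (Abelian.Ext.mk₀ (powQuotMap J h)).comp e (zero_add i) = 0 :=
  Module.DirectLimit.of.zero_exact h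

theorem LocCoh.of_trans {N : ModuleCat.{u} A} {i n m : ℕ} (h : n ≤ m)
    (e : Abelian.Ext (powQuot J n) N i) :
    locCohOf J N i m ((Abelian.Ext.mk₀ (powQuotMap J h)).comp e (zero_add i)) =
      locCohOf J N i n e :=
  Module.DirectLimit.of_f

variable (J) in
/-- Postcomposition with an extension class on local cohomology. -/
noncomputable def LocCoh.post {N N' : ModuleCat.{u} A} {j : ℕ} (β : Abelian.Ext N N' j) {i k : ℕ}
    (h : i + j = k) : LocCoh J N i →ₗ[A] LocCoh J N' k :=
  Module.DirectLimit.map (fun n => β.postcompOfLinear A (powQuot J n) h) (by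
    intro m n hmn
    ext e
    simp only [LinearMap.comp_apply, locCohTrans_apply]
    exact (Abelian.Ext.comp_assoc _ _ _ (zero_add i) h (by omega)))

theorem LocCoh.post_of {N N' : ModuleCat.{u} A} {j : ℕ} (β : Abelian.Ext N N' j) {i k : ℕ}
    (h : i + j = k) (n : ℕ) (e : Abelian.Ext (powQuot J n) N i) :
    LocCoh.post J β h (locCohOf J N i n e) = locCohOf J N' k n (e.comp β h) :=
  Module.DirectLimit.map_apply_of _ _ _

theorem LocCoh.post_post {N N' N'' : ModuleCat.{u} A} {j j' l : ℕ} (β : Abelian.Ext N N' j)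
    (γ : Abelian.Ext N' N'' j') (hl : j + j' = l) {i k k' : ℕ}
    (h : i + j = k) (h' : k + j' = k') (z : LocCoh J N i) :
    LocCoh.post J γ h' (LocCoh.post J β h z) = LocCoh.post J (β.comp γ hl) (by omega) z := by
  obtain ⟨n, e, rfl⟩ := z.exists_of
  rw [post_of, post_of, post_of, Abelian.Ext.comp_assoc _ _ _ h hl (by omega)]

variable (J) in
/-- Functoriality of local cohomology. -/
noncomputable abbrev LocCoh.map {N N' : ModuleCat.{u} A} (f : N ⟶ N') (i : ℕ) :
    LocCoh J N i →ₗ[A] LocCoh J N' i :=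
  LocCoh.post J (Abelian.Ext.mk₀ f) (add_zero i)

theorem LocCoh.map_map {N N' N'' : ModuleCat.{u} A} (f : N ⟶ N') (g : N' ⟶ N'') (i : ℕ)
    (z : LocCoh J N i) : LocCoh.map J g i (LocCoh.map J f i z) = LocCoh.map J (f ≫ g) i z := by
  rw [LocCoh.map, LocCoh.map, post_post _ _ (add_zero 0)]
  simp only [Abelian.Ext.mk₀_comp_mk₀]

theorem LocCoh.map_id {N : ModuleCat.{u} A} (i : ℕ) (z : LocCoh J N i) :
    LocCoh.map J (𝟙 N) i z = z := by
  obtain ⟨n, e, rfl⟩ := z.exists_of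
  rw [LocCoh.map, post_of, Abelian.Ext.comp_mk₀_id]

theorem LocCoh.map_hom_smul {N N' : ModuleCat.{u} A} (a : A) (f : N ⟶ N') (i : ℕ) (z : LocCoh J N i) :
    LocCoh.map J (a • f) i z = a • LocCoh.map J f i z := by
  obtain ⟨n, e, rfl⟩ := z.exists_of
  rw [LocCoh.map, post_of, post_of, Abelian.Ext.mk₀_smul, Abelian.Ext.comp_smul, map_smul]

/-- An isomorphism of modules induces an isomorphism on local cohomology. -/
noncomputable def LocCoh.mapIso {N N' : ModuleCat.{u} A} (f : N ≅ N') (i : ℕ) :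
    LocCoh J N i ≃ₗ[A] LocCoh J N' i :=
  LinearEquiv.ofLinearMap (LocCoh.map J f.hom i) (LocCoh.map J f.inv i)
    (LinearMap.ext fun z => by simp [LocCoh.map_map, LocCoh.map_id])
    (LinearMap.ext fun z => by simp [LocCoh.map_map, LocCoh.map_id])

section exact

variable {S : ShortComplex (ModuleCat.{u} A)} (hS : S.ShortExact)

variable (J) in
/-- The connecting map in local cohomology. -/
noncomputable abbrev LocCoh.δ (i : ℕ) : LocCoh J S.X₃ i →ₗ[A] LocCoh J S.X₁ (i + 1) :=
  LocCoh.post J hS.extClass rfl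

include hS in
theorem LocCoh.exact₂ (i : ℕ) : Function.Exact (LocCoh.map J S.f i) (LocCoh.map J S.g i) := by
  intro z
  constructor
  · intro h
    obtain ⟨n, e, rfl⟩ := z.exists_of
    rw [LocCoh.map, post_of] at h
    obtain ⟨m, hm, h⟩ := of_eq_zero h
    rw [← Abelian.Ext.comp_assoc_of_third_deg_zero] at h
    obtain ⟨y, hy⟩ := Abelian.Ext.covariant_sequence_exact₂ _ hS _ h
    refine ⟨locCohOf J _ i m y, ?_⟩
    rw [LocCoh.map, post_of, hy, of_trans]
  · rintro ⟨y, rfl⟩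
    rw [map_map, S.zero, LocCoh.map, Abelian.Ext.mk₀_zero]
    obtain ⟨n, e, rfl⟩ := y.exists_of
    rw [post_of, Abelian.Ext.comp_zero, map_zero]

theorem LocCoh.exact₃ (i : ℕ) : Function.Exact (LocCoh.map J S.g i) (LocCoh.δ J hS i) := by
  intro z
  constructor
  · intro h
    obtain ⟨n, e, rfl⟩ := z.exists_of
    rw [LocCoh.δ, post_of] at h
    obtain ⟨m, hm, h⟩ := of_eq_zero h
    rw [← Abelian.Ext.comp_assoc _ _ _ (zero_add i) rfl (by omega)] at h
    obtain ⟨y, hy⟩ := Abelian.Ext.covariant_sequence_exact₃ _ hS _ rfl h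
    refine ⟨locCohOf J _ i m y, ?_⟩
    rw [LocCoh.map, post_of, hy, of_trans]
  · rintro ⟨y, rfl⟩
    rw [LocCoh.map, LocCoh.δ, post_post _ _ (zero_add 1), hS.comp_extClass]
    obtain ⟨n, e, rfl⟩ := y.exists_of
    rw [post_of, Abelian.Ext.comp_zero, map_zero]

theorem LocCoh.exact₁ (i : ℕ) :
    Function.Exact (LocCoh.δ J hS i) (LocCoh.map J S.f (i + 1)) := by
  intro z
  constructor
  · intro h
    obtain ⟨n, e, rfl⟩ := z.exists_of
    rw [LocCoh.map, post_of] at h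
    obtain ⟨m, hm, h⟩ := of_eq_zero h
    rw [← Abelian.Ext.comp_assoc_of_third_deg_zero] at h
    obtain ⟨y, hy⟩ := Abelian.Ext.covariant_sequence_exact₁ _ hS _ h rfl
    refine ⟨locCohOf J _ i m y, ?_⟩
    rw [LocCoh.δ, post_of, hy, of_trans]
  · rintro ⟨y, rfl⟩
    rw [LocCoh.map, LocCoh.δ, post_post _ _ (add_zero 1), hS.extClass_comp]
    obtain ⟨n, e, rfl⟩ := y.exists_of
    rw [post_of, Abelian.Ext.comp_zero, map_zero]

theorem LocCoh.δ_naturality {S' : ShortComplex (ModuleCat.{u} A)} (hS' : S'.ShortExact)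
    (φ : S ⟶ S') (i : ℕ) (z : LocCoh J S.X₃ i) :
    LocCoh.map J φ.τ₁ (i + 1) (LocCoh.δ J hS i z) = LocCoh.δ J hS' i (LocCoh.map J φ.τ₃ i z) := by
  rw [LocCoh.map, LocCoh.map, LocCoh.δ, LocCoh.δ, post_post _ _ (add_zero 1),
    post_post _ _ (zero_add 1), ShortComplex.ShortExact.extClass_naturality hS hS' φ]

end exact

end LocCoh

section LocCohZero

variable {A : Type u} [CommRing A] (J : Ideal A)

/-- The submodule of elements annihilated by a power of `J`. -/
def powTors (N : Type*) [AddCommGroup N] [Module A N] : Submodule A N where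
  carrier := {x | ∃ n : ℕ, ∀ a ∈ J ^ n, a • x = 0}
  zero_mem' := ⟨0, fun a _ => smul_zero a⟩
  add_mem' := by
    rintro x y ⟨n, hn⟩ ⟨m, hm⟩
    refine ⟨max n m, fun a ha => ?_⟩
    rw [smul_add, hn a (Ideal.pow_le_pow_right (le_max_left _ _) ha),
      hm a (Ideal.pow_le_pow_right (le_max_right _ _) ha), add_zero]
  smul_mem' := by
    rintro r x ⟨n, hn⟩
    exact ⟨n, fun a ha => by rw [smul_comm, hn a ha, smul_zero]⟩

variable {J}

theorem map_mem_powTors {N N' : Type*} [AddCommGroup N] [Module A N] [AddCommGroup N']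
    [Module A N'] (f : N →ₗ[A] N') {x : N} (hx : x ∈ powTors J N) : f x ∈ powTors J N' := by
  obtain ⟨n, hn⟩ := hx
  exact ⟨n, fun a ha => by rw [← map_smul, hn a ha, map_zero]⟩

theorem exists_pow_annihilates_fg {N : Type*} [AddCommGroup N] [Module A N] (S : Submodule A N)
    (hS : S.FG) (h : S ≤ powTors J N) : ∃ n : ℕ, ∀ x ∈ S, ∀ a ∈ J ^ n, a • x = 0 := by
  obtain ⟨s, rfl⟩ := hS
  have : ∀ x : s, ∃ n : ℕ, ∀ a ∈ J ^ n, a • (x : N) = 0 := fun x => h (Submodule.subset_span x.2)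
  choose n hn using this
  refine ⟨s.attach.sup n, fun x hx a ha => ?_⟩
  have hle : Submodule.span A (s : Set N) ≤ LinearMap.ker (a • (LinearMap.id : N →ₗ[A] N)) := by
    refine Submodule.span_le.2 fun y hy => ?_
    exact hn ⟨y, hy⟩ a (Ideal.pow_le_pow_right (Finset.le_sup (Finset.mem_attach s ⟨y, hy⟩)) ha)
  exact hle hx

variable (J) in
/-- The map from zeroth local cohomology to the module. -/
noncomputable def LocCoh.eval (N : ModuleCat.{u} A) : LocCoh J N 0 →ₗ[A] N :=
  Module.DirectLimit.lift A ℕ _ _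
    (fun n => (LinearMap.applyₗ (Ideal.Quotient.mk (J ^ n) 1 : A ⧸ J ^ n)) ∘ₗ
      (ModuleCat.homLinearEquiv (S := A)).toLinearMap ∘ₗ
        (Abelian.Ext.linearEquiv₀ (R := A) (X := powQuot J n) (Y := N)).toLinearMap)
    (by
      intro m n h x
      obtain ⟨f, rfl⟩ := (Abelian.Ext.mk₀_bijective _ _).2 x
      rw [locCohTrans_apply, Abelian.Ext.mk₀_comp_mk₀]
      simp only [LinearMap.comp_apply, LinearEquiv.coe_coe, ← Abelian.Ext.linearEquiv₀_symm_apply (R := A), LinearEquiv.apply_symm_apply]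
      rfl)

theorem LocCoh.eval_of {N : ModuleCat.{u} A} {n : ℕ} (f : powQuot J n ⟶ N) :
    LocCoh.eval J N (locCohOf J N 0 n (Abelian.Ext.mk₀ f)) =
      f.hom (Ideal.Quotient.mk (J ^ n) 1 : A ⧸ J ^ n) := by
  unfold LocCoh.eval
  rw [Module.DirectLimit.lift_of]
  simp only [LinearMap.comp_apply, LinearEquiv.coe_coe, ← Abelian.Ext.linearEquiv₀_symm_apply (R := A), LinearEquiv.apply_symm_apply]
  rfl

theorem LocCoh.exists_of_mk₀ {N : ModuleCat.{u} A} (z : LocCoh J N 0) :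
    ∃ n, ∃ f : powQuot J n ⟶ N, locCohOf J N 0 n (Abelian.Ext.mk₀ f) = z := by
  obtain ⟨n, e, rfl⟩ := z.exists_of
  obtain ⟨f, rfl⟩ := (Abelian.Ext.mk₀_bijective _ _).2 e
  exact ⟨n, f, rfl⟩

theorem quotient_hom_ext_one {I : Ideal A} {N : Type*} [AddCommGroup N] [Module A N]
    {f g : (A ⧸ I) →ₗ[A] N} (h : f (Ideal.Quotient.mk I 1) = g (Ideal.Quotient.mk I 1)) :
    f = g := by
  refine LinearMap.ext fun x => ?_
  obtain ⟨r, rfl⟩ := Ideal.Quotient.mk_surjective x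
  have : Ideal.Quotient.mk I r = r • Ideal.Quotient.mk I 1 := by
    rw [Algebra.smul_def, map_one, mul_one]; rfl
  rw [this, map_smul, map_smul, h]

theorem LocCoh.eval_injective (N : ModuleCat.{u} A) : Function.Injective (LocCoh.eval J N) := by
  rw [← LinearMap.ker_eq_bot, LinearMap.ker_eq_bot']
  intro z hz
  obtain ⟨n, f, rfl⟩ := z.exists_of_mk₀
  rw [eval_of] at hz
  have : f = 0 := by
    ext1
    exact quotient_hom_ext_one hz
  rw [this, Abelian.Ext.mk₀_zero, map_zero]

theorem LocCoh.range_eval (N : ModuleCat.{u} A) : LinearMap.range (LocCoh.eval J N) = powTors J N := by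
  ext x
  constructor
  · rintro ⟨z, rfl⟩
    obtain ⟨n, f, rfl⟩ := z.exists_of_mk₀
    rw [eval_of]
    refine ⟨n, fun a ha => ?_⟩
    rw [← map_smul]
    have : a • (Ideal.Quotient.mk (J ^ n) 1 : A ⧸ J ^ n) = 0 := by
      rw [Algebra.smul_def, map_one, mul_one]
      exact Ideal.Quotient.eq_zero_iff_mem.2 ha
    rw [this, map_zero]
  · rintro ⟨n, hn⟩
    refine ⟨locCohOf J N 0 n (Abelian.Ext.mk₀ (ModuleCat.ofHom
      (Submodule.liftQ (J ^ n) (LinearMap.toSpanSingleton A N x) (fun a ha => hn a ha)))), ?_⟩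
    rw [eval_of]
    exact one_smul A x

theorem LocCoh.eval_map {N N' : ModuleCat.{u} A} (f : N ⟶ N') (z : LocCoh J N 0) :
    LocCoh.eval J N' (LocCoh.map J f 0 z) = f.hom (LocCoh.eval J N z) := by
  obtain ⟨n, g, rfl⟩ := z.exists_of_mk₀
  rw [LocCoh.map, post_of, Abelian.Ext.mk₀_comp_mk₀, eval_of, eval_of]
  rfl

variable (J) in
/-- Zeroth local cohomology is the submodule of `J`-power torsion elements. -/
noncomputable def LocCoh.zeroEquiv (N : ModuleCat.{u} A) : LocCoh J N 0 ≃ₗ[A] powTors J N :=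
  (LinearEquiv.ofInjective _ (LocCoh.eval_injective N)).trans
    (LinearEquiv.ofEq _ _ (LocCoh.range_eval N))

theorem LocCoh.coe_zeroEquiv {N : ModuleCat.{u} A} (z : LocCoh J N 0) :
    (LocCoh.zeroEquiv J N z : N) = LocCoh.eval J N z := rfl

theorem LocCoh.subsingleton_of_injective (N : ModuleCat.{u} A) [Injective N] (i : ℕ) :
    Subsingleton (LocCoh J N (i + 1)) := by
  refine subsingleton_of_forall_eq 0 fun z => ?_
  obtain ⟨n, e, rfl⟩ := z.exists_of
  rw [Abelian.Ext.eq_zero_of_injective e, map_zero]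

theorem LocCoh.exists_pow_smul_eq_zero {N : ModuleCat.{u} A} {i : ℕ} (z : LocCoh J N i) :
    ∃ n : ℕ, ∀ a ∈ J ^ n, a • z = 0 := by
  obtain ⟨n, e, rfl⟩ := z.exists_of
  refine ⟨n, fun a ha => ?_⟩
  have h0 : a • 𝟙 (powQuot J n) = 0 := by
    ext1
    refine quotient_hom_ext_one ?_
    change a • (Ideal.Quotient.mk (J ^ n) 1 : A ⧸ J ^ n) = 0
    rw [Algebra.smul_def, map_one, mul_one]
    exact Ideal.Quotient.eq_zero_iff_mem.2 ha
  rw [← map_smul, ← Abelian.Ext.mk₀_id_comp e, ← Abelian.Ext.smul_comp, ← Abelian.Ext.mk₀_smul, h0,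
    Abelian.Ext.mk₀_zero, Abelian.Ext.zero_comp, map_zero]

theorem LocCoh.subsingleton_of_bijective {N : ModuleCat.{u} A} {r : A} (hr : r ∈ J)
    (hN : Function.Bijective fun x : N => r • x) (i : ℕ) : Subsingleton (LocCoh J N i) := by
  let g : N ≃ₗ[A] N := LinearEquiv.ofBijective (r • LinearMap.id) hN
  have hg : ∀ z : LocCoh J N i, LocCoh.mapIso (J := J) g.toModuleIso i z = r • z := by
    intro z
    have := LocCoh.map_hom_smul (J := J) r (𝟙 N) i z
    rw [LocCoh.map_id] at this
    rw [← this]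
    rfl
  have hinj : Function.Injective fun z : LocCoh J N i => r • z := by
    intro z w h
    apply (LocCoh.mapIso (J := J) g.toModuleIso i).injective
    rw [hg, hg]
    exact h
  refine subsingleton_of_forall_eq 0 fun z => ?_
  obtain ⟨n, hn⟩ := z.exists_pow_smul_eq_zero
  have h1 : r ^ n • z = r ^ n • (0 : LocCoh J N i) := by
    rw [hn _ (Ideal.pow_mem_pow hr n), smul_zero]
  clear hn
  induction n with
  | zero => simpa using h1
  | succ n ih =>
    rw [pow_succ', mul_smul, mul_smul] at h1
    exact ih (hinj h1)

end LocCohZero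

section TorsionInjective

variable {A : Type u} [CommRing A] [IsNoetherianRing A] {J : Ideal A}

theorem exists_pow_inf_vanish {N : Type*} [AddCommGroup N] [Module A N]
    (hN : ∀ x : N, x ∈ powTors J N) (I : Ideal A) (f : I →ₗ[A] N) :
    ∃ m : ℕ, ∀ x : I, (x : A) ∈ J ^ m → f x = 0 := by
  obtain ⟨n, hn⟩ := exists_pow_annihilates_fg (LinearMap.range f)
    (Module.Finite.iff_fg.1 inferInstance) (fun x _ => hN x)
  obtain ⟨k, hk⟩ := Ideal.exists_pow_inf_eq_pow_smul J (N := I)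
  refine ⟨n + k, fun x hx => ?_⟩
  have h1 : (x : A) ∈ J ^ (n + k) • (⊤ : Submodule A A) ⊓ I :=
    ⟨by simpa using hx, x.2⟩
  rw [hk (n + k) (by omega), Nat.add_sub_cancel] at h1
  have h2 : (x : A) ∈ (J ^ n • (⊤ : Submodule A I)).map I.subtype := by
    rw [Submodule.map_smul'', Submodule.map_top, Submodule.range_subtype]
    exact (show J ^ n • (J ^ k • (⊤ : Ideal A) ⊓ I) ≤ J ^ n • I from smul_mono_right _ inf_le_right) h1
  obtain ⟨y, hy, hyx⟩ := h2
  have : y = x := Subtype.ext hyx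
  subst this
  have h3 : J ^ n • (⊤ : Submodule A I) ≤ LinearMap.ker f := by
    refine Submodule.smul_le.2 fun a ha y _ => ?_
    rw [LinearMap.mem_ker, map_smul]
    exact hn _ (LinearMap.mem_range_self f y) a ha
  exact h3 hy

theorem injective_powTors {I : Type u} [AddCommGroup I] [Module A I] (hI : Module.Injective A I) :
    Module.Injective A (powTors J I) := by
  refine Module.Baer.injective fun 𝔞 f => ?_
  have htors : ∀ x : powTors J I, x ∈ powTors J (powTors J I) := by
    rintro ⟨x, n, hn⟩
    exact ⟨n, fun a ha => Subtype.ext (hn a ha)⟩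
  obtain ⟨m, hm⟩ := exists_pow_inf_vanish htors 𝔞 f
  let K : Submodule A 𝔞 := Submodule.comap 𝔞.subtype (J ^ m : Ideal A)
  let ι : (𝔞 ⧸ K) →ₗ[A] (A ⧸ J ^ m) := Submodule.mapQ K (J ^ m) 𝔞.subtype le_rfl
  have hι : Function.Injective ι := by
    rw [← LinearMap.ker_eq_bot, Submodule.ker_mapQ]
    exact Submodule.mkQ_map_self _
  let g : (𝔞 ⧸ K) →ₗ[A] I := K.liftQ ((powTors J I).subtype ∘ₗ f) (fun x hx => by
    rw [LinearMap.mem_ker, LinearMap.comp_apply, hm x hx, map_zero])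
  obtain ⟨G, hG⟩ := hI.out ι hι g
  have hy : ∀ a ∈ J ^ m, a • G (Ideal.Quotient.mk (J ^ m) 1) = 0 := fun a ha => by
    rw [← map_smul, Algebra.smul_def, map_one, mul_one]
    exact (congrArg G (Ideal.Quotient.eq_zero_iff_mem.2 ha)).trans (map_zero G)
  refine ⟨LinearMap.toSpanSingleton A _ ⟨G (Ideal.Quotient.mk (J ^ m) 1), m, hy⟩, fun x hx => ?_⟩
  refine Subtype.ext ?_
  refine Eq.trans ?_ (hG (Submodule.Quotient.mk ⟨x, hx⟩))
  change x • G (Ideal.Quotient.mk (J ^ m) 1) = G (Ideal.Quotient.mk (J ^ m) x)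
  rw [← map_smul, Algebra.smul_def, map_one, mul_one]
  rfl

end TorsionInjective

section ShortExactHelper

variable {A : Type u} [CommRing A]

theorem exact_of_function_exact {N₁ N₂ N₃ : Type u} [AddCommGroup N₁] [AddCommGroup N₂]
    [AddCommGroup N₃] [Module A N₁] [Module A N₂] [Module A N₃] {f : N₁ →ₗ[A] N₂}
    {g : N₂ →ₗ[A] N₃} (hf : Function.Injective f) (hg : Function.Surjective g)
    (h : Function.Exact f g) :
    (ShortComplex.mk (ModuleCat.ofHom f) (ModuleCat.ofHom g)
      (by ext x; exact h.apply_apply_eq_zero x)).ShortExact := by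
  refine ShortComplex.ShortExact.mk' ?_ ?_ ?_
  · exact (ShortComplex.ShortExact.moduleCat_exact_iff_function_exact _).2 h
  · exact (ModuleCat.mono_iff_injective _).2 hf
  · exact (ModuleCat.epi_iff_surjective _).2 hg

theorem shortExact_mkQ {N : Type u} [AddCommGroup N] [Module A N] (K : Submodule A N) :
    (ShortComplex.mk (ModuleCat.ofHom K.subtype) (ModuleCat.ofHom K.mkQ)
      (by ext x; exact (Submodule.Quotient.mk_eq_zero K).2 x.2)).ShortExact :=
  exact_of_function_exact K.injective_subtype K.mkQ_surjective
    (LinearMap.exact_subtype_mkQ K)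

theorem exists_injective_embedding (N : Type u) [AddCommGroup N] [Module A N] :
    ∃ (I : Type u) (_ : AddCommGroup I) (_ : Module A I) (ι : N →ₗ[A] I),
      Module.Injective A I ∧ Function.Injective ι :=
  let I : ModuleCat.{u} A := Injective.under (ModuleCat.of A N)
  ⟨I, inferInstance, inferInstance, (Injective.ι (ModuleCat.of A N)).hom,
    Module.injective_module_of_injective_object A I
      (inj := (inferInstance : Injective (Injective.under (ModuleCat.of A N)))),
    (ModuleCat.mono_iff_injective _).1 inferInstance⟩

end ShortExactHelper

section LocCohTorsion

variable {A : Type u} [CommRing A] {J : Ideal A}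

theorem LocCoh.eval_bijective_of_torsion {N : Type u} [AddCommGroup N] [Module A N]
    (hN : ∀ x : N, x ∈ powTors J N) : Function.Bijective (LocCoh.eval J (ModuleCat.of A N)) :=
  ⟨LocCoh.eval_injective _, fun x => (LocCoh.range_eval (J := J) (ModuleCat.of A N)).ge (hN x)⟩

theorem LocCoh.subsingleton_of_torsion [IsNoetherianRing A] (i : ℕ) :
    ∀ {N : Type u} [AddCommGroup N] [Module A N], (∀ x : N, x ∈ powTors J N) →
      Subsingleton (LocCoh J (ModuleCat.of A N) (i + 1)) := by
  induction i with
  | zero =>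
    intro N _ _ hN
    obtain ⟨I, _, _, ι, hI, hι⟩ := exists_injective_embedding (A := A) N
    let ι' : N →ₗ[A] powTors J I := LinearMap.codRestrict _ ι fun x => map_mem_powTors ι (hN x)
    have hι' : Function.Injective ι' := fun x y h => hι (congrArg Subtype.val h)
    have hS := exact_of_function_exact hι' (Submodule.mkQ_surjective (LinearMap.range ι'))
      (LinearMap.exact_map_mkQ_range ι')
    have hT : ∀ x : powTors J I, x ∈ powTors J (powTors J I) := by
      rintro ⟨x, n, hn⟩
      exact ⟨n, fun a ha => Subtype.ext (hn a ha)⟩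
    have hinj : Injective (ModuleCat.of A (powTors J I)) :=
      Module.injective_object_of_injective_module A _ (inj := injective_powTors hI)
    have hsub : Subsingleton (LocCoh J (ModuleCat.of A (powTors J I)) 1) :=
      LocCoh.subsingleton_of_injective _ 0
    refine subsingleton_of_forall_eq 0 fun z => ?_
    obtain ⟨w, rfl⟩ := ((LocCoh.exact₁ (J := J) hS 0) z).1 (hsub.elim _ _)
    obtain ⟨y, hy⟩ := Submodule.mkQ_surjective _ (LocCoh.eval J _ w)
    obtain ⟨y', hy'⟩ := (LocCoh.eval_bijective_of_torsion hT).2 y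
    refine ((LocCoh.exact₃ (J := J) hS 0) w).2 ⟨y', ?_⟩
    apply LocCoh.eval_injective
    rw [LocCoh.eval_map, hy']
    exact hy
  | succ i ih =>
    intro N _ _ hN
    obtain ⟨I, _, _, ι, hI, hι⟩ := exists_injective_embedding (A := A) N
    let ι' : N →ₗ[A] powTors J I := LinearMap.codRestrict _ ι fun x => map_mem_powTors ι (hN x)
    have hι' : Function.Injective ι' := fun x y h => hι (congrArg Subtype.val h)
    have hS := exact_of_function_exact hι' (Submodule.mkQ_surjective (LinearMap.range ι'))
      (LinearMap.exact_map_mkQ_range ι')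
    have hT : ∀ x : powTors J I, x ∈ powTors J (powTors J I) := by
      rintro ⟨x, n, hn⟩
      exact ⟨n, fun a ha => Subtype.ext (hn a ha)⟩
    have hQ : ∀ x : (powTors J I ⧸ LinearMap.range ι'), x ∈ powTors J _ := by
      intro x
      obtain ⟨y, rfl⟩ := Submodule.mkQ_surjective _ x
      exact map_mem_powTors _ (hT y)
    have hinj : Injective (ModuleCat.of A (powTors J I)) :=
      Module.injective_object_of_injective_module A _ (inj := injective_powTors hI)
    have hsub : Subsingleton (LocCoh J (ModuleCat.of A (powTors J I)) (i + 2)) :=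
      LocCoh.subsingleton_of_injective _ _
    refine subsingleton_of_forall_eq 0 fun z => ?_
    obtain ⟨w, rfl⟩ := ((LocCoh.exact₁ (J := J) hS (i + 1)) z).1 (hsub.elim _ _)
    rw [(ih hQ).elim w 0, map_zero]

end LocCohTorsion

section LocChain

open scoped TensorProduct

variable {A : Type u} [CommRing A]

/-- An exact sequence `0 → N → L → N' → 0` exhibiting `L` as the localization of `N` away
from `x`. -/
structure LocStep (x : A) (N L N' : ModuleCat.{u} A) where
  f : N →ₗ[A] L
  g : L →ₗ[A] N'
  inj : Function.Injective f
  surj : Function.Surjective g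
  exact : Function.Exact f g
  bij : Function.Bijective fun y : L => x • y
  tors : ∀ y : N', ∃ n : ℕ, x ^ n • y = 0

namespace LocStep

variable {x : A} {N L N' : ModuleCat.{u} A} (s : LocStep x N L N')

/-- The short complex underlying a localization step. -/
abbrev toShortComplex : ShortComplex (ModuleCat.{u} A) :=
  ShortComplex.mk (ModuleCat.ofHom s.f) (ModuleCat.ofHom s.g)
    (by ext y; exact s.exact.apply_apply_eq_zero y)

theorem shortExact : s.toShortComplex.ShortExact :=
  exact_of_function_exact s.inj s.surj s.exact

include s in
theorem regular (y : N) (hy : x • y = 0) : y = 0 := by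
  refine s.inj (s.bij.1 ?_)
  change x • s.f y = x • s.f 0
  rw [← map_smul, hy, map_zero, smul_zero]

include s in
theorem pow_bijective (n : ℕ) : Function.Bijective fun y : L => x ^ n • y := by
  induction n with
  | zero => simpa only [pow_zero, one_smul] using (show Function.Bijective fun y : L => y from Function.bijective_id)
  | succ n ih =>
    have : (fun y : L => x ^ (n + 1) • y) = (fun y : L => x • y) ∘ fun y : L => x ^ n • y := by
      ext y; simp [pow_succ', mul_smul]
    rw [this]
    exact s.bij.comp ih

theorem isLocalizedModule : IsLocalizedModule (Submonoid.powers x) s.f where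
  map_units := by
    rintro ⟨_, n, rfl⟩
    rw [Module.End.isUnit_iff]
    exact s.pow_bijective n
  surj y := by
    obtain ⟨n, hn⟩ := s.tors (s.g y)
    rw [← map_smul] at hn
    obtain ⟨z, hz⟩ := (s.exact _).1 hn
    exact ⟨⟨z, ⟨x ^ n, n, rfl⟩⟩, hz.symm⟩
  exists_of_eq h := ⟨1, congrArg _ (s.inj h)⟩

/-- The localization step attached to a regular element. -/
noncomputable def ofRegular (x : A) (N : ModuleCat.{u} A) (h : ∀ y : N, x • y = 0 → y = 0) :
    LocStep x N (ModuleCat.of A (LocalizedModule (Submonoid.powers x) N))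
      (ModuleCat.of A (LocalizedModule (Submonoid.powers x) N ⧸
        LinearMap.range (LocalizedModule.mkLinearMap (Submonoid.powers x) N))) where
  f := LocalizedModule.mkLinearMap (Submonoid.powers x) N
  g := Submodule.mkQ _
  inj := by
    rw [← LinearMap.ker_eq_bot, LinearMap.ker_eq_bot']
    intro y hy
    obtain ⟨⟨_, n, rfl⟩, hn⟩ := (IsLocalizedModule.eq_zero_iff (Submonoid.powers x)
      (LocalizedModule.mkLinearMap (Submonoid.powers x) N)).1 hy
    replace hn : x ^ n • y = 0 := hn
    induction n with
    | zero => simpa using hn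
    | succ n ih =>
      rw [pow_succ', mul_smul] at hn
      exact ih (h _ hn)
  surj := Submodule.mkQ_surjective _
  exact := LinearMap.exact_map_mkQ_range _
  bij := (Module.End.isUnit_iff _).1 (IsLocalizedModule.map_units
    (LocalizedModule.mkLinearMap (Submonoid.powers x) N) (⟨x, 1, pow_one x⟩ : Submonoid.powers x))
  tors y := by
    obtain ⟨y, rfl⟩ := Submodule.mkQ_surjective _ y
    obtain ⟨⟨z, ⟨_, n, rfl⟩⟩, hz⟩ := IsLocalizedModule.surj (Submonoid.powers x)
      (LocalizedModule.mkLinearMap (Submonoid.powers x) N) y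
    refine ⟨n, ?_⟩
    rw [← map_smul]
    exact (Submodule.Quotient.mk_eq_zero _).2 ⟨z, hz.symm⟩

/-- Localization steps are preserved by flat tensor products. -/
noncomputable def tensor (Q : Type u) [AddCommGroup Q] [Module A Q] [Module.Flat A Q] :
    LocStep x (ModuleCat.of A (N ⊗[A] Q)) (ModuleCat.of A (L ⊗[A] Q))
      (ModuleCat.of A (N' ⊗[A] Q)) where
  f := s.f.rTensor Q
  g := s.g.rTensor Q
  inj := Module.Flat.rTensor_preserves_injective_linearMap _ s.inj
  surj := LinearMap.rTensor_surjective Q s.surj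
  exact := rTensor_exact Q s.exact s.surj
  bij := by
    let e : L ≃ₗ[A] L := LinearEquiv.ofBijective (x • LinearMap.id) s.bij
    have : (fun y : L ⊗[A] Q => x • y) = e.rTensor Q := by
      have h2 : (e : L →ₗ[A] L) = x • LinearMap.id := rfl
      ext y
      rw [← LinearEquiv.coe_coe, LinearEquiv.coe_rTensor, h2, LinearMap.rTensor_smul,
        LinearMap.rTensor_id]
      rfl
    rw [this]
    exact (e.rTensor Q).bijective
  tors y := by
    induction y using TensorProduct.induction_on with
    | zero => exact ⟨0, smul_zero _⟩
    | tmul a b =>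
      obtain ⟨n, hn⟩ := s.tors a
      exact ⟨n, by rw [TensorProduct.smul_tmul', hn, TensorProduct.zero_tmul]⟩
    | add a b ha hb =>
      obtain ⟨n, hn⟩ := ha
      obtain ⟨m, hm⟩ := hb
      exact ⟨n + m, by rw [smul_add, pow_add, mul_smul, mul_smul, hm, smul_comm, hn, smul_zero,
        smul_zero, add_zero]⟩

theorem δ_bijective {J : Ideal A} (hx : x ∈ J) (i : ℕ) :
    Function.Bijective (LocCoh.δ J s.shortExact i) := by
  have hsub := fun i => LocCoh.subsingleton_of_bijective (J := J) (N := L) hx s.bij i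
  constructor
  · rw [← LinearMap.ker_eq_bot, LinearMap.ker_eq_bot']
    intro z hz
    obtain ⟨w, rfl⟩ := (LocCoh.exact₃ (J := J) s.shortExact i z).1 hz
    rw [(hsub i).elim w 0, map_zero]
  · intro z
    exact (LocCoh.exact₁ (J := J) s.shortExact i z).1 ((hsub (i + 1)).elim _ _)

include s in
theorem subsingleton_zero {J : Ideal A} (hx : x ∈ J) : Subsingleton (LocCoh J N 0) := by
  have hsub := LocCoh.subsingleton_of_bijective (J := J) (N := L) hx s.bij 0
  refine subsingleton_of_forall_eq 0 fun z => LocCoh.eval_injective N (s.inj ?_)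
  have := LocCoh.eval_map (ModuleCat.ofHom s.f) z
  rw [hsub.elim (LocCoh.map J (ModuleCat.ofHom s.f) 0 z) 0] at this
  rw [map_zero, map_zero]
  exact this.symm.trans (map_zero _)

theorem δ_naturality (J : Ideal A) {Q Q' : Type u} [AddCommGroup Q] [Module A Q] [Module.Flat A Q]
    [AddCommGroup Q'] [Module A Q'] [Module.Flat A Q'] (q : Q →ₗ[A] Q') (i : ℕ)
    (z : LocCoh J (ModuleCat.of A (N' ⊗[A] Q)) i) :
    LocCoh.map J (ModuleCat.ofHom (q.lTensor N)) (i + 1)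
        (LocCoh.δ J (s.tensor Q).shortExact i z) =
      LocCoh.δ J (s.tensor Q').shortExact i (LocCoh.map J (ModuleCat.ofHom (q.lTensor N')) i z) := by
  let φ : (s.tensor Q).toShortComplex ⟶ (s.tensor Q').toShortComplex :=
    { τ₁ := ModuleCat.ofHom (q.lTensor N)
      τ₂ := ModuleCat.ofHom (q.lTensor L)
      τ₃ := ModuleCat.ofHom (q.lTensor N')
      comm₁₂ := by
        change ModuleCat.ofHom (q.lTensor N) ≫ ModuleCat.ofHom (s.f.rTensor Q') =
          ModuleCat.ofHom (s.f.rTensor Q) ≫ ModuleCat.ofHom (q.lTensor L)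
        rw [← ModuleCat.ofHom_comp, ← ModuleCat.ofHom_comp, LinearMap.lTensor_comp_rTensor,
          LinearMap.rTensor_comp_lTensor]
      comm₂₃ := by
        change ModuleCat.ofHom (q.lTensor L) ≫ ModuleCat.ofHom (s.g.rTensor Q') =
          ModuleCat.ofHom (s.g.rTensor Q) ≫ ModuleCat.ofHom (q.lTensor N')
        rw [← ModuleCat.ofHom_comp, ← ModuleCat.ofHom_comp, LinearMap.lTensor_comp_rTensor,
          LinearMap.rTensor_comp_lTensor] }
  exact LocCoh.δ_naturality (J := J) (s.tensor Q).shortExact (s.tensor Q').shortExact φ i z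

end LocStep

/-- A sequence of localization steps along a list of elements. -/
inductive LocChain : List A → ModuleCat.{u} A → ModuleCat.{u} A → Type (u + 1)
  | nil {N Y : ModuleCat.{u} A} (e : N ≃ₗ[A] Y) : LocChain [] N Y
  | cons {x : A} {l : List A} {N L N' Y : ModuleCat.{u} A} (s : LocStep x N L N')
      (c : LocChain l N' Y) : LocChain (x :: l) N Y

namespace LocChain

variable (J : Ideal A)

/-- The iterated connecting map of a chain tensored with a flat module. -/
noncomputable def δ (Q : Type u) [AddCommGroup Q] [Module A Q] [Module.Flat A Q] (i : ℕ) :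
    ∀ {l : List A} {N Y : ModuleCat.{u} A}, LocChain l N Y →
      (LocCoh J (ModuleCat.of A (Y ⊗[A] Q)) i →ₗ[A]
        LocCoh J (ModuleCat.of A (N ⊗[A] Q)) (i + l.length))
  | _, _, _, nil e => LocCoh.map J (ModuleCat.ofHom (e.symm.toLinearMap.rTensor Q)) i
  | _, _, _, cons s c => LocCoh.δ J (s.tensor Q).shortExact _ ∘ₗ c.δ Q i

variable {J}

theorem δ_cons (Q : Type u) [AddCommGroup Q] [Module A Q] [Module.Flat A Q] (i : ℕ) {x : A}
    {l : List A} {N L N' Y : ModuleCat.{u} A} (s : LocStep x N L N') (c : LocChain l N' Y)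
    (z : LocCoh J (ModuleCat.of A (Y ⊗[A] Q)) i) :
    (cons s c).δ J Q i z = LocCoh.δ J (s.tensor Q).shortExact (i + l.length) (c.δ J Q i z) := by
  rw [δ, LinearMap.comp_apply]

theorem δ_bijective (Q : Type u) [AddCommGroup Q] [Module A Q] [Module.Flat A Q] (i : ℕ)
    {l : List A} {N Y : ModuleCat.{u} A} (c : LocChain l N Y) (hl : ∀ x ∈ l, x ∈ J) :
    Function.Bijective (c.δ J Q i) := by
  induction c with
  | nil e => exact (LocCoh.mapIso (J := J) (e.symm.rTensor Q).toModuleIso i).bijective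
  | cons s c ih =>
    have h1 := (s.tensor Q).δ_bijective (J := J) (hl _ List.mem_cons_self)
    have h2 := ih fun x hx => hl x (List.mem_cons_of_mem _ hx)
    rw [δ, LinearMap.coe_comp]
    exact (h1 _).comp h2

theorem δ_naturality {Q Q' : Type u} [AddCommGroup Q] [Module A Q] [Module.Flat A Q]
    [AddCommGroup Q'] [Module A Q'] [Module.Flat A Q'] (q : Q →ₗ[A] Q') (i : ℕ)
    {l : List A} {N Y : ModuleCat.{u} A} (c : LocChain l N Y)
    (z : LocCoh J (ModuleCat.of A (Y ⊗[A] Q)) i) :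
    LocCoh.map J (ModuleCat.ofHom (q.lTensor N)) _ (c.δ J Q i z) =
      c.δ J Q' i (LocCoh.map J (ModuleCat.ofHom (q.lTensor Y)) i z) := by
  induction c with
  | nil e =>
    refine (LocCoh.map_map _ _ _ _).trans (Eq.trans ?_ (LocCoh.map_map _ _ _ _).symm)
    congr 2
    rw [← ModuleCat.ofHom_comp, ← ModuleCat.ofHom_comp, LinearMap.lTensor_comp_rTensor,
      LinearMap.rTensor_comp_lTensor]
  | @cons x l N L N' Y s c ih =>
    rw [δ_cons, δ_cons, ← ih z]
    exact s.δ_naturality J q (i + l.length) (c.δ J Q i z)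

theorem subsingleton_of_lt (Q : Type u) [AddCommGroup Q] [Module A Q] [Module.Flat A Q]
    {l : List A} {N Y : ModuleCat.{u} A} (c : LocChain l N Y) (hl : ∀ x ∈ l, x ∈ J) (j : ℕ)
    (hj : j < l.length) : Subsingleton (LocCoh J (ModuleCat.of A (N ⊗[A] Q)) j) := by
  induction c generalizing j with
  | nil e => simp at hj
  | cons s c ih =>
    cases j with
    | zero => exact (s.tensor Q).subsingleton_zero (hl _ List.mem_cons_self)
    | succ j =>
      have := ih (fun x hx => hl x (List.mem_cons_of_mem _ hx)) j (by simpa using hj)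
      exact ((s.tensor Q).δ_bijective (hl _ List.mem_cons_self) j).2.subsingleton

/-- A chain starting at a module isomorphic to the given one. -/
def ofEquiv {N₁ N Y : ModuleCat.{u} A} (e : N₁ ≃ₗ[A] N) :
    ∀ {l : List A}, LocChain l N Y → LocChain l N₁ Y
  | _, nil e' => nil (e.trans e')
  | _, cons s c => cons
      { f := s.f ∘ₗ e.toLinearMap
        g := s.g
        inj := s.inj.comp e.injective
        surj := s.surj
        exact := fun y => (s.exact y).trans
          ⟨fun ⟨z, hz⟩ => ⟨e.symm z, by simp [hz]⟩, fun ⟨z, hz⟩ => ⟨e z, hz⟩⟩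
        bij := s.bij
        tors := s.tors } c

end LocChain

end LocChain

section Vanishing

variable {A : Type u} [CommRing A]

theorem LocStep.smul_bijective {x : A} {N L N' : ModuleCat.{u} A} (t : LocStep x N L N') {s : A}
    (hs : Function.Bijective fun y : N => s • y) : Function.Bijective fun y : N' => s • y := by
  have hL : Function.Injective fun y : L => s • y := by
    refine (injective_iff_map_eq_zero (s • LinearMap.id : L →ₗ[A] L)).2 fun y hy => ?_
    replace hy : s • y = 0 := hy
    obtain ⟨n, hn⟩ := t.tors (t.g y)
    rw [← map_smul] at hn
    obtain ⟨z, hz⟩ := (t.exact _).1 hn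
    have h1 : t.f (s • z) = t.f (s • 0) := by
      rw [map_smul, hz, smul_comm, hy, smul_zero, smul_zero, map_zero]
    have h2 := hs.1 (t.inj h1)
    rw [h2, map_zero] at hz
    refine (t.pow_bijective n).1 ?_
    change x ^ n • y = x ^ n • 0
    rw [← hz, smul_zero]
  constructor
  · refine (injective_iff_map_eq_zero (s • LinearMap.id : N' →ₗ[A] N')).2 fun y hy => ?_
    replace hy : s • y = 0 := hy
    obtain ⟨w, rfl⟩ := t.surj y
    rw [← map_smul] at hy
    obtain ⟨z, hz⟩ := (t.exact _).1 hy
    obtain ⟨z', rfl⟩ := hs.2 z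
    refine (t.exact w).2 ⟨z', hL ?_⟩
    change s • t.f z' = s • w
    rw [← hz, ← map_smul]
  · intro y
    obtain ⟨w, rfl⟩ := t.surj y
    obtain ⟨n, hn⟩ := t.tors (t.g w)
    rw [← map_smul] at hn
    obtain ⟨z, hz⟩ := (t.exact _).1 hn
    obtain ⟨z', rfl⟩ := hs.2 z
    obtain ⟨w', hw'⟩ := (t.pow_bijective n).2 (t.f z')
    refine ⟨t.g w', ?_⟩
    change s • t.g w' = t.g w
    rw [← map_smul]
    congr 1
    refine (t.pow_bijective n).1 ?_
    change x ^ n • s • w' = x ^ n • w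
    rw [smul_comm, ← hz, map_smul]
    exact congrArg (s • ·) hw'

theorem LocStep.pow_tors {x : A} {N L N' : ModuleCat.{u} A} (t : LocStep x N L N') {a : A}
    (ha : ∀ y : N, ∃ n : ℕ, a ^ n • y = 0) (y : N') : ∃ n : ℕ, a ^ n • y = 0 := by
  obtain ⟨w, rfl⟩ := t.surj y
  obtain ⟨n, hn⟩ := t.tors (t.g w)
  rw [← map_smul] at hn
  obtain ⟨z, hz⟩ := (t.exact _).1 hn
  obtain ⟨m, hm⟩ := ha z
  refine ⟨m, ?_⟩
  have : a ^ m • w = 0 := by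
    refine (t.pow_bijective n).1 ?_
    change x ^ n • a ^ m • w = x ^ n • 0
    rw [smul_comm, ← hz, ← map_smul, hm, map_zero, smul_zero]
  rw [← map_smul, this, map_zero]

theorem mem_powTors_of_pow [IsNoetherianRing A] {J : Ideal A} {N : Type*} [AddCommGroup N]
    [Module A N] {y : N} (h : ∀ a ∈ J, ∃ n : ℕ, a ^ n • y = 0) : y ∈ powTors J N := by
  have hJ : J ≤ Ideal.radical (LinearMap.ker (LinearMap.toSpanSingleton A N y)) :=
    fun a ha => h a ha
  obtain ⟨n, hn⟩ := Ideal.exists_pow_le_of_le_radical_of_fg hJ (IsNoetherian.noetherian J)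
  exact ⟨n, fun a ha => hn ha⟩

theorem mem_powTors_of_list [IsNoetherianRing A] {J : Ideal A} {s : A} {l : List A}
    (hJ : ∀ a ∈ J, ∃ n : ℕ, s * a ^ n ∈ Ideal.ofList l) {N : Type*} [AddCommGroup N]
    [Module A N] (hs : Function.Injective fun y : N => s • y) {y : N}
    (hy : ∀ a ∈ l, ∃ n : ℕ, a ^ n • y = 0) : y ∈ powTors J N := by
  refine mem_powTors_of_pow fun a ha => ?_
  obtain ⟨n, hn⟩ := hJ a ha
  have hl : Ideal.ofList l ≤ Ideal.radical (LinearMap.ker (LinearMap.toSpanSingleton A N y)) :=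
    Ideal.span_le.2 fun b hb => hy b hb
  obtain ⟨k, hk⟩ := hl hn
  replace hk : (s * a ^ n) ^ k • y = 0 := hk
  rw [mul_pow, mul_smul, ← pow_mul] at hk
  refine ⟨n * k, ?_⟩
  clear hl hn
  generalize a ^ (n * k) • y = w at hk
  induction k with
  | zero => simpa using hk
  | succ k ih =>
    refine ih (hs ?_)
    change s • s ^ k • w = s • 0
    rw [← mul_smul, ← pow_succ', hk, smul_zero]

theorem LocCoh.subsingleton_of_length_lt [IsNoetherianRing A] {J : Ideal A} {s : A} :
    ∀ (l₂ l₁ : List A), (∀ x ∈ l₂, x ∈ J) →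
      (∀ a ∈ J, ∃ n : ℕ, s * a ^ n ∈ Ideal.ofList (l₁ ++ l₂)) → ∀ (N : ModuleCat.{u} A),
      (Function.Bijective fun y : N => s • y) → (∀ a ∈ l₁, ∀ y : N, ∃ n : ℕ, a ^ n • y = 0) →
      ∀ i, l₂.length < i → Subsingleton (LocCoh J N i)
  | [], l₁, _, hJ, N, hs, hN, i, hi => by
    obtain ⟨i, rfl⟩ := Nat.exists_eq_succ_of_ne_zero (Nat.ne_of_gt hi)
    rw [List.append_nil] at hJ
    exact LocCoh.subsingleton_of_torsion i (N := N)
      fun y => mem_powTors_of_list hJ hs.1 fun a ha => hN a ha y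
  | x :: l₂, l₁, hl, hJ, N, hs, hN, i, hi => by
    have hJ' : ∀ a ∈ J, ∃ n : ℕ, s * a ^ n ∈ Ideal.ofList ((l₁ ++ [x]) ++ l₂) := by simpa using hJ
    have hl' : ∀ y ∈ l₂, y ∈ J := fun y hy => hl y (List.mem_cons_of_mem _ hy)
    let T : Submodule A N := powTors (Ideal.span {x}) N
    have hT : ∀ y : N, y ∈ T ↔ ∃ n : ℕ, x ^ n • y = 0 := fun y => by
      refine exists_congr fun n => ?_
      rw [Ideal.span_singleton_pow]
      refine ⟨fun h => h _ (Ideal.mem_span_singleton_self _), fun h a ha => ?_⟩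
      obtain ⟨b, rfl⟩ := Ideal.mem_span_singleton'.1 ha
      rw [mul_smul, h, smul_zero]
    have hTs : ∀ y : N, s • y ∈ T → y ∈ T := fun y hy => by
      obtain ⟨n, hn⟩ := (hT _).1 hy
      refine (hT _).2 ⟨n, hs.1 ?_⟩
      change s • x ^ n • y = s • 0
      rw [smul_comm, hn, smul_zero]
    have hsT : Function.Bijective fun y : ModuleCat.of A T => s • y := by
      refine ⟨fun y z h => Subtype.ext (hs.1 (congrArg Subtype.val h)), fun y => ?_⟩
      obtain ⟨z, hz⟩ := hs.2 y.1
      exact ⟨⟨z, hTs z (by rw [show s • z = y.1 from hz]; exact y.2)⟩, Subtype.ext hz⟩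
    have hsQ : Function.Bijective fun y : ModuleCat.of A (N ⧸ T) => s • y := by
      constructor
      · refine (injective_iff_map_eq_zero (s • LinearMap.id : (N ⧸ T) →ₗ[A] (N ⧸ T))).2 ?_
        intro y hy
        obtain ⟨y, rfl⟩ := T.mkQ_surjective y
        exact (Submodule.Quotient.mk_eq_zero _).2 (hTs _ ((Submodule.Quotient.mk_eq_zero _).1 hy))
      · intro y
        obtain ⟨y, rfl⟩ := T.mkQ_surjective y
        obtain ⟨z, rfl⟩ := hs.2 y
        exact ⟨T.mkQ z, rfl⟩
    have hreg : ∀ y : ModuleCat.of A (N ⧸ T), x • y = 0 → y = 0 := by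
      intro y hy
      obtain ⟨y, rfl⟩ := T.mkQ_surjective y
      refine (Submodule.Quotient.mk_eq_zero _).2 ?_
      obtain ⟨n, hn⟩ := (hT _).1 ((Submodule.Quotient.mk_eq_zero _).1 hy)
      exact (hT _).2 ⟨n + 1, by rw [pow_succ, mul_smul, hn]⟩
    have hQ : ∀ a ∈ l₁, ∀ y : ModuleCat.of A (N ⧸ T), ∃ n : ℕ, a ^ n • y = 0 := by
      intro a ha y
      obtain ⟨y, rfl⟩ := T.mkQ_surjective y
      obtain ⟨n, hn⟩ := hN a ha y
      exact ⟨n, by rw [← map_smul, hn, map_zero]⟩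
    let t := LocStep.ofRegular x (ModuleCat.of A (N ⧸ T)) hreg
    have h1 : Subsingleton (LocCoh J (ModuleCat.of A T) i) := by
      refine subsingleton_of_length_lt l₂ (l₁ ++ [x]) hl' hJ' _ hsT ?_ i
        (lt_trans (by simp) hi)
      intro a ha y
      rcases List.mem_append.1 ha with ha | ha
      · obtain ⟨n, hn⟩ := hN a ha y.1
        exact ⟨n, Subtype.ext hn⟩
      · rw [List.mem_singleton.1 ha]
        obtain ⟨n, hn⟩ := (hT _).1 y.2
        exact ⟨n, Subtype.ext hn⟩
    have h2 : Subsingleton (LocCoh J (ModuleCat.of A (N ⧸ T)) i) := by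
      obtain ⟨i, rfl⟩ := Nat.exists_eq_succ_of_ne_zero (Nat.ne_zero_of_lt hi)
      have h3 := subsingleton_of_length_lt l₂ (l₁ ++ [x]) hl' hJ' _ (t.smul_bijective hsQ) (by
        intro a ha y
        rcases List.mem_append.1 ha with ha | ha
        · exact t.pow_tors (hQ a ha) y
        · rw [List.mem_singleton.1 ha]
          exact t.tors y) i (by simpa using hi)
      exact (t.δ_bijective (hl x List.mem_cons_self) i).2.subsingleton
    refine subsingleton_of_forall_eq 0 fun z => ?_
    obtain ⟨w, rfl⟩ := (LocCoh.exact₂ (J := J) (shortExact_mkQ T) i z).1 (h2.elim _ _)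
    rw [h1.elim w 0, map_zero]

end Vanishing

section DimensionShift

variable {A : Type u} [CommRing A]

theorem nonempty_equiv_of_ker_eq {N N₁ N₂ : Type*} [AddCommGroup N] [Module A N]
    [AddCommGroup N₁] [Module A N₁] [AddCommGroup N₂] [Module A N₂] (f : N →ₗ[A] N₁)
    (g : N →ₗ[A] N₂) (hf : Function.Surjective f) (hg : Function.Surjective g)
    (h : ∀ x, f x = 0 ↔ g x = 0) : Nonempty (N₁ ≃ₗ[A] N₂) :=
  ⟨(f.quotKerEquivOfSurjective hf).symm ≪≫ₗ
    Submodule.quotEquivOfEq _ _ (by ext x; exact h x) ≪≫ₗ g.quotKerEquivOfSurjective hg⟩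

/-- A complex of modules `K` whose terms are the top local cohomology modules of the middle terms
of a spliced sequence of short exact sequences `0 → Z (k + 1) → P k → Z k → 0`. -/
structure LocResolution (J : Ideal A) (h : ℕ) (K : ChainComplex (ModuleCat.{u} A) ℕ)
    (Z : ℕ → ModuleCat.{u} A) where
  P : ℕ → ModuleCat.{u} A
  ι : ∀ k, Z (k + 1) ⟶ P k
  π : ∀ k, P k ⟶ Z k
  w : ∀ k, ι k ≫ π k = 0
  shortExact : ∀ k, (ShortComplex.mk (ι k) (π k) (w k)).ShortExact
  α : ∀ k, K.X k ≃ₗ[A] LocCoh J (P k) h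
  α_d : ∀ k y, α k ((K.d (k + 1) k).hom y) =
    LocCoh.map J (ι k) h (LocCoh.map J (π (k + 1)) h (α (k + 1) y))
  low : ∀ k j, j < h → Subsingleton (LocCoh J (P k) j)
  high : ∀ k, Subsingleton (LocCoh J (Z k) (h + 1))

namespace LocResolution

variable {J : Ideal A} {h : ℕ} {K : ChainComplex (ModuleCat.{u} A) ℕ} {Z : ℕ → ModuleCat.{u} A}
  (r : LocResolution J h K Z)

/-- The map from the complex to the top local cohomology of the syzygies. -/
noncomputable def ψ (k : ℕ) : K.X k →ₗ[A] LocCoh J (Z k) h :=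
  LocCoh.map J (r.π k) h ∘ₗ (r.α k).toLinearMap

theorem ψ_surjective (k : ℕ) : Function.Surjective (r.ψ k) := by
  intro z
  obtain ⟨y, rfl⟩ := (LocCoh.exact₃ (J := J) (r.shortExact k) h z).1 ((r.high (k + 1)).elim _ _)
  exact ⟨(r.α k).symm y, congrArg _ ((r.α k).apply_symm_apply y)⟩

theorem α_d' (k : ℕ) (y : K.X (k + 1)) : r.α k ((K.d (k + 1) k).hom y) =
    LocCoh.map J (r.ι k) h (r.ψ (k + 1) y) := r.α_d k y

theorem ψ_eq_zero_iff (k : ℕ) (y : K.X k) :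
    r.ψ k y = 0 ↔ ∃ y', (K.d (k + 1) k).hom y' = y := by
  refine (LocCoh.exact₂ (J := J) (r.shortExact k) h (r.α k y)).trans ⟨?_, ?_⟩
  · rintro ⟨w, hw⟩
    obtain ⟨y', rfl⟩ := r.ψ_surjective (k + 1) w
    exact ⟨y', (r.α k).injective ((r.α_d' k y').trans hw)⟩
  · rintro ⟨y', rfl⟩
    exact ⟨_, (r.α_d' k y').symm⟩

include r in
theorem homology_zero : Nonempty (K.homology 0 ≃ₗ[A] LocCoh J (Z 0) h) := by
  refine nonempty_equiv_of_ker_eq (homologyClass K 0 0 ChainComplex.next_nat_zero)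
    (r.ψ 0 ∘ₗ Submodule.subtype _) (homologyClass_surjective _ _ _ _) ?_ fun x => ?_
  · intro z
    obtain ⟨y, rfl⟩ := r.ψ_surjective 0 z
    exact ⟨⟨y, by rw [LinearMap.mem_ker, K.shape 0 0 (by simp)]; rfl⟩, rfl⟩
  · rw [homologyClass_eq_zero_iff K 1 0 0 (by simp)]
    exact (r.ψ_eq_zero_iff 0 x.1).symm

include r in
theorem homology_succ (k : ℕ) : Nonempty (K.homology (k + 1) ≃ₗ[A]
    LinearMap.ker (LocCoh.map J (r.ι k) h)) := by
  have key : ∀ y : K.X (k + 1), y ∈ LinearMap.ker (K.d (k + 1) k).hom ↔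
      r.ψ (k + 1) y ∈ LinearMap.ker (LocCoh.map J (r.ι k) h) := fun y => by
    rw [LinearMap.mem_ker, LinearMap.mem_ker, ← r.α_d' k y]
    exact (map_eq_zero_iff _ (r.α k).injective).symm
  refine nonempty_equiv_of_ker_eq (homologyClass K (k + 1) k (ChainComplex.next_nat_succ k))
    (((r.ψ (k + 1)) ∘ₗ Submodule.subtype _).codRestrict _ fun x => (key x.1).1 x.2)
    (homologyClass_surjective _ _ _ _) ?_ fun x => ?_
  · rintro ⟨z, hz⟩
    obtain ⟨y, rfl⟩ := r.ψ_surjective (k + 1) z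
    exact ⟨⟨y, (key y).2 hz⟩, rfl⟩
  · rw [homologyClass_eq_zero_iff K (k + 2) (k + 1) k (by simp)]
    exact (r.ψ_eq_zero_iff (k + 1) x.1).symm.trans
      ⟨fun h => Subtype.ext h, fun h => congrArg Subtype.val h⟩

include r in
theorem shift (j k : ℕ) (hj : j + 1 < h) :
    Nonempty (LocCoh J (Z k) j ≃ₗ[A] LocCoh J (Z (k + 1)) (j + 1)) := by
  refine ⟨LinearEquiv.ofBijective (LocCoh.δ J (r.shortExact k) j) ⟨?_, ?_⟩⟩
  · rw [← LinearMap.ker_eq_bot, LinearMap.ker_eq_bot']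
    intro z hz
    obtain ⟨w, rfl⟩ := (LocCoh.exact₃ (J := J) (r.shortExact k) j z).1 hz
    rw [(r.low k j (by omega)).elim w 0, map_zero]
  · intro z
    exact (LocCoh.exact₁ (J := J) (r.shortExact k) j z).1 ((r.low k (j + 1) hj).elim _ _)

include r in
theorem shift_iterate (m : ℕ) : ∀ (j k : ℕ), j + m < h →
    Nonempty (LocCoh J (Z k) j ≃ₗ[A] LocCoh J (Z (k + m)) (j + m)) := by
  induction m with
  | zero => exact fun j k _ => ⟨LinearEquiv.refl _ _⟩
  | succ m ih =>
    intro j k hj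
    obtain ⟨e⟩ := ih j k (by omega)
    obtain ⟨e'⟩ := r.shift (j + m) (k + m) (by omega)
    exact ⟨e.trans e'⟩

theorem zero_injective (k : ℕ) : Function.Injective (LocCoh.map J (r.ι k) 0) := by
  rw [← LinearMap.ker_eq_bot, LinearMap.ker_eq_bot']
  intro z hz
  refine LocCoh.eval_injective _ ((ModuleCat.mono_iff_injective (r.ι k)).1
    (r.shortExact k).mono_f ?_)
  have := LocCoh.eval_map (J := J) (r.ι k) z
  rw [hz, map_zero] at this
  rw [map_zero]
  exact this.symm.trans (map_zero _).symm

include r in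
theorem kernel_equiv (k : ℕ) {j : ℕ} (hj : j + 1 = h) : Nonempty (LocCoh J (Z k) j ≃ₗ[A]
    LinearMap.ker (LocCoh.map J (r.ι k) h)) := by
  subst hj
  have hinj : Function.Injective (LocCoh.δ J (r.shortExact k) j) := by
    rw [← LinearMap.ker_eq_bot, LinearMap.ker_eq_bot']
    intro z hz
    obtain ⟨w, rfl⟩ := (LocCoh.exact₃ (J := J) (r.shortExact k) j z).1 hz
    rw [(r.low k j (Nat.lt_succ_self j)).elim w 0, map_zero]
  exact ⟨(LinearEquiv.ofInjective _ hinj).trans (LinearEquiv.ofEq _ _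
    (LinearMap.exact_iff.1 (LocCoh.exact₁ (J := J) (r.shortExact k) j)).symm)⟩

include r in
theorem homology_equiv (k : ℕ) (hk : k ≤ h) :
    Nonempty (K.homology k ≃ₗ[A] LocCoh J (Z 0) (h - k)) := by
  cases k with
  | zero => exact r.homology_zero
  | succ k =>
    obtain ⟨e⟩ := r.homology_succ k
    obtain ⟨e'⟩ := r.kernel_equiv k (j := h - (k + 1) + k) (by omega)
    obtain ⟨e''⟩ := r.shift_iterate k (h - (k + 1)) 0 (by omega)
    rw [zero_add] at e''
    exact ⟨e.trans (e''.trans e').symm⟩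

include r in
theorem homology_subsingleton (k : ℕ) (hk : h < k) : Subsingleton (K.homology k) := by
  obtain ⟨k, rfl⟩ := Nat.exists_eq_succ_of_ne_zero (Nat.ne_zero_of_lt hk)
  obtain ⟨e⟩ := r.homology_succ k
  suffices Subsingleton (LinearMap.ker (LocCoh.map J (r.ι k) h)) from e.toEquiv.subsingleton
  rcases h with _ | j
  · rw [LinearMap.ker_eq_bot.2 (r.zero_injective k)]
    infer_instance
  · obtain ⟨e'⟩ := r.kernel_equiv k (j := j) rfl
    obtain ⟨n, rfl⟩ : ∃ n, k = n + 1 + j := ⟨k - (j + 1), by omega⟩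
    obtain ⟨e''⟩ := r.shift_iterate j 0 (n + 1) (by omega)
    rw [zero_add] at e''
    have := r.low n 0 j.succ_pos
    have := (r.zero_injective n).subsingleton
    exact (e''.trans e').symm.toEquiv.subsingleton

end LocResolution

end DimensionShift

section TorOfChain

open scoped TensorProduct

variable {A : Type u} [CommRing A]

/-- The syzygies of a complex augmented by a module `M`. -/
def syzygy (C : ChainComplex (ModuleCat.{u} A) ℕ) (M : ModuleCat.{u} A) : ℕ → ModuleCat.{u} A
  | 0 => M
  | k + 1 => ModuleCat.of A (LinearMap.range (C.d (k + 1) k).hom)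

/-- The inclusion of a syzygy. -/
def syzygyι (C : ChainComplex (ModuleCat.{u} A) ℕ) (M : ModuleCat.{u} A) (k : ℕ) :
    syzygy C M (k + 1) →ₗ[A] C.X k := (LinearMap.range (C.d (k + 1) k).hom).subtype

/-- The projection onto a syzygy. -/
def syzygyπ (C : ChainComplex (ModuleCat.{u} A) ℕ) {M : ModuleCat.{u} A} (ε : C.X 0 →ₗ[A] M) :
    ∀ k, C.X k →ₗ[A] syzygy C M k
  | 0 => ε
  | k + 1 => (C.d (k + 1) k).hom.rangeRestrict

variable {C : ChainComplex (ModuleCat.{u} A) ℕ} {M : ModuleCat.{u} A} {ε : C.X 0 →ₗ[A] M}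

theorem syzygyι_injective (k : ℕ) : Function.Injective (syzygyι C M k) :=
  Submodule.injective_subtype _

theorem syzygyπ_surjective (hε : Function.Surjective ε) :
    ∀ k, Function.Surjective (syzygyπ C ε k)
  | 0 => hε
  | k + 1 => (C.d (k + 1) k).hom.surjective_rangeRestrict

theorem syzygyι_comp_syzygyπ (k : ℕ) :
    syzygyι C M k ∘ₗ syzygyπ C ε (k + 1) = (C.d (k + 1) k).hom := rfl

theorem syzygy_exact (h0 : Function.Exact (C.d 1 0).hom ε)
    (h1 : ∀ k, Function.Exact (C.d (k + 2) (k + 1)).hom (C.d (k + 1) k).hom) :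
    ∀ k, Function.Exact (syzygyι C M k) (syzygyπ C ε k)
  | 0 => fun y => (h0 y).trans ⟨fun ⟨z, hz⟩ => ⟨⟨_, z, rfl⟩, hz⟩, fun ⟨⟨_, z, hz⟩, hy⟩ => ⟨z, hz.trans hy⟩⟩
  | k + 1 => fun y => (Subtype.ext_iff.trans (h1 k y)).trans
      ⟨fun ⟨z, hz⟩ => ⟨⟨_, z, rfl⟩, hz⟩, fun ⟨⟨_, z, hz⟩, hy⟩ => ⟨z, hz.trans hy⟩⟩

theorem tensor_mem_powTors {J : Ideal A} {X Q : Type*} [AddCommGroup X] [Module A X]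
    [AddCommGroup Q] [Module A Q] (hX : ∀ x : X, x ∈ powTors J X) (y : X ⊗[A] Q) :
    y ∈ powTors J (X ⊗[A] Q) := by
  induction y using TensorProduct.induction_on with
  | zero => exact zero_mem _
  | tmul a b => exact map_mem_powTors ((TensorProduct.mk A X Q).flip b) (hX a)
  | add a b ha hb => exact add_mem ha hb

theorem smul_tensor_bijective {s : A} {N Q : Type*} [AddCommGroup N] [Module A N]
    [AddCommGroup Q] [Module A Q] (hs : Function.Bijective fun y : N => s • y) :
    Function.Bijective fun y : N ⊗[A] Q => s • y := by
  let e : N ≃ₗ[A] N := LinearEquiv.ofBijective (s • LinearMap.id) hs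
  have : (fun y : N ⊗[A] Q => s • y) = e.rTensor Q := by
    have h2 : (e : N →ₗ[A] N) = s • LinearMap.id := rfl
    ext y
    rw [← LinearEquiv.coe_coe, LinearEquiv.coe_rTensor, h2, LinearMap.rTensor_smul,
      LinearMap.rTensor_id]
    rfl
  rw [this]
  exact (e.rTensor Q).bijective

/-- The comparison of a torsion module tensored with a flat module with top local cohomology. -/
noncomputable def LocChain.topEquiv {J : Ideal A} {l : List A} {N X : ModuleCat.{u} A}
    (c : LocChain l N X) (hl : ∀ x ∈ l, x ∈ J) (hX : ∀ x : X, x ∈ powTors J X)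
    (Q : Type u) [AddCommGroup Q] [Module A Q] [Module.Flat A Q] :
    (X ⊗[A] Q) ≃ₗ[A] LocCoh J (ModuleCat.of A (N ⊗[A] Q)) (0 + l.length) :=
  (LinearEquiv.ofBijective (LocCoh.eval J (ModuleCat.of A (X ⊗[A] Q)))
    (LocCoh.eval_bijective_of_torsion (tensor_mem_powTors hX))).symm ≪≫ₗ
  LinearEquiv.ofBijective (c.δ J Q 0) (c.δ_bijective Q 0 hl)

theorem LocChain.topEquiv_naturality {J : Ideal A} {l : List A} {N X : ModuleCat.{u} A}
    (c : LocChain l N X) (hl : ∀ x ∈ l, x ∈ J) (hX : ∀ x : X, x ∈ powTors J X)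
    {Q Q' : Type u} [AddCommGroup Q] [Module A Q] [Module.Flat A Q]
    [AddCommGroup Q'] [Module A Q'] [Module.Flat A Q'] (q : Q →ₗ[A] Q') (y : X ⊗[A] Q) :
    c.topEquiv hl hX Q' (q.lTensor X y) =
      LocCoh.map J (ModuleCat.ofHom (q.lTensor N)) _ (c.topEquiv hl hX Q y) := by
  let ev (Q : Type u) [AddCommGroup Q] [Module A Q] :=
    LinearEquiv.ofBijective (LocCoh.eval J (ModuleCat.of A (X ⊗[A] Q)))
      (LocCoh.eval_bijective_of_torsion (tensor_mem_powTors hX))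
  obtain ⟨z, rfl⟩ := (ev Q).surjective y
  have h1 : c.topEquiv hl hX Q (ev Q z) = c.δ J Q 0 z :=
    congrArg (c.δ J Q 0) ((ev Q).symm_apply_apply z)
  have h2 : q.lTensor X (ev Q z) = ev Q' (LocCoh.map J (ModuleCat.ofHom (q.lTensor X)) 0 z) :=
    (LocCoh.eval_map (J := J) (ModuleCat.ofHom (q.lTensor X)) z).symm
  have h3 : ∀ w, c.topEquiv hl hX Q' (ev Q' w) = c.δ J Q' 0 w := fun w =>
    congrArg (c.δ J Q' 0) ((ev Q').symm_apply_apply w)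
  rw [h1, h2, h3, c.δ_naturality]

/-- A chain of localization steps computes the complex obtained by tensoring a flat resolution. -/
noncomputable def LocChain.locResolution [IsNoetherianRing A] {J : Ideal A} {l : List A}
    {N X : ModuleCat.{u} A} [Module.Flat A N] (c : LocChain l N X) (hl : ∀ x ∈ l, x ∈ J)
    (hX : ∀ x : X, x ∈ powTors J X) {s : A} (hs : Function.Bijective fun y : N => s • y)
    (hJ : ∀ a ∈ J, ∃ n : ℕ, s * a ^ n ∈ Ideal.ofList l) (hε : Function.Surjective ε)
    (h0 : Function.Exact (C.d 1 0).hom ε)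
    (h1 : ∀ k, Function.Exact (C.d (k + 2) (k + 1)).hom (C.d (k + 1) k).hom)
    [∀ k, Module.Flat A (C.X k)] :
    LocResolution J (0 + l.length)
      ((((MonoidalCategory.tensoringLeft (ModuleCat.{u} A)).obj X).mapHomologicalComplex _).obj C)
      (fun k => ModuleCat.of A (N ⊗[A] syzygy C M k)) where
  P k := ModuleCat.of A (N ⊗[A] C.X k)
  ι k := ModuleCat.ofHom ((syzygyι C M k).lTensor N)
  π k := ModuleCat.ofHom ((syzygyπ C ε k).lTensor N)
  w k := by
    rw [← ModuleCat.ofHom_comp, ← LinearMap.lTensor_comp, (syzygy_exact h0 h1 k).linearMap_comp_eq_zero,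
      LinearMap.lTensor_zero]
    rfl
  shortExact k := exact_of_function_exact
    (Module.Flat.lTensor_preserves_injective_linearMap _ (syzygyι_injective k))
    (LinearMap.lTensor_surjective N (syzygyπ_surjective hε k))
    (lTensor_exact N (syzygy_exact h0 h1 k) (syzygyπ_surjective hε k))
  α k := c.topEquiv hl hX (C.X k)
  α_d k y := by
    rw [LocCoh.map_map, ← ModuleCat.ofHom_comp, ← LinearMap.lTensor_comp, syzygyι_comp_syzygyπ]
    exact c.topEquiv_naturality hl hX (C.d (k + 1) k).hom y
  low k j hj := c.subsingleton_of_lt (C.X k) hl j (by simpa using hj)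
  high k := LocCoh.subsingleton_of_length_lt l [] hl (by simpa using hJ) _
    (smul_tensor_bijective hs) (fun a ha => absurd ha List.not_mem_nil) _ (Nat.lt_succ_of_le (by simp))

theorem exists_flat_resolution (M : ModuleCat.{u} A) :
    ∃ (C : ChainComplex (ModuleCat.{u} A) ℕ) (ε : C.X 0 →ₗ[A] M),
      Function.Surjective ε ∧ Function.Exact (C.d 1 0).hom ε ∧
      (∀ k, Function.Exact (C.d (k + 2) (k + 1)).hom (C.d (k + 1) k).hom) ∧
      (∀ k, Module.Flat A (C.X k)) ∧
      ∀ (X : ModuleCat.{u} A) (k : ℕ), Nonempty ((((Tor (ModuleCat.{u} A) k).obj X).obj M) ≅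
        HomologicalComplex.homology ((((MonoidalCategory.tensoringLeft (ModuleCat.{u} A)).obj
          X).mapHomologicalComplex _).obj C) k) := by
  let P : ProjectiveResolution M := (inferInstance : HasProjectiveResolution M).out.some
  refine ⟨P.complex, (P.π.f 0).hom, ?_, ?_, ?_, ?_, ?_⟩
  · exact (ModuleCat.epi_iff_surjective (P.π.f 0)).1 inferInstance
  · have := P.exact₀
    exact (ShortComplex.ShortExact.moduleCat_exact_iff_function_exact _).1 this
  · intro k
    exact (ShortComplex.ShortExact.moduleCat_exact_iff_function_exact _).1 (P.exact_succ k)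
  · intro k
    have : Module.Projective A (P.complex.X k) := (IsProjective.iff_projective _).2 (P.projective k)
    infer_instance
  · exact fun X k => ⟨P.isoLeftDerivedObj _ k⟩

theorem LocChain.tor_equiv [IsNoetherianRing A] {J : Ideal A} {l : List A}
    {N X : ModuleCat.{u} A} [Module.Flat A N] (c : LocChain l N X) (hl : ∀ x ∈ l, x ∈ J)
    (hX : ∀ x : X, x ∈ powTors J X) {s : A} (hs : Function.Bijective fun y : N => s • y)
    (hJ : ∀ a ∈ J, ∃ n : ℕ, s * a ^ n ∈ Ideal.ofList l) (M : ModuleCat.{u} A) (k : ℕ) :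
    (k ≤ l.length → Nonempty (((Tor (ModuleCat.{u} A) k).obj X).obj M ≃ₗ[A]
      LocCoh J (ModuleCat.of A (N ⊗[A] M)) (l.length - k))) ∧
    (l.length < k → Subsingleton (((Tor (ModuleCat.{u} A) k).obj X).obj M)) := by
  obtain ⟨C, ε, hε, h0, h1, hflat, hT⟩ := exists_flat_resolution M
  obtain ⟨e⟩ := hT X k
  have r := c.locResolution hl hX hs hJ hε h0 h1
  refine ⟨fun hk => ?_, fun hk => ?_⟩
  · obtain ⟨e'⟩ := r.homology_equiv k (by omega)
    rw [zero_add] at e'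
    exact ⟨e.toLinearEquiv.trans e'⟩
  · have := r.homology_subsingleton k (by omega)
    exact e.toLinearEquiv.toEquiv.subsingleton

end TorOfChain

section LocalCohomologyComparison

variable {A : Type u} [CommRing A] (J : Ideal A) (N : ModuleCat.{u} A) (i : ℕ)

/-- The comparison of `Ext` modules out of `A/J^n`. -/
noncomputable def powQuotExtComparison (n : ℕ) :
    ((Ext A (ModuleCat.{u} A) i).obj (Opposite.op (powQuot J n))).obj N ≃ₗ[A]
      Abelian.Ext (powQuot J n) N i :=
  extComparison (inferInstance : HasProjectiveResolution (powQuot J n)).out.some N i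

theorem powQuotExtComparison_naturality {m n : ℕ} (h : m ≤ n)
    (e : ((Ext A (ModuleCat.{u} A) i).obj (Opposite.op (powQuot J m))).obj N) :
    powQuotExtComparison J N i n ((((Ext A (ModuleCat.{u} A) i).map
        (powQuotMap J h).op).app N).hom e) =
      locCohTrans J N i m n h (powQuotExtComparison J N i m e) :=
  extComparison_naturality _ _ _ _ _ _

/-- The diagram of `Ext` modules defining local cohomology, evaluated at `N`. -/
noncomputable abbrev extPowDiagram : ℕᵒᵖᵒᵖ ⥤ ModuleCat.{u} A :=
  localCohomology.diagram (localCohomology.idealPowersDiagram J) i ⋙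
    (evaluation (ModuleCat.{u} A) (ModuleCat.{u} A)).obj N

theorem extPowDiagram_map {a b : ℕᵒᵖᵒᵖ} (f : a ⟶ b)
    (e : ((Ext A (ModuleCat.{u} A) i).obj (Opposite.op (powQuot J a.unop.unop))).obj N) :
    powQuotExtComparison J N i b.unop.unop (((extPowDiagram J N i).map f).hom e) =
      locCohTrans J N i a.unop.unop b.unop.unop f.unop.unop.down.down
        (powQuotExtComparison J N i a.unop.unop e) :=
  powQuotExtComparison_naturality J N i _ e

/-- The cocone with point `LocCoh J N i`. -/
noncomputable def locCohCocone : Cocone (extPowDiagram J N i) where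
  pt := ModuleCat.of A (LocCoh J N i)
  ι :=
    { app := fun a => ModuleCat.ofHom
        (locCohOf J N i a.unop.unop ∘ₗ (powQuotExtComparison J N i a.unop.unop).toLinearMap)
      naturality := fun a b f => by
        ext e
        exact (congrArg (locCohOf J N i b.unop.unop) (extPowDiagram_map J N i f e)).trans
          Module.DirectLimit.of_f }

variable {J N i} in
/-- The map out of `LocCoh J N i` induced by a cocone. -/
noncomputable def locCohDesc (s : Cocone (extPowDiagram J N i)) : LocCoh J N i →ₗ[A] s.pt :=
  Module.DirectLimit.lift A ℕ _ _
    (fun n => (s.ι.app (Opposite.op (Opposite.op n))).hom ∘ₗ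
      (powQuotExtComparison J N i n).symm.toLinearMap) (by
    intro m n h x
    obtain ⟨e, rfl⟩ := (powQuotExtComparison J N i m).surjective x
    let f : Opposite.op (Opposite.op m) ⟶ Opposite.op (Opposite.op n) := (homOfLE h).op.op
    have h1 := extPowDiagram_map J N i f e
    have h2 := LinearMap.congr_fun (congrArg ModuleCat.Hom.hom (s.w f)) e
    refine Eq.trans ?_ (h2.trans ?_)
    · refine congrArg (s.ι.app (Opposite.op (Opposite.op n))).hom ?_
      exact ((powQuotExtComparison J N i n).symm_apply_eq).2 h1.symm
    · exact congrArg (s.ι.app (Opposite.op (Opposite.op m))).hom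
        ((powQuotExtComparison J N i m).symm_apply_apply e).symm)

variable {J N i} in
theorem locCohDesc_of (s : Cocone (extPowDiagram J N i)) (n : ℕ)
    (e : ((Ext A (ModuleCat.{u} A) i).obj (Opposite.op (powQuot J n))).obj N) :
    locCohDesc s (locCohOf J N i n (powQuotExtComparison J N i n e)) =
      (s.ι.app (Opposite.op (Opposite.op n))).hom e := by
  rw [locCohDesc, Module.DirectLimit.lift_of]
  exact congrArg (s.ι.app (Opposite.op (Opposite.op n))).hom
    ((powQuotExtComparison J N i n).symm_apply_apply e)

/-- `LocCoh J N i` is a colimit of the diagram of `Ext` modules. -/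
noncomputable def locCohCoconeIsColimit : IsColimit (locCohCocone J N i) where
  desc s := ModuleCat.ofHom (locCohDesc s)
  fac s a := ModuleCat.hom_ext (LinearMap.ext fun e => locCohDesc_of s a.unop.unop e)
  uniq s m hm := ModuleCat.hom_ext (LinearMap.ext fun z => by
    obtain ⟨n, x, rfl⟩ := LocCoh.exists_of z
    obtain ⟨e, rfl⟩ := (powQuotExtComparison J N i n).surjective x
    have := LinearMap.congr_fun (congrArg ModuleCat.Hom.hom (hm (Opposite.op (Opposite.op n)))) e
    exact this.trans (locCohDesc_of s n e).symm)

/-- Local cohomology as a direct limit of derived-category `Ext` modules. -/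
noncomputable def localCohomologyEquiv : (localCohomology J i).obj N ≃ₗ[A] LocCoh J N i :=
  ((isColimitOfPreserves ((evaluation (ModuleCat.{u} A) (ModuleCat.{u} A)).obj N)
    (colimit.isColimit (localCohomology.diagram (localCohomology.idealPowersDiagram J)
      i))).coconePointUniqueUpToIso (locCohCoconeIsColimit J N i)).toLinearEquiv

end LocalCohomologyComparison

section ChangeOfRings

variable {R A : Type u} [CommRing R] [CommRing A] [Algebra R A]

theorem nonempty_addEquiv_of_ker_eq {T X Y : Type*} [AddCommGroup T] [Module R T]
    [AddCommGroup X] [Module R X] [AddCommGroup Y] [Module A Y] (f : T →ₗ[R] X) (g : T →+ Y)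
    (hg : ∀ (r : R) t, g (r • t) = algebraMap R A r • g t) (hf : Function.Surjective f)
    (hg' : Function.Surjective g) (h : ∀ t, f t = 0 ↔ g t = 0) :
    ∃ e : X ≃+ Y, ∀ (r : R) x, e (r • x) = algebraMap R A r • e x := by
  let _ : Module R Y := Module.compHom Y (algebraMap R A)
  let g' : T →ₗ[R] Y := { g with map_smul' := hg }
  obtain ⟨e⟩ := nonempty_equiv_of_ker_eq f g' hf hg' h
  exact ⟨e.toAddEquiv, e.map_smul⟩

theorem injective_of_flat_algebra [Module.Flat R A] {I : Type u} [AddCommGroup I] [Module R I]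
    [Module A I] [IsScalarTower R A I] (hI : Module.Injective A I) :
    Injective (ModuleCat.of R I) := by
  have h1 : Injective (ModuleCat.of A I) := Module.injective_object_of_injective_module A I
  have := ModuleCat.preservesFiniteLimits_extendScalars_of_flat (f := algebraMap R A)
    (RingHom.flat_algebraMap_iff.2 inferInstance)
  have h2 : Injective ((ModuleCat.restrictScalars (algebraMap R A)).obj (ModuleCat.of A I)) :=
    Injective.injective_of_adjoint (ModuleCat.extendRestrictScalarsAdj (algebraMap R A)) _
  let e : I ≃ₗ[R] (ModuleCat.restrictScalars (algebraMap R A)).obj (ModuleCat.of A I) :=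
    { AddEquiv.refl I with map_smul' := fun r x => (algebraMap_smul A r x).symm }
  exact Injective.of_iso e.symm.toModuleIso h2

theorem mem_powTors_map_iff {J : Ideal R} {N : Type*} [AddCommGroup N] [Module R N] [Module A N]
    [IsScalarTower R A N] {x : N} :
    x ∈ powTors (J.map (algebraMap R A)) N ↔ x ∈ powTors J N := by
  refine exists_congr fun n => ?_
  rw [← Ideal.map_pow]
  constructor
  · intro h a ha
    rw [← algebraMap_smul A a x]
    exact h _ (Ideal.mem_map_of_mem _ ha)
  · intro h
    have : Ideal.map (algebraMap R A) (J ^ n) ≤ LinearMap.ker (LinearMap.toSpanSingleton A N x) :=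
      Ideal.map_le_iff_le_comap.2 fun a ha => by
        change algebraMap R A a • x = 0
        rw [algebraMap_smul, h a ha]
    exact fun a ha => this ha

variable (A) in
theorem LocCoh.exists_addEquiv_zero (J : Ideal R) (N : Type u) [AddCommGroup N] [Module R N]
    [Module A N] [IsScalarTower R A N] :
    ∃ e : LocCoh J (ModuleCat.of R N) 0 ≃+ LocCoh (J.map (algebraMap R A)) (ModuleCat.of A N) 0,
      (∀ z, LocCoh.eval _ _ (e z) = LocCoh.eval _ _ z) ∧
      ∀ (r : R) x, e (r • x) = algebraMap R A r • e x := by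
  let e0 : powTors J N ≃+ powTors (J.map (algebraMap R A)) N :=
    { toFun := fun x => ⟨x.1, mem_powTors_map_iff.2 x.2⟩
      invFun := fun x => ⟨x.1, mem_powTors_map_iff.1 x.2⟩
      left_inv := fun _ => rfl
      right_inv := fun _ => rfl
      map_add' := fun _ _ => rfl }
  let e1 := LocCoh.zeroEquiv (J := J) (ModuleCat.of R N)
  let e2 := LocCoh.zeroEquiv (J := J.map (algebraMap R A)) (ModuleCat.of A N)
  let e := (e1.toAddEquiv.trans e0).trans e2.symm.toAddEquiv
  have he : ∀ z, LocCoh.eval _ _ (e z) = LocCoh.eval _ _ z := fun z => by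
    refine (LocCoh.coe_zeroEquiv (e z)).symm.trans ?_
    have : e2 (e z) = e0 (e1 z) := e2.apply_symm_apply _
    exact (congrArg Subtype.val this).trans (LocCoh.coe_zeroEquiv z)
  refine ⟨e, he, fun r x => LocCoh.eval_injective _ ?_⟩
  rw [he, map_smul, map_smul, he]
  exact (algebraMap_smul A r _).symm

theorem mem_range_of_subsingleton {N N' : Type*} [AddCommGroup N] [Module R N] [AddCommGroup N']
    [Module R N'] [Subsingleton N] (f : N →ₗ[R] N') (z : N') : z ∈ Set.range f ↔ z = 0 :=
  ⟨fun ⟨w, hw⟩ => by rw [← hw, Subsingleton.elim w 0, map_zero], fun h => ⟨0, by rw [h, map_zero]⟩⟩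

set_option maxHeartbeats 1000000 in
theorem LocCoh.exists_addEquiv [Module.Flat R A] (J : Ideal R) (i : ℕ) :
    ∀ (N : Type u) [AddCommGroup N] [Module R N] [Module A N] [IsScalarTower R A N],
    ∃ e : LocCoh J (ModuleCat.of R N) i ≃+ LocCoh (J.map (algebraMap R A)) (ModuleCat.of A N) i,
      ∀ (r : R) x, e (r • x) = algebraMap R A r • e x := by
  induction i with
  | zero =>
    intro N _ _ _ _
    obtain ⟨e, -, he⟩ := LocCoh.exists_addEquiv_zero A J N
    exact ⟨e, he⟩
  | succ i ih =>
    intro N _ _ _ _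
    obtain ⟨I, _, _, ι, hI, hι⟩ := exists_injective_embedding (A := A) N
    let _ : Module R I := Module.compHom I (algebraMap R A)
    have _ : IsScalarTower R A I := IsScalarTower.of_algebraMap_smul fun _ _ => rfl
    have hIR : Injective (ModuleCat.of R I) := injective_of_flat_algebra hI
    have hIA : Injective (ModuleCat.of A I) := Module.injective_object_of_injective_module A I
    let Q := I ⧸ LinearMap.range ι
    let q : I →ₗ[A] Q := (LinearMap.range ι).mkQ
    have hq : Function.Surjective q := Submodule.mkQ_surjective _
    have hex : Function.Exact ι q := LinearMap.exact_map_mkQ_range ι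
    have hA := exact_of_function_exact hι hq hex
    have hR := exact_of_function_exact (f := ι.restrictScalars R) (g := q.restrictScalars R)
      hι hq hex
    have sA := fun i => LocCoh.subsingleton_of_injective (J := J.map (algebraMap R A))
      (ModuleCat.of A I) i
    have sR := fun i => LocCoh.subsingleton_of_injective (J := J) (ModuleCat.of R I) i
    have surjA : Function.Surjective (LocCoh.δ (J.map (algebraMap R A)) hA i) := fun z =>
      (LocCoh.exact₁ (J := J.map (algebraMap R A)) hA i z).1 ((sA i).elim _ _)
    have surjR : Function.Surjective (LocCoh.δ J hR i) := fun z =>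
      (LocCoh.exact₁ (J := J) hR i z).1 ((sR i).elim _ _)
    suffices ∃ e : LocCoh J (ModuleCat.of R Q) i ≃+
        LocCoh (J.map (algebraMap R A)) (ModuleCat.of A Q) i,
        (∀ (r : R) x, e (r • x) = algebraMap R A r • e x) ∧
        ∀ z, z ∈ Set.range (LocCoh.map J (ModuleCat.ofHom (q.restrictScalars R)) i) ↔
          e z ∈ Set.range (LocCoh.map (J.map (algebraMap R A)) (ModuleCat.ofHom q) i) by
      obtain ⟨e, he, h⟩ := this
      refine nonempty_addEquiv_of_ker_eq (LocCoh.δ J hR i)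
        ((LocCoh.δ (J.map (algebraMap R A)) hA i).toAddMonoidHom.comp e.toAddMonoidHom)
        (fun r t => ?_) surjR (surjA.comp e.surjective) fun z => ?_
      · exact (congrArg (LocCoh.δ (J.map (algebraMap R A)) hA i) (he r t)).trans (map_smul _ _ _)
      · exact (LocCoh.exact₃ (J := J) hR i z).trans ((h z).trans
          (LocCoh.exact₃ (J := J.map (algebraMap R A)) hA i (e z)).symm)
    clear surjA surjR hR hA
    cases i with
    | zero =>
      obtain ⟨e, h, he⟩ := LocCoh.exists_addEquiv_zero A J Q
      obtain ⟨e', h', -⟩ := LocCoh.exists_addEquiv_zero A J I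
      refine ⟨e, he, fun z => ?_⟩
      have key : ∀ w, e (LocCoh.map J (ModuleCat.ofHom (q.restrictScalars R)) 0 w) =
          LocCoh.map (J.map (algebraMap R A)) (ModuleCat.ofHom q) 0 (e' w) := fun w =>
        LocCoh.eval_injective _ ((h _).trans ((LocCoh.eval_map _ _).trans
          ((congrArg q (h' w)).symm.trans (LocCoh.eval_map (ModuleCat.ofHom q) (e' w)).symm)))
      constructor
      · rintro ⟨w, rfl⟩
        exact ⟨e' w, (key w).symm⟩
      · rintro ⟨w, hw⟩
        obtain ⟨w, rfl⟩ := e'.surjective w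
        exact ⟨w, e.injective ((key w).trans hw)⟩
    | succ i =>
      obtain ⟨e, he⟩ := ih Q
      have _ := sA i
      have _ := sR i
      refine ⟨e, he, fun z => ?_⟩
      exact (mem_range_of_subsingleton _ z).trans
        (e.map_eq_zero_iff.symm.trans (mem_range_of_subsingleton _ (e z)).symm)

theorem LocCoh.nonempty_equiv_restrictScalars [Module.Flat R A] (J : Ideal R) (i : ℕ)
    (N : Type u) [AddCommGroup N] [Module R N] [Module A N] [IsScalarTower R A N] :
    Nonempty (LocCoh J (ModuleCat.of R N) i ≃ₗ[R]
      (ModuleCat.restrictScalars (algebraMap R A)).obj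
        ((localCohomology (J.map (algebraMap R A)) i).obj (ModuleCat.of A N))) := by
  obtain ⟨e, he⟩ := LocCoh.exists_addEquiv (A := A) J i N
  let e' := localCohomologyEquiv (J.map (algebraMap R A)) (ModuleCat.of A N) i
  exact ⟨{ e.trans e'.symm.toAddEquiv with
    map_smul' := fun r x => (congrArg e'.symm (he r x)).trans (map_smul e'.symm _ _) }⟩

end ChangeOfRings

section ExtVanishing

variable {R : Type u} [CommRing R]

/-- The vanishing of `Ext_R^n(F, N)`. -/
abbrev ExtVanish (R : Type u) [CommRing R] (F N : Type u) [AddCommGroup F] [Module R F]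
    [AddCommGroup N] [Module R N] (n : ℕ) : Prop :=
  Subsingleton (Abelian.Ext (ModuleCat.of R F) (ModuleCat.of R N) n)

variable {F F₁ F₂ F₃ N N₁ N₂ N₃ : Type u} [AddCommGroup F] [Module R F]
  [AddCommGroup F₁] [Module R F₁] [AddCommGroup F₂] [Module R F₂] [AddCommGroup F₃] [Module R F₃]
  [AddCommGroup N] [Module R N]
  [AddCommGroup N₁] [Module R N₁] [AddCommGroup N₂] [Module R N₂] [AddCommGroup N₃] [Module R N₃]

namespace ExtVanish

theorem left_middle {f : F₁ →ₗ[R] F₂} {g : F₂ →ₗ[R] F₃} (hf : Function.Injective f)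
    (hg : Function.Surjective g) (h : Function.Exact f g) {n : ℕ}
    (h₁ : ExtVanish R F₁ N n) (h₃ : ExtVanish R F₃ N n) : ExtVanish R F₂ N n := by
  refine subsingleton_of_forall_eq 0 fun z => ?_
  obtain ⟨w, hw⟩ := Abelian.Ext.contravariant_sequence_exact₂ (exact_of_function_exact hf hg h) _ z
    (h₁.elim _ _)
  rw [← hw, h₃.elim w 0, Abelian.Ext.comp_zero]

theorem left_three {f : F₁ →ₗ[R] F₂} {g : F₂ →ₗ[R] F₃} (hf : Function.Injective f)
    (hg : Function.Surjective g) (h : Function.Exact f g) {n : ℕ}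
    (h₁ : ExtVanish R F₁ N n) (h₂ : ExtVanish R F₂ N (n + 1)) : ExtVanish R F₃ N (n + 1) := by
  refine subsingleton_of_forall_eq 0 fun z => ?_
  obtain ⟨w, hw⟩ := Abelian.Ext.contravariant_sequence_exact₃ (exact_of_function_exact hf hg h) _ z
    (h₂.elim _ _) (add_comm 1 n)
  rw [← hw, h₁.elim w 0, Abelian.Ext.comp_zero]

theorem left_one {f : F₁ →ₗ[R] F₂} {g : F₂ →ₗ[R] F₃} (hf : Function.Injective f)
    (hg : Function.Surjective g) (h : Function.Exact f g) {n : ℕ}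
    (h₂ : ExtVanish R F₂ N n) (h₃ : ExtVanish R F₃ N (n + 1)) : ExtVanish R F₁ N n := by
  refine subsingleton_of_forall_eq 0 fun z => ?_
  obtain ⟨w, hw⟩ := Abelian.Ext.contravariant_sequence_exact₁ (exact_of_function_exact hf hg h) _ z
    (add_comm 1 n) (h₃.elim _ _)
  rw [← hw, h₂.elim w 0, Abelian.Ext.comp_zero]

theorem right_three {f : N₁ →ₗ[R] N₂} {g : N₂ →ₗ[R] N₃} (hf : Function.Injective f)
    (hg : Function.Surjective g) (h : Function.Exact f g) {n : ℕ}
    (h₁ : ExtVanish R F N₁ (n + 1)) (h₂ : ExtVanish R F N₂ n) : ExtVanish R F N₃ n := by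
  refine subsingleton_of_forall_eq 0 fun z => ?_
  obtain ⟨w, hw⟩ := Abelian.Ext.covariant_sequence_exact₃ _ (exact_of_function_exact hf hg h) z
    rfl (h₁.elim _ _)
  rw [← hw, h₂.elim w 0, Abelian.Ext.zero_comp]

theorem right_one {f : N₁ →ₗ[R] N₂} {g : N₂ →ₗ[R] N₃} (hf : Function.Injective f)
    (hg : Function.Surjective g) (h : Function.Exact f g) {n : ℕ}
    (h₂ : ExtVanish R F N₂ (n + 1)) (h₃ : ExtVanish R F N₃ n) : ExtVanish R F N₁ (n + 1) := by
  refine subsingleton_of_forall_eq 0 fun z => ?_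
  obtain ⟨w, hw⟩ := Abelian.Ext.covariant_sequence_exact₁ _ (exact_of_function_exact hf hg h) z
    (h₂.elim _ _) rfl
  rw [← hw, h₃.elim w 0, Abelian.Ext.zero_comp]

theorem exists_extension {f : F₁ →ₗ[R] F₂} {g : F₂ →ₗ[R] F₃} (hf : Function.Injective f)
    (hg : Function.Surjective g) (h : Function.Exact f g) (h₃ : ExtVanish R F₃ N 1)
    (φ : F₁ →ₗ[R] N) : ∃ ψ : F₂ →ₗ[R] N, ψ ∘ₗ f = φ := by
  obtain ⟨w, hw⟩ := Abelian.Ext.contravariant_sequence_exact₁ (exact_of_function_exact hf hg h) _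
    (Abelian.Ext.mk₀ (ModuleCat.ofHom φ)) (add_zero 1) (h₃.elim _ _)
  obtain ⟨ψ, rfl⟩ := (Abelian.Ext.mk₀_bijective _ _).2 w
  rw [Abelian.Ext.mk₀_comp_mk₀] at hw
  exact ⟨ψ.hom, congrArg ModuleCat.Hom.hom ((Abelian.Ext.mk₀_bijective _ _).1 hw)⟩

theorem exists_lift {f : N₁ →ₗ[R] N₂} {g : N₂ →ₗ[R] N₃} (hf : Function.Injective f)
    (hg : Function.Surjective g) (h : Function.Exact f g) (h₁ : ExtVanish R F N₁ 1)
    (φ : F →ₗ[R] N₃) : ∃ ψ : F →ₗ[R] N₂, g ∘ₗ ψ = φ := by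
  obtain ⟨w, hw⟩ := Abelian.Ext.covariant_sequence_exact₃ _ (exact_of_function_exact hf hg h)
    (Abelian.Ext.mk₀ (ModuleCat.ofHom φ)) (zero_add 1) (h₁.elim _ _)
  obtain ⟨ψ, rfl⟩ := (Abelian.Ext.mk₀_bijective _ _).2 w
  rw [Abelian.Ext.mk₀_comp_mk₀] at hw
  exact ⟨ψ.hom, congrArg ModuleCat.Hom.hom ((Abelian.Ext.mk₀_bijective _ _).1 hw)⟩

theorem exists_extClass {f : F₁ →ₗ[R] F₂} {g : F₂ →ₗ[R] F₃} (hf : Function.Injective f)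
    (hg : Function.Surjective g) (h : Function.Exact f g) (h₂ : ExtVanish R F₂ N 1) :
    ∃ δ : (F₁ →ₗ[R] N) →ₗ[R] Abelian.Ext (ModuleCat.of R F₃) (ModuleCat.of R N) 1,
      Function.Surjective δ ∧ ∀ ψ : F₂ →ₗ[R] N, δ (ψ ∘ₗ f) = 0 := by
  have hS := exact_of_function_exact hf hg h
  refine ⟨{ toFun := fun φ => hS.extClass.comp (Abelian.Ext.mk₀ (ModuleCat.ofHom φ)) (add_zero 1)
            map_add' := fun φ ψ => ?_
            map_smul' := fun r φ => ?_ }, fun z => ?_, fun ψ => ?_⟩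
  · rw [← Abelian.Ext.comp_add, ← Abelian.Ext.mk₀_add]; rfl
  · rw [RingHom.id_apply, ← Abelian.Ext.comp_smul, ← Abelian.Ext.mk₀_smul]; rfl
  · obtain ⟨w, hw⟩ := Abelian.Ext.contravariant_sequence_exact₃ hS _ z (h₂.elim _ _) (add_zero 1)
    obtain ⟨ψ, rfl⟩ := (Abelian.Ext.mk₀_bijective _ _).2 w
    exact ⟨ψ.hom, hw⟩
  · change hS.extClass.comp (Abelian.Ext.mk₀ (ModuleCat.ofHom f ≫ ModuleCat.ofHom ψ)) (add_zero 1) = 0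
    rw [← Abelian.Ext.mk₀_comp_mk₀]
    exact hS.extClass_comp_assoc _

theorem one_of_forall_extension {f : F₁ →ₗ[R] F₂} {g : F₂ →ₗ[R] F₃} (hf : Function.Injective f)
    (hg : Function.Surjective g) (h : Function.Exact f g) (h₂ : ExtVanish R F₂ N 1)
    (H : ∀ φ : F₁ →ₗ[R] N, ∃ ψ : F₂ →ₗ[R] N, ψ ∘ₗ f = φ) : ExtVanish R F₃ N 1 := by
  obtain ⟨δ, hδ, h0⟩ := exists_extClass hf hg h h₂
  refine subsingleton_of_forall_eq 0 fun z => ?_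
  obtain ⟨φ, rfl⟩ := hδ z
  obtain ⟨ψ, rfl⟩ := H φ
  exact h0 ψ

theorem of_projective [Module.Projective R F] (n : ℕ) : ExtVanish R F N (n + 1) :=
  have : Projective (ModuleCat.of R F) := (IsProjective.iff_projective F).1 inferInstance
  Abelian.Ext.subsingleton_of_projective (ModuleCat.of R F) (ModuleCat.of R N) n

theorem of_injective (hN : Module.Injective R N) (n : ℕ) : ExtVanish R F N (n + 1) :=
  have : Injective (ModuleCat.of R N) := Module.injective_object_of_injective_module R N
  subsingleton_of_forall_eq 0 fun z => Abelian.Ext.eq_zero_of_injective z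

theorem congr_left (e : F₁ ≃ₗ[R] F₂) {n : ℕ} (h : ExtVanish R F₁ N n) : ExtVanish R F₂ N n := by
  refine subsingleton_of_forall_eq 0 fun z => ?_
  let i : ModuleCat.of R F₁ ≅ ModuleCat.of R F₂ := e.toModuleIso
  have : z = (Abelian.Ext.mk₀ i.inv).comp ((Abelian.Ext.mk₀ i.hom).comp z (zero_add n))
      (zero_add n) := by
    rw [← Abelian.Ext.comp_assoc_of_second_deg_zero, Abelian.Ext.mk₀_comp_mk₀, i.inv_hom_id,
      Abelian.Ext.mk₀_id_comp]
  rw [this, h.elim (Abelian.Ext.comp _ z _) 0, Abelian.Ext.comp_zero]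

theorem congr_right (e : N₁ ≃ₗ[R] N₂) {n : ℕ} (h : ExtVanish R F N₁ n) : ExtVanish R F N₂ n := by
  refine subsingleton_of_forall_eq 0 fun z => ?_
  let i : ModuleCat.of R N₁ ≅ ModuleCat.of R N₂ := e.toModuleIso
  have : z = (z.comp (Abelian.Ext.mk₀ i.inv) (add_zero n)).comp (Abelian.Ext.mk₀ i.hom)
      (add_zero n) := by
    rw [Abelian.Ext.comp_assoc_of_third_deg_zero, Abelian.Ext.mk₀_comp_mk₀, i.inv_hom_id,
      Abelian.Ext.comp_mk₀_id]
  rw [this, h.elim (Abelian.Ext.comp z _ _) 0, Abelian.Ext.zero_comp]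

theorem of_smul_bijective {s : R} (hN : Function.Bijective fun y : N => s • y)
    (hF : ∀ y : F, s • y = 0) (n : ℕ) : ExtVanish R F N n := by
  refine subsingleton_of_forall_eq 0 fun z => ?_
  let e : N ≃ₗ[R] N := LinearEquiv.ofBijective (s • LinearMap.id) hN
  let i : ModuleCat.of R N ≅ ModuleCat.of R N := e.toModuleIso
  have hi : i.hom = s • 𝟙 (ModuleCat.of R N) := rfl
  have hF' : s • 𝟙 (ModuleCat.of R F) = 0 := by
    ext y
    exact hF y
  have h1 : z = (z.comp (Abelian.Ext.mk₀ i.inv) (add_zero n)).comp (Abelian.Ext.mk₀ i.hom)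
      (add_zero n) := by
    rw [Abelian.Ext.comp_assoc_of_third_deg_zero, Abelian.Ext.mk₀_comp_mk₀, i.inv_hom_id,
      Abelian.Ext.comp_mk₀_id]
  generalize z.comp (Abelian.Ext.mk₀ i.inv) (add_zero n) = w at h1
  rw [hi, ← Abelian.Ext.smul_eq_comp_mk₀] at h1
  rw [h1, ← Abelian.Ext.mk₀_id_comp w, ← Abelian.Ext.smul_comp, ← Abelian.Ext.mk₀_smul, hF',
    Abelian.Ext.mk₀_zero, Abelian.Ext.zero_comp]

theorem of_ext {n : ℕ} (h : Subsingleton (((Ext R (ModuleCat.{u} R) n).obj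
    (Opposite.op (ModuleCat.of R F))).obj (ModuleCat.of R N))) : ExtVanish R F N n :=
  (extComparison (inferInstance : HasProjectiveResolution (ModuleCat.of R F)).out.some
    (ModuleCat.of R N) n).symm.toEquiv.subsingleton

end ExtVanish

end ExtVanishing

section Localization

variable {R : Type u} [CommRing R]

theorem smul_bijective_of_isLocalizedModule {S : Submonoid R} {N N' : Type*} [AddCommGroup N]
    [Module R N] [AddCommGroup N'] [Module R N'] (f : N →ₗ[R] N') [IsLocalizedModule S f] {s : R}
    (hs : s ∈ S) : Function.Bijective fun y : N' => s • y :=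
  (Module.End.isUnit_iff _).1 (IsLocalizedModule.map_units f (⟨s, hs⟩ : S))

theorem smul_bijective_linearMap {s : R} {N : Type*} [AddCommGroup N] [Module R N]
    (hs : Function.Bijective fun y : N => s • y) (F : Type*) [AddCommGroup F] [Module R F] :
    Function.Bijective fun φ : F →ₗ[R] N => s • φ := by
  let e : N ≃ₗ[R] N := LinearEquiv.ofBijective (s • LinearMap.id) hs
  refine ⟨fun φ ψ h => LinearMap.ext fun y => hs.1 (LinearMap.congr_fun h y),
    fun φ => ⟨e.symm.toLinearMap ∘ₗ φ, LinearMap.ext fun y => ?_⟩⟩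
  exact e.apply_symm_apply (φ y)

/-- Homomorphisms out of a finitely presented module commute with localization. -/
theorem isLocalizedModule_compRight (S : Submonoid R) {F N N' : Type*} [AddCommGroup F]
    [Module R F] [Module.FinitePresentation R F] [AddCommGroup N] [Module R N] [AddCommGroup N']
    [Module R N'] (f : N →ₗ[R] N') [IsLocalizedModule S f] :
    IsLocalizedModule S (LinearMap.compRight R f : (F →ₗ[R] N) →ₗ[R] (F →ₗ[R] N')) where
  map_units s := (Module.End.isUnit_iff _).2
    (smul_bijective_linearMap (smul_bijective_of_isLocalizedModule f s.2) F)
  surj φ := by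
    obtain ⟨ψ, s, h⟩ := Module.FinitePresentation.exists_lift_of_isLocalizedModule S f φ
    exact ⟨⟨ψ, s⟩, h.symm⟩
  exists_of_eq h := Module.Finite.exists_smul_of_comp_eq_of_isLocalizedModule S f _ _ h

theorem ExtVanish.localization [IsNoetherianRing R] (S : Submonoid R) {N N' : Type u}
    [AddCommGroup N] [Module R N] [AddCommGroup N'] [Module R N'] (f : N →ₗ[R] N')
    [IsLocalizedModule S f] (n : ℕ) : ∀ (F : Type u) [AddCommGroup F] [Module R F]
      [Module.Finite R F], ExtVanish R F N (n + 1) → ExtVanish R F N' (n + 1) := by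
  induction n with
  | zero =>
    intro F _ _ _ h
    obtain ⟨m, π, hπ⟩ := Module.Finite.exists_fin' R F
    have hex := LinearMap.exact_subtype_ker_map π
    refine one_of_forall_extension (Submodule.subtype_injective _) hπ hex (of_projective 0)
      fun φ => ?_
    have := Module.finitePresentation_of_finite R (LinearMap.ker π)
    obtain ⟨ψ, s, hψ⟩ := Module.FinitePresentation.exists_lift_of_isLocalizedModule S f φ
    obtain ⟨χ, rfl⟩ := exists_extension (Submodule.subtype_injective _) hπ hex h ψ
    obtain ⟨ω, hω⟩ := (smul_bijective_linearMap
      (smul_bijective_of_isLocalizedModule f s.2) (Fin m → R)).2 (f ∘ₗ χ)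
    refine ⟨ω, (smul_bijective_linearMap (smul_bijective_of_isLocalizedModule f s.2) _).1 ?_⟩
    change (s : R) • ω ∘ₗ _ = s • φ
    rw [← hψ, ← LinearMap.smul_comp, show (s : R) • ω = f ∘ₗ χ from hω]
    rfl
  | succ n ih =>
    intro F _ _ _ h
    obtain ⟨m, π, hπ⟩ := Module.Finite.exists_fin' R F
    have hex := LinearMap.exact_subtype_ker_map π
    exact left_three (Submodule.subtype_injective _) hπ hex
      (ih _ (left_one (Submodule.subtype_injective _) hπ hex (of_projective n) h))
      (of_projective (n + 1))

theorem InjDimLE.extVanish (F : Type u) [AddCommGroup F] [Module R F] :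
    ∀ {n : ℕ} {N : ModuleCat.{u} R}, InjDimLE R n N → ∀ j, n < j → ExtVanish R F N j
  | 0, N, h, j, hj => by
    obtain ⟨j, rfl⟩ := Nat.exists_eq_succ_of_ne_zero hj.ne'
    exact ExtVanish.of_injective h j
  | n + 1, N, h, j, hj => by
    obtain ⟨I, hI, ι, hι, h⟩ := h
    obtain ⟨j, rfl⟩ := Nat.exists_eq_succ_of_ne_zero (Nat.ne_zero_of_lt hj)
    exact ExtVanish.right_one hι (Submodule.mkQ_surjective _) (LinearMap.exact_map_mkQ_range ι)
      (ExtVanish.of_injective hI j) (InjDimLE.extVanish F h j (Nat.lt_of_succ_lt_succ hj))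

end Localization

section Regularity

variable {R : Type u} [CommRing R]

theorem exists_linearMap_ne_zero [IsNoetherianRing R] (D : Type*) [AddCommGroup D] [Module R D]
    [Module.Finite R D] (hD : Module.annihilator R D = ⊥) (q : Ideal R) [q.IsPrime] :
    ∃ f : D →ₗ[R] R ⧸ q, f ≠ 0 := by
  by_contra! h
  obtain ⟨r, hr, hreg⟩ := IsSMulRegular.subsingleton_linearMap_iff.1 (subsingleton_of_forall_eq 0 h)
  rw [hD] at hr
  rw [(Submodule.mem_bot R).1 hr] at hreg
  exact zero_ne_one (hreg (show (0 : R) • (0 : R ⧸ q) = (0 : R) • 1 by rw [zero_smul, zero_smul]))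

theorem smul_eq_zero_of_linearMap [IsNoetherianRing R] {D N : Type*} [AddCommGroup D]
    [Module R D] [Module.Finite R D] (hD : Module.annihilator R D = ⊥) [AddCommGroup N]
    [Module R N] {x : R} (hx : ∀ f : D →ₗ[R] N, x • f = 0 → f = 0) (y : N) (hy : x • y = 0) :
    y = 0 := by
  by_contra hne
  obtain ⟨q, hq, hyq⟩ := exists_le_isAssociatedPrime_of_isNoetherianRing R y hne
  obtain ⟨hprime, ι, hι⟩ := (isAssociatedPrime_iff_exists_injective_linearMap _ _).1 hq
  have hxq : x ∈ q := hyq (Submodule.mem_colon_singleton.2 hy)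
  obtain ⟨f, hf⟩ := exists_linearMap_ne_zero D hD q
  refine hf (LinearMap.ext fun d => hι ?_)
  rw [LinearMap.zero_apply, map_zero]
  refine LinearMap.congr_fun (hx (ι ∘ₗ f) (LinearMap.ext fun d => ?_)) d
  obtain ⟨r, hr⟩ := Ideal.Quotient.mk_surjective (f d)
  change x • ι (f d) = 0
  rw [← map_smul, ← hr, ← Ideal.Quotient.mkₐ_eq_mk R, ← map_smul, Ideal.Quotient.mkₐ_eq_mk,
    smul_eq_mul, Ideal.Quotient.eq_zero_iff_mem.2 (Ideal.mul_mem_right _ _ hxq), map_zero]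

namespace LocStep

variable {x : R} {N L N' : ModuleCat.{u} R}

theorem eq_zero_of_smul_eq_zero (s : LocStep x N L N') {y : R}
    (h : ∀ z z' : N, y • z = x • z' → ∃ w : N, z = x • w) (v : N') (hv : y • v = 0) : v = 0 := by
  obtain ⟨n, hn⟩ := s.tors v
  induction n generalizing v with
  | zero => simpa using hn
  | succ n ih =>
    have hx : x ^ n • v = 0 := by
      obtain ⟨w, hw⟩ := s.surj (x ^ n • v)
      have h1 : s.g (x • w) = 0 := by rw [map_smul, hw, ← mul_smul, ← pow_succ', hn]
      have h2 : s.g (y • w) = 0 := by rw [map_smul, hw, smul_comm, hv, smul_zero]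
      obtain ⟨z, hz⟩ := (s.exact _).1 h1
      obtain ⟨z', hz'⟩ := (s.exact _).1 h2
      obtain ⟨w', hw'⟩ := h z z' (s.inj (by rw [map_smul, map_smul, hz, hz', smul_comm]))
      have : w = s.f w' := s.bij.1 (by
        change x • w = x • s.f w'
        rw [← hz, hw', map_smul])
      rw [← hw, this, s.exact.apply_apply_eq_zero]
    exact ih v hv hx

/-- The reduction of a localization step modulo an element regular on the torsion part. -/
noncomputable def quotSMulTop (s : LocStep x N L N') (y : R) (hy : ∀ v : N', y • v = 0 → v = 0) :
    LocStep x (ModuleCat.of R (QuotSMulTop y N)) (ModuleCat.of R (QuotSMulTop y L))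
      (ModuleCat.of R (QuotSMulTop y N')) where
  f := QuotSMulTop.map y s.f
  g := QuotSMulTop.map y s.g
  inj := by
    refine (injective_iff_map_eq_zero _).2 fun z hz => ?_
    obtain ⟨z, rfl⟩ := Submodule.mkQ_surjective _ z
    obtain ⟨w, -, hw⟩ := (Submodule.mem_smul_pointwise_iff_exists _ _ _).1
      ((Submodule.Quotient.mk_eq_zero _).1 hz)
    replace hw : y • w = s.f z := hw
    have h1 : s.g w = 0 := hy _ (by rw [← map_smul, hw, s.exact.apply_apply_eq_zero])
    obtain ⟨w, rfl⟩ := (s.exact _).1 h1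
    refine (Submodule.Quotient.mk_eq_zero _).2
      ((Submodule.mem_smul_pointwise_iff_exists _ _ _).2 ⟨w, trivial, s.inj ?_⟩)
    rw [map_smul, hw]
  surj := QuotSMulTop.map_surjective y s.surj
  exact := QuotSMulTop.map_exact y s.exact s.surj
  bij := by
    constructor
    · refine (injective_iff_map_eq_zero (x • LinearMap.id : QuotSMulTop y L →ₗ[R] _)).2 ?_
      intro z hz
      obtain ⟨z, rfl⟩ := Submodule.mkQ_surjective _ z
      obtain ⟨w, -, hw⟩ := (Submodule.mem_smul_pointwise_iff_exists _ _ _).1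
        ((Submodule.Quotient.mk_eq_zero _).1 hz)
      obtain ⟨w, rfl⟩ := s.bij.2 w
      refine (Submodule.Quotient.mk_eq_zero _).2
        ((Submodule.mem_smul_pointwise_iff_exists _ _ _).2 ⟨w, trivial, s.bij.1 ?_⟩)
      change x • y • w = x • z
      rw [smul_comm]
      exact hw
    · intro z
      obtain ⟨z, rfl⟩ := Submodule.mkQ_surjective _ z
      obtain ⟨w, rfl⟩ := s.bij.2 z
      exact ⟨Submodule.mkQ _ w, rfl⟩
  tors v := by
    obtain ⟨v, rfl⟩ := Submodule.mkQ_surjective _ v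
    obtain ⟨n, hn⟩ := s.tors v
    exact ⟨n, by rw [← map_smul, hn, map_zero]⟩

theorem isWeaklyRegular (l : List R) : ∀ {N L N' : ModuleCat.{u} R} (_ : LocStep x N L N')
    {Q : Type u} [AddCommGroup Q] [Module R Q] (q : N →ₗ[R] Q) (_ : Function.Surjective q)
    (_ : ∀ z, q z = 0 ↔ ∃ w, z = x • w), RingTheory.Sequence.IsWeaklyRegular Q l →
      RingTheory.Sequence.IsWeaklyRegular N' l := by
  induction l with
  | nil =>
    intro N L N' s Q _ _ q _ _ _
    exact .nil R _
  | cons y l ih =>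
    intro N L N' s Q _ _ q hq hqx h
    obtain ⟨h1, h2⟩ := (RingTheory.Sequence.isWeaklyRegular_cons_iff Q y l).1 h
    have hy : ∀ v : N', y • v = 0 → v = 0 := s.eq_zero_of_smul_eq_zero fun z z' hz =>
      (hqx z).1 (h1 (by
        change y • q z = y • 0
        rw [smul_zero, ← map_smul]
        exact (hqx _).2 ⟨z', hz⟩))
    have hinj : Function.Injective (y • LinearMap.id : N' →ₗ[R] N') :=
      (injective_iff_map_eq_zero _).2 hy
    refine (RingTheory.Sequence.isWeaklyRegular_cons_iff N' y l).2 ⟨fun a b e => hinj e, ?_⟩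
    refine ih (s.quotSMulTop y hy) (QuotSMulTop.map y q) (QuotSMulTop.map_surjective y hq)
      (fun z => ?_) h2
    obtain ⟨z, rfl⟩ := Submodule.mkQ_surjective _ z
    constructor
    · intro hz
      obtain ⟨w, -, hw⟩ := (Submodule.mem_smul_pointwise_iff_exists _ _ _).1
        ((Submodule.Quotient.mk_eq_zero _).1 hz)
      replace hw : y • w = q z := hw
      obtain ⟨w, rfl⟩ := hq w
      obtain ⟨t, ht⟩ := (hqx (z - y • w)).1 (by rw [map_sub, map_smul, hw, sub_self])
      refine ⟨Submodule.mkQ _ t, ?_⟩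
      rw [← map_smul, ← ht, map_sub, eq_comm, sub_eq_self]
      exact (Submodule.Quotient.mk_eq_zero _).2
        ((Submodule.mem_smul_pointwise_iff_exists _ _ _).2 ⟨w, trivial, rfl⟩)
    · rintro ⟨w, hw⟩
      obtain ⟨w, rfl⟩ := Submodule.mkQ_surjective _ w
      rw [hw, map_smul]
      change Submodule.mkQ _ (x • q w) = 0
      rw [← map_smul, (hqx (x • w)).2 ⟨w, rfl⟩, map_zero]

/-- The localization step obtained by applying `Hom_R(D, -)`. -/
def hom (s : LocStep x N L N') (D : Type u) [AddCommGroup D] [Module R D] [Module.Finite R D]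
    (h : ExtVanish R D N 1) : LocStep x (ModuleCat.of R (D →ₗ[R] N)) (ModuleCat.of R (D →ₗ[R] L))
      (ModuleCat.of R (D →ₗ[R] N')) where
  f := LinearMap.compRight R s.f
  g := LinearMap.compRight R s.g
  inj φ ψ e := LinearMap.ext fun y => s.inj (LinearMap.congr_fun e y)
  surj := ExtVanish.exists_lift s.inj s.surj s.exact h
  exact φ := by
    constructor
    · intro hφ
      let e := LinearEquiv.ofInjective s.f s.inj
      have hr : ∀ y, φ y ∈ LinearMap.range s.f := fun y =>
        (s.exact _).1 (LinearMap.congr_fun hφ y)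
      refine ⟨e.symm.toLinearMap ∘ₗ φ.codRestrict _ hr, LinearMap.ext fun y => ?_⟩
      exact congrArg Subtype.val (e.apply_symm_apply ⟨φ y, hr y⟩)
    · rintro ⟨ψ, rfl⟩
      exact LinearMap.ext fun y => s.exact.apply_apply_eq_zero _
  bij := smul_bijective_linearMap s.bij D
  tors φ := by
    obtain ⟨t, ht⟩ := Module.Finite.fg_top (R := R) (M := D)
    choose n hn using fun y : D => s.tors (φ y)
    refine ⟨t.sum n, ?_⟩
    have : LinearMap.ker (x ^ t.sum n • φ) = ⊤ := by
      rw [eq_top_iff, ← ht, Submodule.span_le]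
      intro y hy
      change x ^ t.sum n • φ y = 0
      obtain ⟨k, hk⟩ := Nat.exists_eq_add_of_le' (Finset.single_le_sum (f := n)
        (fun _ _ => Nat.zero_le _) hy)
      rw [hk, pow_add, mul_smul, hn, smul_zero]
    exact LinearMap.ker_eq_top.1 this

theorem extVanish [IsNoetherianRing R] (s : LocStep x N L N') (D : Type u) [AddCommGroup D]
    [Module R D] [Module.Finite R D] (h : ∀ j, ExtVanish R D N (j + 1)) (j : ℕ) :
    ExtVanish R D N' (j + 1) :=
  have := s.isLocalizedModule
  ExtVanish.right_three s.inj s.surj s.exact (h (j + 1))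
    (ExtVanish.localization (Submonoid.powers x) s.f j D (h j))

theorem extVanish_of_smul_eq_zero (s : LocStep x N L N') {F : Type u} [AddCommGroup F]
    [Module R F] (hF : ∀ y : F, x • y = 0) {j : ℕ} (h : ExtVanish R F N (j + 1)) :
    ExtVanish R F N' j :=
  ExtVanish.right_three s.inj s.surj s.exact h (ExtVanish.of_smul_bijective s.bij hF j)

end LocStep

namespace LocChain

variable {l : List R} {N Y : ModuleCat.{u} R}

theorem exists_of_isWeaklyRegular [IsNoetherianRing R] (D : Type u) [AddCommGroup D]
    [Module R D] [Module.Finite R D] (hD : Module.annihilator R D = ⊥) (l : List R) :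
    ∀ N : ModuleCat.{u} R, (∀ j, ExtVanish R D N (j + 1)) →
      RingTheory.Sequence.IsWeaklyRegular (D →ₗ[R] N) l →
      ∃ Y : ModuleCat.{u} R, Nonempty (LocChain l N Y) ∧
        Nonempty (LocChain l (ModuleCat.of R (D →ₗ[R] N)) (ModuleCat.of R (D →ₗ[R] Y))) := by
  induction l with
  | nil => exact fun N _ _ => ⟨N, ⟨nil (LinearEquiv.refl _ _)⟩, ⟨nil (LinearEquiv.refl _ _)⟩⟩
  | cons x l ih =>
    intro N hN h
    obtain ⟨h1, h2⟩ := (RingTheory.Sequence.isWeaklyRegular_cons_iff _ x l).1 h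
    let s := LocStep.ofRegular x N (smul_eq_zero_of_linearMap hD fun f hf =>
      h1 (hf.trans (smul_zero x).symm))
    let s' := s.hom D (hN 0)
    have hz : ∀ z : D →ₗ[R] N, (Submodule.mkQ _ z : QuotSMulTop x (D →ₗ[R] N)) = 0 ↔
        ∃ w, z = x • w := by
      intro z
      rw [Submodule.mkQ_apply, Submodule.Quotient.mk_eq_zero,
        Submodule.mem_smul_pointwise_iff_exists]
      exact ⟨fun ⟨w, _, hw⟩ => ⟨w, hw.symm⟩, fun ⟨w, hw⟩ => ⟨w, trivial, hw.symm⟩⟩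
    obtain ⟨Y, ⟨c⟩, ⟨c'⟩⟩ := ih _ (s.extVanish D hN) (s'.isWeaklyRegular l (Submodule.mkQ _)
      (Submodule.mkQ_surjective _) hz h2)
    exact ⟨Y, ⟨cons s c⟩, ⟨cons s' c'⟩⟩

theorem smul_bijective (c : LocChain l N Y) {s : R} (hs : Function.Bijective fun y : N => s • y) :
    Function.Bijective fun y : Y => s • y := by
  induction c with
  | nil e =>
    have h : (fun y => s • y) = e ∘ (fun y => s • y) ∘ e.symm := by
      ext y
      simp
    rw [h]
    exact e.bijective.comp (hs.comp e.symm.bijective)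
  | cons t c ih => exact ih (t.smul_bijective hs)

theorem pow_tors (c : LocChain l N Y) {a : R} (ha : ∀ y : N, ∃ n : ℕ, a ^ n • y = 0) (y : Y) :
    ∃ n : ℕ, a ^ n • y = 0 := by
  induction c with
  | nil e =>
    obtain ⟨n, hn⟩ := ha (e.symm y)
    exact ⟨n, by rw [← e.apply_symm_apply y, ← map_smul, hn, map_zero]⟩
  | cons t c ih => exact ih (t.pow_tors ha) y

theorem pow_tors_of_mem (c : LocChain l N Y) {a : R} (ha : a ∈ l) (y : Y) :
    ∃ n : ℕ, a ^ n • y = 0 := by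
  induction c with
  | nil e => simp at ha
  | cons t c ih =>
    rcases List.mem_cons.1 ha with rfl | ha
    · exact c.pow_tors t.tors y
    · exact ih ha y

theorem extVanish_of_smul_eq_zero (c : LocChain l N Y) {F : Type u} [AddCommGroup F] [Module R F]
    (hF : ∀ a ∈ l, ∀ y : F, a • y = 0) {j : ℕ} (h : ExtVanish R F N (j + l.length)) :
    ExtVanish R F Y j := by
  induction c with
  | nil e => exact ExtVanish.congr_right e h
  | @cons x l N L N' Y t c ih =>
    exact ih (fun a ha => hF a (List.mem_cons_of_mem _ ha))
      (t.extVanish_of_smul_eq_zero (hF x List.mem_cons_self) h)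

end LocChain

end Regularity

section Socle

variable {R : Type u} [CommRing R]

namespace LocStep

variable {x y : R} {N L N' : ModuleCat.{u} R}

theorem smul_surjective_middle (s : LocStep y N L N') (hx : ∀ z : N, ∃ w, x • w = z) (v : L) :
    ∃ w, x • w = v := by
  obtain ⟨n, hn⟩ := s.tors (s.g v)
  rw [← map_smul] at hn
  obtain ⟨z, hz⟩ := (s.exact _).1 hn
  obtain ⟨z, rfl⟩ := hx z
  obtain ⟨w, hw⟩ := (s.pow_bijective n).2 (s.f z)
  refine ⟨w, (s.pow_bijective n).1 ?_⟩
  change y ^ n • x • w = y ^ n • v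
  rw [← hz, map_smul, smul_comm]
  exact congrArg (x • ·) hw

theorem smul_surjective_right (s : LocStep y N L N') (hx : ∀ v : L, ∃ w, x • w = v) (v : N') :
    ∃ w, x • w = v := by
  obtain ⟨v, rfl⟩ := s.surj v
  obtain ⟨w, rfl⟩ := hx v
  exact ⟨s.g w, (map_smul _ _ _).symm⟩

/-- The localization step of `x`-torsion submodules, for `x` acting surjectively. -/
noncomputable def torsionBy (s : LocStep y N L N') (hx : ∀ z : N, ∃ w, x • w = z) :
    LocStep y (ModuleCat.of R (Submodule.torsionBy R N x))
      (ModuleCat.of R (Submodule.torsionBy R L x)) (ModuleCat.of R (Submodule.torsionBy R N' x)) where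
  f := s.f.restrict fun z (hz : x • z = 0) => show x • s.f z = 0 by rw [← map_smul, hz, map_zero]
  g := s.g.restrict fun z (hz : x • z = 0) => show x • s.g z = 0 by rw [← map_smul, hz, map_zero]
  inj z z' h := Subtype.ext (s.inj (congrArg Subtype.val h))
  surj := by
    rintro ⟨v, hv⟩
    replace hv : x • v = 0 := hv
    obtain ⟨w, rfl⟩ := s.surj v
    rw [← map_smul] at hv
    obtain ⟨z, hz⟩ := (s.exact _).1 hv
    obtain ⟨z, rfl⟩ := hx z
    refine ⟨⟨w - s.f z, show x • (w - s.f z) = 0 from ?_⟩, Subtype.ext ?_⟩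
    · rw [smul_sub, ← map_smul, hz, sub_self]
    · change s.g (w - s.f z) = _
      rw [map_sub, s.exact.apply_apply_eq_zero, sub_zero]
  exact := by
    rintro ⟨v, hv⟩
    constructor
    · intro h
      obtain ⟨z, rfl⟩ := (s.exact v).1 (congrArg Subtype.val h)
      refine ⟨⟨z, show x • z = 0 from s.inj ?_⟩, rfl⟩
      rw [map_smul, map_zero]
      exact hv
    · rintro ⟨z, hz⟩
      rw [← hz]
      exact Subtype.ext (s.exact.apply_apply_eq_zero _)
  bij := by
    constructor
    · exact fun v v' h => Subtype.ext (s.bij.1 (congrArg Subtype.val h))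
    · rintro ⟨v, hv⟩
      obtain ⟨w, rfl⟩ := s.bij.2 v
      refine ⟨⟨w, show x • w = 0 from s.bij.1 ?_⟩, rfl⟩
      change y • x • w = y • 0
      rw [smul_comm, smul_zero]
      exact hv
  tors := by
    rintro ⟨v, hv⟩
    obtain ⟨n, hn⟩ := s.tors v
    exact ⟨n, Subtype.ext hn⟩

theorem exists_range_eq_torsionBy (s : LocStep x N L N') :
    ∃ ρ : N →ₗ[R] Submodule.torsionBy R N' x, Function.Surjective ρ ∧
      ∀ z, ρ z = 0 → ∃ w, z = x • w := by
  let e : L ≃ₗ[R] L := LinearEquiv.ofBijective (x • LinearMap.id) s.bij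
  have he : ∀ v, x • e.symm v = v := e.apply_symm_apply
  refine ⟨(s.g ∘ₗ e.symm.toLinearMap ∘ₗ s.f).codRestrict _ fun z => ?_, ?_, fun z hz => ?_⟩
  · change x • s.g (e.symm (s.f z)) = 0
    rw [← map_smul, he, s.exact.apply_apply_eq_zero]
  · rintro ⟨v, hv⟩
    obtain ⟨w, rfl⟩ := s.surj v
    obtain ⟨z, hz⟩ := (s.exact (x • w)).1 ((map_smul _ _ _).trans hv)
    refine ⟨z, Subtype.ext ?_⟩
    change s.g (e.symm (s.f z)) = s.g w
    rw [hz]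
    exact congrArg s.g (e.symm_apply_apply w)
  · obtain ⟨w, hw⟩ := (s.exact _).1 (show s.g (e.symm (s.f z)) = 0 from congrArg Subtype.val hz)
    exact ⟨w, s.inj (by rw [map_smul, hw, he])⟩

end LocStep

namespace LocChain

theorem torsionBy {l : List R} {N Y : ModuleCat.{u} R} (c : LocChain l N Y) {x : R}
    (hx : ∀ z : N, ∃ w, x • w = z) :
    Nonempty (LocChain l (ModuleCat.of R (Submodule.torsionBy R N x))
      (ModuleCat.of R (Submodule.torsionBy R Y x))) := by
  induction c with
  | nil e =>
    refine ⟨nil (LinearEquiv.ofBijective (e.toLinearMap.restrict fun z (hz : x • z = 0) =>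
      show x • e z = 0 by rw [← map_smul, hz, map_zero])
      ⟨fun z z' h => Subtype.ext (e.injective (congrArg Subtype.val h)), ?_⟩)⟩
    rintro ⟨v, hv⟩
    refine ⟨⟨e.symm v, show x • e.symm v = 0 from ?_⟩, Subtype.ext (e.apply_symm_apply v)⟩
    rw [← map_smul, show x • v = 0 from hv, map_zero]
  | cons s c ih =>
    obtain ⟨c'⟩ := ih (s.smul_surjective_right (s.smul_surjective_middle hx))
    exact ⟨cons (s.torsionBy hx) c'⟩

/-- The elements annihilated by the sequence of a localization chain form a quotient of the
starting module by the sequence. -/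
theorem exists_mem_range_iff (l : List R) : ∀ {N Y : ModuleCat.{u} R} (_ : LocChain l N Y),
    ∃ φ : N →ₗ[R] Y, (∀ y, y ∈ LinearMap.range φ ↔ ∀ a ∈ l, a • y = 0) ∧
      LinearMap.ker φ ≤ Ideal.ofList l • (⊤ : Submodule R N) := by
  induction l with
  | nil =>
    intro N Y c
    cases c with
    | nil e =>
      refine ⟨e, fun y => ⟨fun _ _ h => absurd h List.not_mem_nil,
        fun _ => ⟨e.symm y, e.apply_symm_apply y⟩⟩, ?_⟩
      rw [LinearEquiv.ker]
      exact bot_le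
  | cons x l ih =>
    intro N Y c
    cases c with
    | cons s c =>
      obtain ⟨c'⟩ := c.torsionBy (s.smul_surjective_right s.bij.2)
      obtain ⟨φ, hφ, hker⟩ := ih c'
      obtain ⟨ρ, hρ, hρker⟩ := s.exists_range_eq_torsionBy
      refine ⟨Submodule.subtype _ ∘ₗ φ ∘ₗ ρ, fun y => ?_, fun z hz => ?_⟩
      · rw [List.forall_mem_cons]
        constructor
        · rintro ⟨z, rfl⟩
          exact ⟨(φ (ρ z)).2, fun a ha => congrArg Subtype.val ((hφ (φ (ρ z))).1 ⟨_, rfl⟩ a ha)⟩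
        · rintro ⟨hx, hl⟩
          obtain ⟨w, hw⟩ := (hφ ⟨y, hx⟩).2 fun a ha => Subtype.ext (hl a ha)
          obtain ⟨z, rfl⟩ := hρ w
          exact ⟨z, congrArg Subtype.val hw⟩
      · have h1 : ρ z ∈ Ideal.ofList l • (⊤ : Submodule R (Submodule.torsionBy R _ x)) :=
          hker (Subtype.ext hz)
        rw [← LinearMap.range_eq_top.2 hρ, LinearMap.range_eq_map, ← Submodule.map_smul''] at h1
        obtain ⟨z', hz', h2⟩ := h1
        obtain ⟨w, hw⟩ := hρker (z - z') (by rw [map_sub, h2, sub_self])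
        rw [sub_eq_iff_eq_add.1 hw, Ideal.ofList_cons, Submodule.sup_smul]
        exact add_mem (Submodule.mem_sup_left
          (Submodule.smul_mem_smul (Ideal.mem_span_singleton_self x) trivial))
          (Submodule.mem_sup_right hz')

end LocChain

end Socle

section PrimeLocal

variable {R : Type u} [CommRing R]

theorem isLocalizedModule_quotSMulTop (S : Submonoid R) (x : R) {B B' : Type*} [AddCommGroup B]
    [Module R B] [AddCommGroup B'] [Module R B'] (f : B →ₗ[R] B') [IsLocalizedModule S f] :
    IsLocalizedModule S (QuotSMulTop.map x f) where
  map_units s := by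
    rw [Module.End.isUnit_iff]
    have hs := smul_bijective_of_isLocalizedModule f s.2
    constructor
    · refine (injective_iff_map_eq_zero ((s : R) • LinearMap.id : QuotSMulTop x B' →ₗ[R] _)).2 ?_
      intro z hz
      obtain ⟨z, rfl⟩ := Submodule.mkQ_surjective _ z
      obtain ⟨w, -, hw⟩ := (Submodule.mem_smul_pointwise_iff_exists _ _ _).1
        ((Submodule.Quotient.mk_eq_zero _).1 hz)
      obtain ⟨w, rfl⟩ := hs.2 w
      refine (Submodule.Quotient.mk_eq_zero _).2
        ((Submodule.mem_smul_pointwise_iff_exists _ _ _).2 ⟨w, trivial, hs.1 ?_⟩)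
      change (s : R) • x • w = (s : R) • z
      rw [smul_comm]
      exact hw
    · intro z
      obtain ⟨z, rfl⟩ := Submodule.mkQ_surjective _ z
      obtain ⟨w, rfl⟩ := hs.2 z
      exact ⟨Submodule.mkQ _ w, rfl⟩
  surj z := by
    obtain ⟨z, rfl⟩ := Submodule.mkQ_surjective _ z
    obtain ⟨⟨w, s⟩, hw⟩ := IsLocalizedModule.surj S f z
    exact ⟨⟨Submodule.mkQ _ w, s⟩, congrArg (Submodule.mkQ _) hw⟩
  exists_of_eq {z z'} h := by
    obtain ⟨z, rfl⟩ := Submodule.mkQ_surjective _ z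
    obtain ⟨z', rfl⟩ := Submodule.mkQ_surjective _ z'
    obtain ⟨w, -, hw⟩ := (Submodule.mem_smul_pointwise_iff_exists _ _ _).1
      ((Submodule.Quotient.eq _).1 h)
    replace hw : x • w = f z - f z' := hw
    obtain ⟨⟨c, s⟩, hc⟩ := IsLocalizedModule.surj S f w
    replace hc : (s : R) • w = f c := hc
    have : f ((s : R) • (z - z')) = f (x • c) := by
      rw [map_smul, map_smul, map_sub, ← hw, ← hc, smul_comm]
    obtain ⟨t, ht⟩ := IsLocalizedModule.exists_of_eq (S := S) this
    refine ⟨t * s, (Submodule.Quotient.eq _).2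
      ((Submodule.mem_smul_pointwise_iff_exists _ _ _).2 ⟨(t : R) • c, trivial, ?_⟩)⟩
    change (t : R) • (s : R) • (z - z') = (t : R) • x • c at ht
    change x • (t : R) • c = ((t : R) * s) • z - ((t : R) * s) • z'
    rw [← smul_sub, mul_smul, ht, smul_comm]

variable [IsNoetherianRing R]

theorem ExtVanish.quotSMulTop (S : Submonoid R) {x : R} {B B' N : Type u} [AddCommGroup B]
    [Module R B] [Module.Finite R B] [AddCommGroup B'] [Module R B'] (f : B →ₗ[R] B')
    [IsLocalizedModule S f] [AddCommGroup N] [Module R N]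
    (hN : ∀ s ∈ S, Function.Bijective fun y : N => s • y) (hx : IsSMulRegular B' x) {j : ℕ}
    (h : ExtVanish R B N (j + 1)) (h' : ExtVanish R B N (j + 2)) :
    ExtVanish R (QuotSMulTop x B) N (j + 2) := by
  let m : B →ₗ[R] B := x • LinearMap.id
  have hK : ∀ k : LinearMap.ker m, ∃ s ∈ S, s • k = 0 := by
    rintro ⟨k, hk⟩
    have : f k = 0 := hx (by
      change x • f k = x • 0
      rw [← map_smul, smul_zero, show x • k = 0 from hk, map_zero])
    obtain ⟨t, ht⟩ := (IsLocalizedModule.eq_zero_iff S f).1 this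
    exact ⟨t, t.2, Subtype.ext ht⟩
  obtain ⟨s, hs, hsK⟩ : ∃ s ∈ S, ∀ k : LinearMap.ker m, s • k = 0 := by
    obtain ⟨t, ht⟩ := Module.Finite.fg_top (R := R) (M := LinearMap.ker m)
    choose n hnS hn using hK
    refine ⟨t.prod n, prod_mem fun k _ => hnS k, ?_⟩
    have : LinearMap.ker (t.prod n • LinearMap.id : LinearMap.ker m →ₗ[R] _) = ⊤ := by
      rw [eq_top_iff, ← ht, Submodule.span_le]
      intro y hy
      change t.prod n • y = 0
      obtain ⟨k, hk⟩ := Finset.dvd_prod_of_mem n hy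
      rw [hk, mul_comm, mul_smul, hn, smul_zero]
    exact LinearMap.congr_fun (LinearMap.ker_eq_top.1 this)
  have h1 : ExtVanish R (LinearMap.range m) N (j + 1) :=
    left_three (g := m.rangeRestrict) (Submodule.subtype_injective _) m.surjective_rangeRestrict
      (by
        rw [LinearMap.exact_iff, Submodule.range_subtype, LinearMap.ker_rangeRestrict]) (of_smul_bijective (hN s hs) hsK j) h
  have h2 : ExtVanish R (B ⧸ LinearMap.range m) N (j + 2) :=
    left_three (Submodule.subtype_injective _) (Submodule.mkQ_surjective _)
      (LinearMap.exact_subtype_mkQ _) h1 h'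
  refine congr_left (Submodule.quotEquivOfEq _ _ ?_) h2
  ext y
  rw [Submodule.mem_smul_pointwise_iff_exists]
  exact ⟨fun ⟨w, hw⟩ => ⟨w, trivial, hw⟩, fun ⟨w, _, hw⟩ => ⟨w, hw⟩⟩

theorem ExtVanish.quotOfList (S : Submonoid R) {N : Type u} [AddCommGroup N] [Module R N]
    (hN : ∀ s ∈ S, Function.Bijective fun y : N => s • y) (l : List R) :
    ∀ {B B' : Type u} [AddCommGroup B] [Module R B] [Module.Finite R B] [AddCommGroup B']
      [Module R B'] (f : B →ₗ[R] B') [IsLocalizedModule S f],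
      RingTheory.Sequence.IsWeaklyRegular B' l → ∀ n, (∀ j, n < j → ExtVanish R B N j) →
      ∀ j, n + l.length < j →
        ExtVanish R (B ⧸ (Ideal.ofList l • ⊤ : Submodule R B)) N j := by
  induction l with
  | nil =>
    intro B B' _ _ _ _ _ f _ _ n h j hj
    refine congr_left (Submodule.quotEquivOfEqBot _ ?_).symm (h j hj)
    rw [Ideal.ofList_nil, Submodule.bot_smul]
  | cons x l ih =>
    intro B B' _ _ _ _ _ f _ hreg n h j hj
    obtain ⟨h1, h2⟩ := (RingTheory.Sequence.isWeaklyRegular_cons_iff B' x l).1 hreg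
    have := isLocalizedModule_quotSMulTop S x f
    refine congr_left (Submodule.quotOfListConsSMulTopEquivQuotSMulTopInner B x l).symm
      (ih (QuotSMulTop.map x f) h2 (n + 1) (fun i hi => ?_) j ?_)
    · obtain ⟨i, rfl⟩ := Nat.exists_eq_add_of_le' (show 2 ≤ i by omega)
      exact quotSMulTop S f hN h1 (h _ (by omega)) (h _ (by omega))
    · rw [List.length_cons] at hj
      omega

variable {p : Ideal R} {N : Type u} [AddCommGroup N] [Module R N]

omit [IsNoetherianRing R] in
theorem ExtVanish.quotient_prime (hN : ∀ s ∉ p, Function.Bijective fun y : N => s • y)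
    {q : Ideal R} (hq : ¬ q ≤ p) (n : ℕ) : ExtVanish R (R ⧸ q) N n := by
  obtain ⟨s, hsq, hsp⟩ := SetLike.not_le_iff_exists.1 hq
  refine of_smul_bijective (hN s hsp) (fun y => ?_) n
  obtain ⟨r, rfl⟩ := Ideal.Quotient.mk_surjective y
  exact Ideal.Quotient.eq_zero_iff_mem.2 (Ideal.mul_mem_right _ _ hsq)

/-- Finite injective dimension and a maximal regular sequence bound the nonvanishing of
`Ext` out of modules killed by the sequence. -/
theorem ExtVanish.of_isWeaklyRegular [p.IsPrime] (hN : ∀ s ∉ p, Function.Bijective fun y : N => s • y)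
    {l : List R}
    (hreg : RingTheory.Sequence.IsWeaklyRegular (LocalizedModule p.primeCompl R) l)
    (hmin : ∀ q : Ideal R, q.IsPrime → (∀ x ∈ l, x ∈ q) → q ≤ p → q = p)
    (hass : ∃ ι : R ⧸ p →ₗ[R] R ⧸ Ideal.ofList l, Function.Injective ι) {n : ℕ}
    (hn : ∀ (F : Type u) [AddCommGroup F] [Module R F], Module.Finite R F → ∀ j, n < j →
      ExtVanish R F N j) (m : ℕ) :
    ∀ (F : Type u) [AddCommGroup F] [Module R F], Module.Finite R F →
      (∀ x ∈ l, ∀ y : F, x • y = 0) → ∀ j, l.length < j → n < j + m → ExtVanish R F N j := by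
  induction m with
  | zero => exact fun F _ _ hF _ j _ hj => hn F hF j hj
  | succ m ih =>
    intro F _ _ hF hlF j hj hjm
    have key : ExtVanish R (R ⧸ p) N j := by
      obtain ⟨ι, hι⟩ := hass
      have hB : ExtVanish R (R ⧸ Ideal.ofList l) N j := by
        refine congr_left (Submodule.quotEquivOfEq _ _ (by simp))
          (quotOfList p.primeCompl hN l (LocalizedModule.mkLinearMap p.primeCompl R) hreg 0
            (fun i hi => ?_) j (by omega))
        obtain ⟨i, rfl⟩ := Nat.exists_eq_succ_of_ne_zero hi.ne'
        exact of_projective i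
      refine left_one hι (Submodule.mkQ_surjective _) (LinearMap.exact_map_mkQ_range ι) hB
        (ih _ inferInstance (fun x hx y => ?_) (j + 1) (by omega) (by omega))
      obtain ⟨y, rfl⟩ := Submodule.mkQ_surjective _ y
      obtain ⟨r, rfl⟩ := Ideal.Quotient.mk_surjective y
      rw [← map_smul]
      refine (congrArg _ ?_).trans (map_zero _)
      exact Ideal.Quotient.eq_zero_iff_mem.2
        (Ideal.mul_mem_right _ _ (Ideal.subset_span hx))
    clear ih
    revert hlF
    refine IsNoetherianRing.induction_on_isQuotientEquivQuotientPrime R hF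
      (motive := fun F _ _ _ => (∀ x ∈ l, ∀ y : F, x • y = 0) → ExtVanish R F N j) ?_ ?_ ?_
    · intro F _ _ _ _ _
      refine of_smul_bijective (s := 1) ?_ (fun y => Subsingleton.elim _ _) j
      rw [show (fun y : N => (1 : R) • y) = id from funext (one_smul R)]
      exact Function.bijective_id
    · intro F _ _ _ q e hlF
      refine congr_left e.symm ?_
      by_cases hqp : q.1 ≤ p
      · rw [hmin q.1 q.2 (fun x hx => ?_) hqp]
        · exact key
        · refine Ideal.Quotient.eq_zero_iff_mem.1 ?_
          have := hlF x hx (e.symm 1)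
          rw [← map_smul, LinearEquiv.map_eq_zero_iff] at this
          rw [← this, Algebra.smul_def, mul_one]
          rfl
      · exact quotient_prime hN hqp j
    · intro F₁ _ _ _ F₂ _ _ _ F₃ _ _ _ f g hf hg hfg h₁ h₃ hlF
      refine left_middle hf hg hfg (h₁ fun x hx y => hf ?_) (h₃ fun x hx y => ?_)
      · rw [map_smul, hlF x hx, map_zero]
      · obtain ⟨y, rfl⟩ := hg y
        rw [← map_smul, hlF x hx, map_zero]

end PrimeLocal

section InjectiveCriterion

variable {R : Type u} [CommRing R]

theorem ExtVanish.smul_eq_zero {F N : Type u} [AddCommGroup F] [Module R F] [AddCommGroup N]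
    [Module R N] {x : R} (hx : IsSMulRegular F x) {n : ℕ}
    (h : ExtVanish R (F ⧸ LinearMap.range (x • LinearMap.id : F →ₗ[R] F)) N n)
    (z : Abelian.Ext (ModuleCat.of R F) (ModuleCat.of R N) n) (hz : x • z = 0) : z = 0 := by
  let m : F →ₗ[R] F := x • LinearMap.id
  have hm : Function.Injective m := hx
  have hS := exact_of_function_exact hm (Submodule.mkQ_surjective _)
    (LinearMap.exact_map_mkQ_range m)
  have hi : ModuleCat.ofHom m = x • 𝟙 (ModuleCat.of R F) := rfl
  obtain ⟨w, hw⟩ := Abelian.Ext.contravariant_sequence_exact₂ hS _ z (by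
    change (Abelian.Ext.mk₀ (ModuleCat.ofHom m)).comp z (zero_add n) = 0
    rw [hi, Abelian.Ext.mk₀_smul, Abelian.Ext.smul_comp, Abelian.Ext.mk₀_id_comp, hz])
  rw [← hw, h.elim w 0, Abelian.Ext.comp_zero]

theorem exists_pow_smul_linearMap_eq_zero {F N : Type*} [AddCommGroup F] [Module R F]
    [Module.Finite R F] [AddCommGroup N] [Module R N] {x : R}
    (h : ∀ y : N, ∃ n : ℕ, x ^ n • y = 0) (φ : F →ₗ[R] N) : ∃ n : ℕ, x ^ n • φ = 0 := by
  obtain ⟨t, ht⟩ := Module.Finite.fg_top (R := R) (M := F)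
  choose n hn using fun y : F => h (φ y)
  refine ⟨t.sum n, LinearMap.ker_eq_top.1 ?_⟩
  rw [eq_top_iff, ← ht, Submodule.span_le]
  intro y hy
  change x ^ t.sum n • φ y = 0
  obtain ⟨k, hk⟩ := Nat.exists_eq_add_of_le' (Finset.single_le_sum (f := n)
    (fun _ _ => Nat.zero_le _) hy)
  rw [hk, pow_add, mul_smul, hn, smul_zero]

variable [IsNoetherianRing R] {p : Ideal R} {N : Type u} [AddCommGroup N] [Module R N]

theorem ExtVanish.one_quotient_of_lt (hT : ∀ a ∈ p, ∀ y : N, ∃ n : ℕ, a ^ n • y = 0)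
    {q : Ideal R} [q.IsPrime] (hq : q < p)
    (h : ∀ J : Ideal R, q < J → ∀ (F : Type u) [AddCommGroup F] [Module R F], Module.Finite R F →
      (∀ a ∈ J, ∀ y : F, a • y = 0) → ExtVanish R F N 1) : ExtVanish R (R ⧸ q) N 1 := by
  obtain ⟨x, hxp, hxq⟩ := SetLike.exists_of_lt hq
  have hx : IsSMulRegular (R ⧸ q) x := by
    refine fun a b hab => ?_
    have h0 : Ideal.Quotient.mk q x ≠ 0 := fun h => hxq (Ideal.Quotient.eq_zero_iff_mem.1 h)
    exact mul_left_cancel₀ h0 hab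
  have key := smul_eq_zero (N := N) (n := 1) hx (h (q ⊔ Ideal.span {x}) ?_ _ inferInstance ?_)
  · obtain ⟨δ, hδ, -⟩ := exists_extClass (N := N) (Submodule.subtype_injective q)
      (Submodule.mkQ_surjective q) (LinearMap.exact_subtype_mkQ q) (of_projective 0)
    refine subsingleton_of_forall_eq 0 fun z => ?_
    obtain ⟨φ, rfl⟩ := hδ z
    obtain ⟨n, hn⟩ := exists_pow_smul_linearMap_eq_zero (hT x hxp) φ
    replace hn : x ^ n • δ φ = 0 := by rw [← map_smul, hn, map_zero]
    generalize δ φ = z at hn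
    induction n with
    | zero => simpa using hn
    | succ n ih =>
      rw [pow_succ', mul_smul] at hn
      exact ih (key _ hn)
  · exact lt_of_le_of_ne le_sup_left fun h0 => hxq
      (h0 ▸ Ideal.mem_sup_right (Ideal.mem_span_singleton_self x))
  · intro a ha y
    obtain ⟨y, rfl⟩ := Submodule.mkQ_surjective _ y
    obtain ⟨r, rfl⟩ := Ideal.Quotient.mk_surjective y
    obtain ⟨b, hb, c, hc, rfl⟩ := Submodule.mem_sup.1 ha
    obtain ⟨c, rfl⟩ := Ideal.mem_span_singleton'.1 hc
    rw [← map_smul]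
    refine (Submodule.Quotient.mk_eq_zero _).2 ⟨Ideal.Quotient.mk q (c * r), ?_⟩
    change Ideal.Quotient.mk q (x * (c * r)) = Ideal.Quotient.mk q ((b + c * x) * r)
    rw [Ideal.Quotient.eq]
    have : x * (c * r) - (b + c * x) * r = -(r * b) := by ring
    rw [this]
    exact q.neg_mem (q.mul_mem_left _ hb)

theorem ExtVanish.one_of_forall_smul_eq_zero
    (hN : ∀ s ∉ p, Function.Bijective fun y : N => s • y)
    (hT : ∀ a ∈ p, ∀ y : N, ∃ n : ℕ, a ^ n • y = 0) (hp : ExtVanish R (R ⧸ p) N 1) (J : Ideal R) :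
    ∀ (F : Type u) [AddCommGroup F] [Module R F], Module.Finite R F →
      (∀ a ∈ J, ∀ y : F, a • y = 0) → ExtVanish R F N 1 := by
  induction J using IsNoetherian.induction with
  | hgt J ih =>
  intro F _ _ hF hJ
  revert hJ
  refine IsNoetherianRing.induction_on_isQuotientEquivQuotientPrime R hF
    (motive := fun F _ _ _ => (∀ a ∈ J, ∀ y : F, a • y = 0) → ExtVanish R F N 1) ?_ ?_ ?_
  · intro F _ _ _ _ _
    exact of_projective 0
  · intro F _ _ _ q e hJ
    have hJq : J ≤ q.1 := by
      intro a ha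
      refine Ideal.Quotient.eq_zero_iff_mem.1 ?_
      have := hJ a ha (e.symm 1)
      rw [← map_smul, LinearEquiv.map_eq_zero_iff] at this
      rw [← this, Algebra.smul_def, mul_one]
      rfl
    refine congr_left e.symm ?_
    rcases hJq.lt_or_eq with hlt | rfl
    · refine ih _ hlt _ inferInstance fun a ha y => ?_
      obtain ⟨r, rfl⟩ := Ideal.Quotient.mk_surjective y
      exact Ideal.Quotient.eq_zero_iff_mem.2 (Ideal.mul_mem_right _ _ ha)
    · by_cases hqp : q.1 ≤ p
      · rcases hqp.lt_or_eq with hlt | heq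
        · exact one_quotient_of_lt hT hlt ih
        · rwa [heq]
      · exact quotient_prime hN hqp 1
  · intro F₁ _ _ _ F₂ _ _ _ F₃ _ _ _ f g hf hg hfg h₁ h₃ hlF
    refine left_middle hf hg hfg (h₁ fun x hx y => hf ?_) (h₃ fun x hx y => ?_)
    · rw [map_smul, hlF x hx, map_zero]
    · obtain ⟨y, rfl⟩ := hg y
      rw [← map_smul, hlF x hx, map_zero]

theorem injective_of_extVanish_quotient (hN : ∀ s ∉ p, Function.Bijective fun y : N => s • y)
    (hT : ∀ a ∈ p, ∀ y : N, ∃ n : ℕ, a ^ n • y = 0) (hp : ExtVanish R (R ⧸ p) N 1) :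
    Module.Injective R N := by
  refine Module.Baer.injective fun I φ => ?_
  obtain ⟨ψ, hψ⟩ := ExtVanish.exists_extension (Submodule.subtype_injective I)
    (Submodule.mkQ_surjective I) (LinearMap.exact_subtype_mkQ I)
    (ExtVanish.one_of_forall_smul_eq_zero hN hT hp ⊥ _ inferInstance fun a ha y => by
      rw [(Submodule.mem_bot R).1 ha, zero_smul]) φ
  exact ⟨ψ, fun x hx => LinearMap.congr_fun hψ ⟨x, hx⟩⟩

end InjectiveCriterion

section Hull

variable {R : Type u} [CommRing R] [IsNoetherianRing R] {p : Ideal R}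

theorem exists_injective_quotient {N : Type*} [AddCommGroup N] [Module R N]
    (hN : ∀ s ∉ p, ∀ y : N, s • y = 0 → y = 0) (hT : ∀ a ∈ p, ∀ y : N, ∃ n : ℕ, a ^ n • y = 0)
    {y : N} (hy : y ≠ 0) : ∃ ι : R ⧸ p →ₗ[R] N, Function.Injective ι := by
  obtain ⟨q, hq, -⟩ := exists_le_isAssociatedPrime_of_isNoetherianRing R y hy
  obtain ⟨hprime, ι, hι⟩ := (isAssociatedPrime_iff_exists_injective_linearMap _ _).1 hq
  have h1 (a : R) : a • ι 1 = 0 ↔ a ∈ q := by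
    rw [← map_smul, map_eq_zero_iff ι hι, Algebra.smul_def, mul_one]
    exact Ideal.Quotient.eq_zero_iff_mem
  have hqp : q = p := by
    refine le_antisymm (fun a ha => ?_) fun a ha => ?_
    · by_contra hap
      exact one_ne_zero (hι ((hN a hap _ ((h1 a).2 ha)).trans (map_zero ι).symm))
    · obtain ⟨n, hn⟩ := hT a ha (ι 1)
      exact hprime.mem_of_pow_mem n ((h1 _).1 hn)
  subst hqp
  exact ⟨ι, hι⟩

/-- An injective `p`-local `p`-torsion module `Y` is the injective hull of `R ⧸ p` as soon as the
maps from `D` to `Y` killed by a sequence in `p` are locally generated by one of them. -/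
theorem IsInjectiveHull.nonempty_equiv [p.IsPrime] {D Y E : Type u} [AddCommGroup D] [Module R D]
    [Module.Finite R D] (hD : Module.annihilator R D = ⊥) [AddCommGroup Y] [Module R Y]
    [AddCommGroup E] [Module R E] (hE : IsInjectiveHull R (R ⧸ p) E) (hY : Module.Injective R Y)
    [Nontrivial Y] (hN : ∀ s ∉ p, ∀ y : Y, s • y = 0 → y = 0)
    (hT : ∀ a ∈ p, ∀ y : Y, ∃ n : ℕ, a ^ n • y = 0) {l : List R} (hl : ∀ x ∈ l, x ∈ p)
    {v : D →ₗ[R] Y} (hv : ∀ x ∈ l, x • v = 0)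
    (hgen : ∀ f : D →ₗ[R] Y, (∀ x ∈ l, x • f = 0) → ∃ s ∉ p, ∃ r : R, s • f = r • v) :
    Nonempty (E ≃ₗ[R] Y) := by
  obtain ⟨hEinj, η, hη, hess⟩ := hE
  obtain ⟨y, hy⟩ := exists_ne (0 : Y)
  obtain ⟨ι, hι⟩ := exists_injective_quotient hN hT hy
  obtain ⟨j, hj⟩ := hY.out η hη ι
  have hjinj : Function.Injective j := by
    rw [← LinearMap.ker_eq_bot]
    by_contra hne
    refine hess _ hne ((Submodule.eq_bot_iff _).2 ?_)
    rintro _ ⟨hz, z, rfl⟩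
    have hz : j (η z) = 0 := hz
    rw [hj, map_eq_zero_iff ι hι] at hz
    rw [hz, map_zero]
  obtain ⟨r, hr⟩ := hEinj.out j hjinj LinearMap.id
  replace hr : ∀ z, r (j z) = z := hr
  by_cases hW : LinearMap.ker r = ⊥
  · exact ⟨LinearEquiv.ofBijective j
      ⟨hjinj, fun z => ⟨r z, LinearMap.ker_eq_bot.1 hW (hr _)⟩⟩⟩
  exfalso
  obtain ⟨w, hw, hw0⟩ := (Submodule.ne_bot_iff _).1 hW
  obtain ⟨ι', hι'⟩ := exists_injective_quotient (N := LinearMap.ker r) (p := p)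
    (fun s hs y hy => Subtype.ext (hN s hs y (congrArg Subtype.val hy)))
    (fun a ha y => (hT a ha y).imp fun n hn => Subtype.ext hn) (y := ⟨w, hw⟩)
    fun h => hw0 (congrArg Subtype.val h)
  obtain ⟨q, hq⟩ := exists_linearMap_ne_zero D hD p
  have hql : ∀ x ∈ l, x • q = 0 := fun x hx => LinearMap.ext fun d => by
    obtain ⟨a, ha⟩ := Ideal.Quotient.mk_surjective (q d)
    change x • q d = 0
    rw [← ha]
    exact Ideal.Quotient.eq_zero_iff_mem.2 (Ideal.mul_mem_right _ _ (hl x hx))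
  have hkill (k : R ⧸ p →ₗ[R] Y) (x : R) (hx : x ∈ l) : x • k ∘ₗ q = 0 := by
    rw [← LinearMap.comp_smul, hql x hx, LinearMap.comp_zero]
  have hne (k : R ⧸ p →ₗ[R] Y) (hk : Function.Injective k) : k ∘ₗ q ≠ 0 := fun h =>
    hq (LinearMap.ext fun d => hk ((LinearMap.congr_fun h d).trans (map_zero k).symm))
  let T : (D →ₗ[R] Y) →ₗ[R] (D →ₗ[R] Y) := LinearMap.compRight R (j ∘ₗ r)
  have hTf : T (Submodule.subtype _ ∘ₗ ι' ∘ₗ q) = 0 := LinearMap.ext fun d =>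
    show j (r (ι' (q d))) = 0 by rw [LinearMap.mem_ker.1 (ι' (q d)).2, map_zero]
  have hTg : T (ι ∘ₗ q) = ι ∘ₗ q := LinearMap.ext fun d =>
    show j (r (ι (q d))) = ι (q d) by rw [← hj, hr]
  have hinj (s : R) (hs : s ∉ p) (f : D →ₗ[R] Y) (hf : s • f = 0) : f = 0 :=
    LinearMap.ext fun d => hN s hs _ (LinearMap.congr_fun hf d)
  have hTT : T (T v) = T v := LinearMap.ext fun d =>
    show j (r (j (r (v d)))) = j (r (v d)) by rw [hr]
  obtain ⟨s, hs, a, ha⟩ := hgen (T v) fun x hx => by rw [← map_smul, hv x hx, map_zero]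
  by_cases hap : a ∈ p
  · have h1 : T v = 0 := by
      refine hinj (s - a) (fun h => hs ((Submodule.sub_mem_iff_left _ hap).1 h)) _ ?_
      have := congrArg T ha
      rw [map_smul, map_smul, hTT] at this
      rw [sub_smul, this, sub_self]
    obtain ⟨s', hs', b, hb⟩ := hgen _ (hkill ι)
    refine hne ι hι (hinj s' hs' _ ?_)
    rw [← hTg, ← map_smul, hb, map_smul, h1, smul_zero]
  · have h1 : T v = v := by
      refine sub_eq_zero.1 (hinj a hap _ ?_)
      have := congrArg T ha
      rw [map_smul, map_smul, hTT] at this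
      rw [smul_sub, ← this, ha, sub_self]
    obtain ⟨s', hs', b, hb⟩ := hgen _ (hkill (Submodule.subtype _ ∘ₗ ι'))
    refine hne (Submodule.subtype _ ∘ₗ ι') (Subtype.val_injective.comp hι') (hinj s' hs' _ ?_)
    rw [hb, ← h1, ← map_smul, ← hb, map_smul]
    exact (congrArg (s' • ·) hTf).trans (smul_zero s')

end Hull

section CohenMacaulay

open RingTheory.Sequence
open scoped Pointwise

theorem RingTheory.Sequence.IsWeaklyRegular.of_forall₂_isUnit_mul {A : Type*} [CommRing A]
    {rs l : List A} (hl : List.Forall₂ (fun a r => ∃ v, IsUnit v ∧ a = v * r) l rs)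
    {N : Type*} [AddCommGroup N] [Module A N] (h : IsWeaklyRegular N rs) :
    IsWeaklyRegular N l := by
  induction hl generalizing N with
  | nil => exact h
  | @cons a r l rs har _ ih =>
    obtain ⟨v, hv, rfl⟩ := har
    rw [isWeaklyRegular_cons_iff] at h ⊢
    refine ⟨fun x y hxy => h.1 (hv.smul_left_cancel.1 ?_), ?_⟩
    · simpa only [mul_smul] using hxy
    · have heq : r • (⊤ : Submodule A N) = (v * r) • ⊤ := by
        rw [← Submodule.ideal_span_singleton_smul, ← Submodule.ideal_span_singleton_smul,
          Ideal.span_singleton_mul_left_unit hv]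
      exact ((Submodule.quotEquivOfEq _ _ heq).isWeaklyRegular_congr l).1 (ih h.2)

theorem exists_list_forall₂_isUnit_mul {R : Type*} [CommRing R] (p : Ideal R) [p.IsPrime]
    (A : Type*) [CommRing A] [IsLocalRing A] [Algebra R A] [IsLocalization.AtPrime A p]
    (rs : List A) (hrs : ∀ r ∈ rs, r ∈ IsLocalRing.maximalIdeal A) :
    ∃ l : List R, (∀ x ∈ l, x ∈ p) ∧
      List.Forall₂ (fun a r => ∃ v, IsUnit v ∧ a = v * r) (l.map (algebraMap R A)) rs := by
  induction rs with
  | nil => exact ⟨[], by simp, by simp⟩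
  | cons r rs ih =>
    obtain ⟨l, hl, hl'⟩ := ih fun x hx => hrs x (List.mem_cons_of_mem _ hx)
    obtain ⟨⟨a, s⟩, hs⟩ := IsLocalization.surj p.primeCompl r
    refine ⟨a :: l, ?_, ?_⟩
    · rintro x (_ | ⟨_, hx⟩)
      · rw [← IsLocalization.AtPrime.to_map_mem_maximal_iff A p, ← hs]
        exact Ideal.mul_mem_right _ _ (hrs r List.mem_cons_self)
      · exact hl x hx
    · refine List.Forall₂.cons ⟨_, IsLocalization.map_units A s, ?_⟩ hl'
      rw [← hs, mul_comm]

theorem exists_mul_mem_of_map_le_map {R : Type*} [CommRing R] (S : Submonoid R)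
    (A : Type*) [CommRing A] [Algebra R A] [IsLocalization S A] {I L : Ideal R} (hI : I.FG)
    (h : I.map (algebraMap R A) ≤ L.map (algebraMap R A)) :
    ∃ s ∈ S, ∀ x ∈ I, s * x ∈ L := by
  induction I, hI using Submodule.fg_induction with
  | singleton x =>
    have hx := h (Ideal.mem_map_of_mem _ (Submodule.mem_span_singleton_self x))
    obtain ⟨s, hs, hsx⟩ := (IsLocalization.algebraMap_mem_map_algebraMap_iff S A L x).1 hx
    refine ⟨s, hs, fun y hy => ?_⟩
    obtain ⟨c, rfl⟩ := Submodule.mem_span_singleton.1 hy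
    rw [smul_eq_mul, mul_left_comm]
    exact Ideal.mul_mem_left _ _ hsx
  | sup I₁ I₂ _ _ h₁ h₂ =>
    obtain ⟨s, hs, hs'⟩ := h₁ ((Ideal.map_mono le_sup_left).trans h)
    obtain ⟨t, ht, ht'⟩ := h₂ ((Ideal.map_mono le_sup_right).trans h)
    refine ⟨s * t, mul_mem hs ht, fun y hy => ?_⟩
    obtain ⟨a, ha, b, hb, rfl⟩ := Submodule.mem_sup.1 hy
    rw [mul_add]
    refine add_mem ?_ ?_
    · rw [mul_comm s, mul_assoc]
      exact Ideal.mul_mem_left _ _ (hs' a ha)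
    · rw [mul_assoc]
      exact Ideal.mul_mem_left _ _ (ht' b hb)

theorem RingTheory.Sequence.IsRegular.exists_pow_mem_of_length {A : Type*} [CommRing A]
    [IsLocalRing A] [IsNoetherianRing A] {rs : List A} (hreg : IsRegular A rs)
    (hrs : ∀ r ∈ rs, r ∈ IsLocalRing.maximalIdeal A)
    (hlen : ringKrullDim A = rs.length) {a : A} (ha : a ∈ IsLocalRing.maximalIdeal A) :
    ∃ n : ℕ, a ^ n ∈ Ideal.ofList rs := by
  have hle : Ideal.ofList rs ≤ IsLocalRing.maximalIdeal A := Ideal.span_le.2 hrs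
  have : Nontrivial (A ⧸ Ideal.ofList rs) :=
    Ideal.Quotient.nontrivial_iff.2 (ne_top_of_le_ne_top (Ideal.IsPrime.ne_top inferInstance) hle)
  have : IsLocalRing (A ⧸ Ideal.ofList rs) :=
    IsLocalRing.of_surjective' _ Ideal.Quotient.mk_surjective
  have hdim := ringKrullDim_add_length_eq_ringKrullDim_of_isRegular rs hreg
  rw [hlen] at hdim
  have : Ring.KrullDimLE 0 (A ⧸ Ideal.ofList rs) := by
    rw [ringKrullDimZero_iff_ringKrullDim_eq_zero]
    have hb : ringKrullDim (A ⧸ Ideal.ofList rs) ≠ ⊥ := ringKrullDim_ne_bot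
    revert hdim hb
    generalize ringKrullDim (A ⧸ Ideal.ofList rs) = d
    intro hdim hb
    lift d to ℕ∞ using hb
    have hdim' : d + (rs.length : ℕ∞) = 0 + (rs.length : ℕ∞) := by
      rw [zero_add]
      exact_mod_cast hdim
    rw [(ENat.add_left_injective_of_ne_top (ENat.natCast_ne_top rs.length)) hdim']
    rfl
  have hnil : IsNilpotent (Ideal.Quotient.mk (Ideal.ofList rs) a) := by
    rw [Ring.KrullDimLE.isNilpotent_iff_mem_maximalIdeal, IsLocalRing.mem_maximalIdeal,
      mem_nonunits_iff]
    intro hu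
    obtain ⟨b, hb⟩ := hu.exists_right_inv
    obtain ⟨b, rfl⟩ := Ideal.Quotient.mk_surjective b
    rw [← map_mul, ← map_one (Ideal.Quotient.mk _), Ideal.Quotient.eq] at hb
    refine (IsLocalRing.maximalIdeal A).one_notMem ?_
    rw [← sub_sub_cancel (a * b) 1]
    exact sub_mem (Ideal.mul_mem_right _ _ ha) (hle hb)
  obtain ⟨n, hn⟩ := hnil
  rw [← map_pow] at hn
  exact ⟨n, Ideal.Quotient.eq_zero_iff_mem.1 hn⟩

theorem IsCohenMacaulayRing.exists_list {R : Type u} [CommRing R] [IsNoetherianRing R]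
    (hCM : IsCohenMacaulayRing R) {p : Ideal R} (hp : p.IsPrime) {h : ℕ}
    (hh : (h : ℕ∞) = Order.height (⟨p, hp⟩ : PrimeSpectrum R)) :
    ∃ l : List R, l.length = h ∧ (∀ x ∈ l, x ∈ p) ∧
      IsWeaklyRegular (LocalizedModule p.primeCompl R) l ∧
      (∃ ι : R ⧸ p →ₗ[R] R ⧸ Ideal.ofList l, Function.Injective ι) ∧
      ∃ s ∉ p, ∀ a ∈ p, ∃ n : ℕ, s * a ^ n ∈ Ideal.ofList l := by
  let A := Localization.AtPrime p
  have hdim : ringKrullDim A = (h : ℕ∞) := by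
    rw [IsLocalization.AtPrime.ringKrullDim_eq_height p A, hh,
      ← PrimeSpectrum.height_eq_orderHeight]
  have hdepth : localRingDepth A = h := WithBot.coe_injective ((hCM p hp).trans hdim)
  obtain ⟨rs, hrs, hreg, hlen⟩ : (h : ℕ∞) ∈ {n : ℕ∞ | ∃ rs : List A,
      (∀ r ∈ rs, r ∈ IsLocalRing.maximalIdeal A) ∧ IsRegular A rs ∧ (rs.length : ℕ∞) = n} := by
    have : Nonempty {n : ℕ∞ | ∃ rs : List A,
        (∀ r ∈ rs, r ∈ IsLocalRing.maximalIdeal A) ∧ IsRegular A rs ∧ (rs.length : ℕ∞) = n} :=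
      ⟨0, [], by simp, IsRegular.nil A A, by simp⟩
    rw [← hdepth]
    exact ENat.sSup_mem_of_nonempty_of_lt_top (hdepth.trans_lt (ENat.natCast_lt_top h))
  have hlen' : rs.length = h := by exact_mod_cast hlen
  obtain ⟨l, hl, hlrs⟩ := exists_list_forall₂_isUnit_mul p A rs hrs
  have hmap : Ideal.ofList rs ≤ (Ideal.ofList l).map (algebraMap R A) := by
    refine Ideal.span_le.2 fun r hr => ?_
    obtain ⟨i, hi, rfl⟩ := List.getElem_of_mem hr
    obtain ⟨v, hv, hvr⟩ := hlrs.get (i := i) (by rwa [hlrs.length_eq]) hi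
    have hi' : i < l.length := by rwa [← List.length_map (algebraMap R A), hlrs.length_eq]
    have hmem : l[i] ∈ l := List.getElem_mem _
    refine (Ideal.unit_mul_mem_iff_mem _ hv).1 ?_
    simp only [List.get_eq_getElem, List.getElem_map] at hvr
    rw [← hvr]
    exact Ideal.mem_map_of_mem _ (Ideal.subset_span hmem)
  obtain ⟨s, hs, hsl⟩ : ∃ s ∉ p, ∀ a ∈ p, ∃ n : ℕ, s * a ^ n ∈ Ideal.ofList l := by
    have hrad : p.map (algebraMap R A) ≤ ((Ideal.ofList l).map (algebraMap R A)).radical := by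
      refine Ideal.map_le_iff_le_comap.2 fun a ha => ?_
      obtain ⟨n, hn⟩ := hreg.exists_pow_mem_of_length hrs (by rw [hdim, ← hlen]; rfl)
        ((IsLocalization.AtPrime.to_map_mem_maximal_iff A p a).2 ha)
      exact ⟨n, hmap hn⟩
    obtain ⟨n, hn⟩ := Ideal.exists_pow_le_of_le_radical_of_fg hrad
      (IsNoetherian.noetherian _)
    rw [← Ideal.map_pow] at hn
    obtain ⟨s, hs, hsn⟩ := exists_mul_mem_of_map_le_map p.primeCompl A
      (IsNoetherian.noetherian (p ^ n)) hn
    exact ⟨s, hs, fun a ha => ⟨n, hsn _ (Ideal.pow_mem_pow ha n)⟩⟩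
  refine ⟨l, ?_, hl, ?_, ?_, s, hs, hsl⟩
  · rw [← hlen', ← hlrs.length_eq, List.length_map]
  · have h₁ := (isWeaklyRegular_map_algebraMap_iff A A l).1
      (hreg.toIsWeaklyRegular.of_forall₂_isUnit_mul hlrs)
    exact ((IsLocalizedModule.linearEquiv p.primeCompl (Algebra.linearMap R A)
      (LocalizedModule.mkLinearMap p.primeCompl R)).isWeaklyRegular_congr l).1 h₁
  · have hmin : p ∈ (Module.annihilator R (R ⧸ Ideal.ofList l)).minimalPrimes := by
      rw [Ideal.annihilator_quotient]
      refine ⟨⟨hp, Ideal.span_le.2 hl⟩, fun q ⟨hq, hlq⟩ hqp a ha => ?_⟩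
      obtain ⟨n, hn⟩ := hsl a ha
      exact hq.mem_of_pow_mem n
        ((hq.mem_or_mem (hlq hn)).resolve_left fun hsq => hs (hqp hsq))
    have hass := Module.associatedPrimes.minimalPrimes_annihilator_subset_associatedPrimes R _ hmin
    exact ((isAssociatedPrime_iff_exists_injective_linearMap _ _).1 hass).2

end CohenMacaulay

section Dualizing

open RingTheory.Sequence

variable {R : Type u} [CommRing R]

theorem IsSemidualizing.annihilator_eq_bot {D : Type u} [AddCommGroup D] [Module R D]
    (hD : IsSemidualizing R D) : Module.annihilator R D = ⊥ := by
  refine eq_bot_iff.2 fun r hr => (Submodule.mem_bot R).2 (hD.2.1.1 (LinearMap.ext fun d => ?_))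
  change r • d = (0 : R) • d
  rw [Module.mem_annihilator.1 hr d, zero_smul]

/-- The endomorphism ring of a semidualizing module, localized. -/
noncomputable def IsSemidualizing.localizationEquiv [IsNoetherianRing R] {D : Type u}
    [AddCommGroup D] [Module R D] (hD : IsSemidualizing R D) (S : Submonoid R) {A D' : Type*}
    [CommRing A] [Algebra R A] [IsLocalization S A] [AddCommGroup D'] [Module R D']
    (f : D →ₗ[R] D') [IsLocalizedModule S f] : A ≃ₗ[R] (D →ₗ[R] D') :=
  have _ : Module.Finite R D := hD.1
  have _ : Module.FinitePresentation R D := Module.finitePresentation_of_finite R D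
  have _ := isLocalizedModule_compRight S (F := D) f
  let e : R ≃ₗ[R] (D →ₗ[R] D) :=
    LinearEquiv.ofBijective ((LinearMap.lsmul R D : R →ₗ[R] D →ₗ[R] D)) hD.2.1
  have _ : IsLocalizedModule S (LinearMap.compRight R f ∘ₗ e.toLinearMap) :=
    IsLocalizedModule.of_linearEquiv_right S (LinearMap.compRight R f) e
  IsLocalizedModule.linearEquiv S (Algebra.linearMap R A)
    (LinearMap.compRight R f ∘ₗ e.toLinearMap : R →ₗ[R] (D →ₗ[R] D'))

/-- A chain ending at a module isomorphic to the given one. -/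
def LocChain.trans {Y Y' : ModuleCat.{u} R} (e : Y ≃ₗ[R] Y') :
    ∀ {l : List R} {N : ModuleCat.{u} R}, LocChain l N Y → LocChain l N Y'
  | _, _, nil e' => nil (e'.trans e)
  | _, _, cons s c => cons s (c.trans e)

theorem IsDualizing.nonempty_locChain [IsNoetherianRing R] {D : Type u} [AddCommGroup D]
    [Module R D] (hD : IsDualizing R D) {p : Ideal R} [p.IsPrime] {E : Type u} [AddCommGroup E]
    [Module R E] (hE : IsInjectiveHull R (R ⧸ p) E) {l : List R} (hl : ∀ x ∈ l, x ∈ p)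
    (hreg : IsWeaklyRegular (LocalizedModule p.primeCompl R) l)
    (hass : ∃ ι : R ⧸ p →ₗ[R] R ⧸ Ideal.ofList l, Function.Injective ι) {s : R} (hs : s ∉ p)
    (hsl : ∀ a ∈ p, ∃ n : ℕ, s * a ^ n ∈ Ideal.ofList l) :
    Nonempty (LocChain l (ModuleCat.of R (Localization.AtPrime p))
      (ModuleCat.of R (D →ₗ[R] E))) := by
  obtain ⟨hD, n, hn⟩ := hD
  have hfin : Module.Finite R D := hD.1
  let A := Localization.AtPrime p
  let D' := LocalizedModule p.primeCompl D
  let f : D →ₗ[R] D' := LocalizedModule.mkLinearMap p.primeCompl D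
  let e : A ≃ₗ[R] (D →ₗ[R] D') := hD.localizationEquiv p.primeCompl f
  have hDD (j : ℕ) : ExtVanish R D D' (j + 1) :=
    ExtVanish.localization p.primeCompl f j D (ExtVanish.of_ext (hD.2.2 (j + 1) (by omega)))
  have hD'n (F : Type u) [AddCommGroup F] [Module R F] (_ : Module.Finite R F) (j : ℕ)
      (hj : n < j) : ExtVanish R F D' j := by
    obtain ⟨j, rfl⟩ := Nat.exists_eq_succ_of_ne_zero (Nat.ne_zero_of_lt hj)
    exact ExtVanish.localization p.primeCompl f j F (InjDimLE.extVanish F hn _ hj)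
  have hD's (t : R) (ht : t ∉ p) : Function.Bijective fun y : D' => t • y :=
    smul_bijective_of_isLocalizedModule (S := p.primeCompl) f ht
  have hAs (t : R) (ht : t ∉ p) : Function.Bijective fun y : A => t • y :=
    smul_bijective_of_isLocalizedModule (S := p.primeCompl) (Algebra.linearMap R A) ht
  have hregA : IsWeaklyRegular A l := ((IsLocalizedModule.linearEquiv p.primeCompl
    (LocalizedModule.mkLinearMap p.primeCompl R)
    (Algebra.linearMap R A)).isWeaklyRegular_congr l).1 hreg
  obtain ⟨Y, ⟨c⟩, ⟨c'⟩⟩ := LocChain.exists_of_isWeaklyRegular D hD.annihilator_eq_bot l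
    (ModuleCat.of R D') hDD ((e.isWeaklyRegular_congr l).1 hregA)
  have c₁ : LocChain l (ModuleCat.of R A) (ModuleCat.of R (D →ₗ[R] Y)) := LocChain.ofEquiv e c'
  have hYs (t : R) (ht : t ∉ p) : Function.Bijective fun y : Y => t • y :=
    c.smul_bijective (hD's t ht)
  have hYT (a : R) (ha : a ∈ p) (y : Y) : ∃ m : ℕ, a ^ m • y = 0 := by
    obtain ⟨m, hm⟩ := mem_powTors_of_list hsl (hYs s hs).1 (y := y)
      fun b hb => c.pow_tors_of_mem hb y
    exact ⟨m, hm _ (Ideal.pow_mem_pow ha m)⟩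
  have hmin (q : Ideal R) (hq : q.IsPrime) (hlq : ∀ x ∈ l, x ∈ q) (hqp : q ≤ p) : q = p := by
    refine le_antisymm hqp fun a ha => ?_
    obtain ⟨m, hm⟩ := hsl a ha
    exact hq.mem_of_pow_mem m
      ((hq.mem_or_mem (Ideal.span_le.2 hlq hm)).resolve_left fun hsq => hs (hqp hsq))
  have hlF (a : R) (ha : a ∈ l) (y : R ⧸ p) : a • y = 0 := by
    obtain ⟨r, rfl⟩ := Ideal.Quotient.mk_surjective y
    exact Ideal.Quotient.eq_zero_iff_mem.2 (Ideal.mul_mem_right _ _ (hl a ha))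
  have hY : Module.Injective R Y := injective_of_extVanish_quotient hYs hYT
    (c.extVanish_of_smul_eq_zero hlF (ExtVanish.of_isWeaklyRegular hD's hreg hmin hass hD'n n
      (R ⧸ p) inferInstance hlF _ (by omega) (by omega)))
  obtain ⟨φ, hφ, hker⟩ := LocChain.exists_mem_range_iff l c₁
  let v : D →ₗ[R] Y := φ (1 : A)
  have hv : v ≠ 0 := by
    intro hv
    have h1 : (1 : A) ∈ Ideal.ofList l • (⊤ : Submodule R A) := hker hv
    have h2 : (1 : A) ∈ IsLocalRing.maximalIdeal A := by
      refine Submodule.smul_induction_on (p := fun y : A => y ∈ IsLocalRing.maximalIdeal A) h1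
        (fun r hr y _ => ?_) fun y z => add_mem
      rw [Algebra.smul_def]
      exact Ideal.mul_mem_right _ _
        ((IsLocalization.AtPrime.to_map_mem_maximal_iff A p r).2 (Ideal.span_le.2 hl hr))
    exact (IsLocalRing.maximalIdeal A).one_notMem h2
  have hnt : Nontrivial Y := by
    by_contra hY'
    have _ := not_nontrivial_iff_subsingleton.1 hY'
    exact hv (LinearMap.ext fun d => Subsingleton.elim _ _)
  obtain ⟨e'⟩ := IsInjectiveHull.nonempty_equiv hD.annihilator_eq_bot hE hY
    (fun t ht y hy => (hYs t ht).1 (hy.trans (smul_zero t).symm)) hYT hl (v := v)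
    ((hφ v).1 ⟨_, rfl⟩) fun g hg => by
      obtain ⟨a, rfl⟩ := (hφ g).2 hg
      obtain ⟨⟨r, t⟩, hrt⟩ := IsLocalization.surj p.primeCompl (a : A)
      refine ⟨t, t.2, r, ?_⟩
      rw [← map_smul, ← map_smul]
      refine congrArg φ ?_
      rw [Algebra.smul_def, Algebra.smul_def, mul_one, mul_comm]
      exact hrt
  exact ⟨c₁.trans (LinearEquiv.congrRight e'.symm : (D →ₗ[R] Y) ≃ₗ[R] (D →ₗ[R] E))⟩

end Dualizing

/-- Over a Cohen-Macaulay noetherian ring with dualizing module `D`, for a prime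
`p` of height `h` and any module `M`, `Tor_k^R(Hom_R(D, E_R(R/p)), M) ≅ H^{h-k}_p(M_p)
≅ H^{h-k}_{pR_p}(M_p)` for all `k` (for `k > h` both sides vanish). -/
theorem statement7 (R : Type u) [CommRing R] [IsNoetherianRing R]
    (hCM : IsCohenMacaulayRing R)
    (D : Type u) [AddCommGroup D] [Module R D] (hD : IsDualizing R D)
    (p : Ideal R) (hp : p.IsPrime)
    (E : Type u) [AddCommGroup E] [Module R E] (hE : IsInjectiveHull R (R ⧸ p) E)
    (M : Type u) [AddCommGroup M] [Module R M]
    (h : ℕ) (hh : (h : ℕ∞) = Order.height (⟨p, hp⟩ : PrimeSpectrum R)) :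
    (∀ k : ℕ, k ≤ h →
      Nonempty ((TorM R k (D →ₗ[R] E) M) ≃ₗ[R]
        ((localCohomology p (h - k)).obj
          (ModuleCat.of R (LocalizedModule p.primeCompl M)))) ∧
      Nonempty ((TorM R k (D →ₗ[R] E) M) ≃ₗ[R]
        ((ModuleCat.restrictScalars (algebraMap R (Localization.AtPrime p))).obj
          ((localCohomology (p.map (algebraMap R (Localization.AtPrime p))) (h - k)).obj
            (ModuleCat.of (Localization.AtPrime p) (LocalizedModule p.primeCompl M)))))) ∧
    (∀ k : ℕ, h < k → Subsingleton (TorM R k (D →ₗ[R] E) M)) := by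
  obtain ⟨l, rfl, hl, hreg, hass, s, hs, hsl⟩ := hCM.exists_list hp hh
  obtain ⟨c⟩ := hD.nonempty_locChain hE hl hreg hass hs hsl
  let A := Localization.AtPrime p
  have hAs (t : R) (ht : t ∉ p) : Function.Bijective fun y : A => t • y :=
    smul_bijective_of_isLocalizedModule (S := p.primeCompl) (Algebra.linearMap R A) ht
  have _ : Module.Flat R A := IsLocalization.flat A p.primeCompl
  have hX (x : D →ₗ[R] E) : x ∈ powTors p (D →ₗ[R] E) :=
    mem_powTors_of_list hsl (c.smul_bijective (hAs s hs)).1 fun a ha => c.pow_tors_of_mem ha x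
  have key := c.tor_equiv (J := p) hl hX (hAs s hs) hsl (ModuleCat.of R M)
  refine ⟨fun k hk => ?_, fun k => (key k).2⟩
  obtain ⟨e⟩ := (key k).1 hk
  let e₁ := e.trans (LocCoh.mapIso (J := p) ((LocalizedModule.equivTensorProduct p.primeCompl
    M).symm.restrictScalars R).toModuleIso (l.length - k))
  obtain ⟨e₂⟩ := LocCoh.nonempty_equiv_restrictScalars (A := A) p (l.length - k)
    (LocalizedModule p.primeCompl M)
  exact ⟨⟨e₁.trans (localCohomologyEquiv p _ _).symm⟩, ⟨e₁.trans e₂⟩⟩
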